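/- Let M ⊆ ℂ^N be a connected Stein manifold of complex dimension n+1 (n ≥ 1), let B ⊆ ℂ^n be a connected open set, and let p : M → B be a holomorphic map such that the Betti numbers b_0(t) and b_1(t) of every fibre p^{-1}(t) are finite. Let λ be a point in the interior of Im p ∖ closure(p(Sing p)). Assume that the Euler characteristic χ(t) = b_0(t) − b_1(t) is constant for t in some neighborhood of λ and that no connected component of p^{-1}(t) vanishes at infinity as t → λ. Then both Betti numbers b_0(t) and b_1(t) are constant for t in some (possibly smaller) neighborhood of λ. -/

import Mathlib

open Filter Set Topology

noncomputable section

/-- The singular chain complex of a topological space, with `ℚ` coefficients: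
the alternating face map complex of the free simplicial `ℚ`-module on the
singular simplicial set. -/
def singularChainComplex (X : Type) [TopologicalSpace X] : ChainComplex (ModuleCat ℚ) ℕ :=
  (AlgebraicTopology.alternatingFaceMapComplex (ModuleCat ℚ)).obj
    (((CategoryTheory.SimplicialObject.whiskering (Type) (ModuleCat ℚ)).obj
      (ModuleCat.free ℚ)).obj (TopCat.toSSet.obj (TopCat.of X)))

/-- Singular homology of a topological space with `ℚ` coefficients. -/
def singularHomology (X : Type) [TopologicalSpace X] (i : ℕ) : ModuleCat ℚ :=
  (singularChainComplex X).homology i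

/-- The `i`-th Betti number: the dimension over `ℚ` of the `i`-th singular
homology with `ℚ` coefficients. -/
def bettiNumber (X : Type) [TopologicalSpace X] (i : ℕ) : ℕ :=
  Module.finrank ℚ (singularHomology X i)

/-- The `i`-th Betti number is finite. -/
def FiniteBetti (X : Type) [TopologicalSpace X] (i : ℕ) : Prop :=
  FiniteDimensional ℚ (singularHomology X i)

/-- `Φ` and `Ψ` give mutually inverse smooth maps between `S ⊆ E` and `T ⊆ F`,
i.e. a diffeomorphism between `S` and `T` (smoothness of a map on a subset is
expressed via `ContDiffOn`). -/
def IsDiffeoOn {E F : Type} [NormedAddCommGroup E] [NormedSpace ℝ E]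
    [NormedAddCommGroup F] [NormedSpace ℝ F]
    (Φ : E → F) (Ψ : F → E) (S : Set E) (T : Set F) : Prop :=
  ContDiffOn ℝ (⊤ : ℕ∞) Φ S ∧ ContDiffOn ℝ (⊤ : ℕ∞) Ψ T ∧ Set.MapsTo Φ S T ∧ Set.MapsTo Ψ T S ∧
    Set.LeftInvOn Ψ Φ S ∧ Set.RightInvOn Ψ Φ T

/-- `S` and `T` are diffeomorphic. -/
def DiffeoEquiv {E F : Type} [NormedAddCommGroup E] [NormedSpace ℝ E]
    [NormedAddCommGroup F] [NormedSpace ℝ F] (S : Set E) (T : Set F) : Prop :=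
  ∃ Φ Ψ, IsDiffeoOn Φ Ψ S T

/-- The restriction of `p` to `M` is a trivial smooth fibration over `D` with fibre
`p⁻¹(lam) ∩ M`: there is a diffeomorphism `Φ : M ∩ p⁻¹(D) → D × (M ∩ p⁻¹(lam))`
with `pr₁ ∘ Φ = p`. -/
def IsSmoothTrivialFibrationOn {E F : Type} [NormedAddCommGroup E] [NormedSpace ℝ E]
    [NormedAddCommGroup F] [NormedSpace ℝ F]
    (p : E → F) (M : Set E) (D : Set F) (lam : F) : Prop :=
  ∃ Φ : E → F × E, ∃ Ψ : F × E → E,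
    IsDiffeoOn Φ Ψ (M ∩ p ⁻¹' D) (D ×ˢ (M ∩ p ⁻¹' {lam})) ∧
    ∀ x ∈ M ∩ p ⁻¹' D, (Φ x).1 = p x

/-- `lam` is not a bifurcation value of `p : M → B`. -/
def IsNotBifurcationValueOn {E F : Type} [NormedAddCommGroup E] [NormedSpace ℝ E]
    [NormedAddCommGroup F] [NormedSpace ℝ F]
    (p : E → F) (M : Set E) (B : Set F) (lam : F) : Prop :=
  ∃ D : Set F, IsOpen D ∧ lam ∈ D ∧ D ⊆ B ∧ IsSmoothTrivialFibrationOn p M D lam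

/-- `g : V → ℂᵏ` is a holomorphic local defining function for `M` at `x`, with
surjective derivative at every point of its zero set. -/
def IsLocalDefiningFunction {E : Type} [NormedAddCommGroup E] [NormedSpace ℂ E]
    (k : ℕ) (M : Set E) (x : E) (V : Set E) (g : E → (Fin k → ℂ)) : Prop :=
  IsOpen V ∧ x ∈ V ∧ DifferentiableOn ℂ g V ∧
    (∀ y ∈ V, g y = 0 → Function.Surjective (fderiv ℂ g y)) ∧
    M ∩ V = {y ∈ V | g y = 0}

/-- `M ⊆ ℂᴺ` is a (Stein) closed complex submanifold of complex dimension `m`: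
it is closed and near each of its points it is the zero set of a holomorphic
submersion to `ℂ^{N-m}`. -/
def IsSteinSubmanifold (N m : ℕ) (M : Set (Fin N → ℂ)) : Prop :=
  IsClosed M ∧ ∀ x ∈ M, ∃ V g, IsLocalDefiningFunction (N - m) M x V g

/-- A holomorphic map `p` (defined near `M`) is a submersion at `x ∈ M`: its
derivative maps the tangent space `T_x M = ker (d_x g)` onto the target, where
`g` is a local defining function of `M` near `x` (of codimension `k`). -/
def SubmersionAt {E F : Type} [NormedAddCommGroup E] [NormedSpace ℂ E]
    [NormedAddCommGroup F] [NormedSpace ℂ F]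
    (k : ℕ) (M : Set E) (p : E → F) (x : E) : Prop :=
  ∃ V g, IsLocalDefiningFunction k M x V g ∧
    Submodule.map (fderiv ℂ p x).toLinearMap
      (LinearMap.ker (fderiv ℂ g x).toLinearMap) = ⊤

/-- A connected component of the fibres of `p : M → B` vanishes at infinity as
`t → lam`: there are `t k → lam` in `B` and connected components
`C k = connectedComponentIn (M ∩ p⁻¹(t k)) (x k)` of the fibres over `t k`
which eventually miss every compact subset. -/
def HasVanishingComponentAtInfinity {E F : Type} [TopologicalSpace E] [TopologicalSpace F]
    (M : Set E) (p : E → F) (B : Set F) (lam : F) : Prop :=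
  ∃ t : ℕ → F, ∃ x : ℕ → E,
    (∀ k, t k ∈ B) ∧ Filter.Tendsto t Filter.atTop (nhds lam) ∧
    (∀ k, x k ∈ M ∩ p ⁻¹' {t k}) ∧
    ∀ K : Set E, IsCompact K →
      ∀ᶠ k in Filter.atTop, connectedComponentIn (M ∩ p ⁻¹' {t k}) (x k) ∩ K = ∅

/-- `Φ` and `Ψ` give mutually inverse continuous maps between `S` and `T`,
i.e. a homeomorphism between `S` and `T`. -/
def IsHomeoOn {E F : Type} [TopologicalSpace E] [TopologicalSpace F]
    (Φ : E → F) (Ψ : F → E) (S : Set E) (T : Set F) : Prop :=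
  ContinuousOn Φ S ∧ ContinuousOn Ψ T ∧ Set.MapsTo Φ S T ∧ Set.MapsTo Ψ T S ∧
    Set.LeftInvOn Ψ Φ S ∧ Set.RightInvOn Ψ Φ T

/-- The Euler characteristic `b₀ - b₁` of the fibre of `p : M → ·` over `t`
(the fibres under consideration are open curves, with no homology in degrees ≥ 2). -/
def eulerCharOn {E F : Type} [TopologicalSpace E] (p : E → F) (M : Set E) (t : F) : ℤ :=
  (bettiNumber ↥(M ∩ p ⁻¹' {t}) 0 : ℤ) - (bettiNumber ↥(M ∩ p ⁻¹' {t}) 1 : ℤ)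


section Algebra
open CategoryTheory

theorem hm_equiv (K : ChainComplex (ModuleCat ℚ) ℕ) (i j k : ℕ)
    (hi : (ComplexShape.down ℕ).prev j = i) (hk : (ComplexShape.down ℕ).next j = k) :
    Nonempty (K.homology j ≃ₗ[ℚ] (LinearMap.ker (K.d j k).hom ⧸
      (LinearMap.range (K.d i j).hom).comap (LinearMap.ker (K.d j k).hom).subtype)) := by
  have e1 : K.homology j ≅ (K.sc' i j k).homology :=
    ShortComplex.homologyMapIso (K.isoSc' i j k hi hk)
  have e2 := (K.sc' i j k).moduleCatHomologyIso
  have e3 := (e1 ≪≫ e2).toLinearEquiv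
  refine ⟨e3.trans (Submodule.quotEquivOfEq _ _ ?_)⟩
  ext x
  simp only [LinearMap.mem_range, Submodule.mem_comap, Subtype.ext_iff]
  rfl

theorem la_extract {C2 C1 C0 H : Type} [AddCommGroup C2] [Module ℚ C2] [AddCommGroup C1]
    [Module ℚ C1] [AddCommGroup C0] [Module ℚ C0] [AddCommGroup H] [Module ℚ H]
    (d2 : C2 →ₗ[ℚ] C1) (d1 : C1 →ₗ[ℚ] C0) (hd : ∀ c, d1 (d2 c) = 0)
    (e : H ≃ₗ[ℚ] (LinearMap.ker d1 ⧸ (LinearMap.range d2).comap (LinearMap.ker d1).subtype))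
    [FiniteDimensional ℚ H] :
    ∃ (z : Fin (Module.finrank ℚ H) → C1) (l : Fin (Module.finrank ℚ H) → (C1 →ₗ[ℚ] ℚ)),
      (∀ i, d1 (z i) = 0) ∧ (∀ j c, l j (d2 c) = 0) ∧
      ∀ i j, l j (z i) = if i = j then 1 else 0 := by
  classical
  let b := (Module.finBasis ℚ H).map e
  have hs := Submodule.mkQ_surjective ((LinearMap.range d2).comap (LinearMap.ker d1).subtype)
  choose z hz using fun i => hs (b i)
  have hl : ∀ j, ∃ l : C1 →ₗ[ℚ] ℚ, l ∘ₗ (LinearMap.ker d1).subtype =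
      b.coord j ∘ₗ Submodule.mkQ _ := fun j => LinearMap.exists_extend _
  choose l hl using hl
  refine ⟨fun i => (z i : C1), l, fun i => (z i).2, fun j c => ?_, fun i j => ?_⟩
  · have := LinearMap.congr_fun (hl j) ⟨d2 c, LinearMap.mem_ker.2 (hd c)⟩
    simp only [LinearMap.comp_apply, Submodule.subtype_apply] at this
    rw [this, Submodule.mkQ_apply, (Submodule.Quotient.mk_eq_zero _).2, map_zero]
    simp
  · have := LinearMap.congr_fun (hl j) (z i)
    simp only [LinearMap.comp_apply, Submodule.subtype_apply] at this
    rw [this, hz]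
    simp [Finsupp.single_apply]

theorem la_lower {C2 C1 C0 H : Type} [AddCommGroup C2] [Module ℚ C2] [AddCommGroup C1]
    [Module ℚ C1] [AddCommGroup C0] [Module ℚ C0] [AddCommGroup H] [Module ℚ H]
    (d2 : C2 →ₗ[ℚ] C1) (d1 : C1 →ₗ[ℚ] C0)
    (e : H ≃ₗ[ℚ] (LinearMap.ker d1 ⧸ (LinearMap.range d2).comap (LinearMap.ker d1).subtype))
    [FiniteDimensional ℚ H] (b : ℕ) (z : Fin b → C1) (hz : ∀ i, d1 (z i) = 0)
    (h : ∀ c : C2, ∃ l : Fin b → (C1 →ₗ[ℚ] ℚ), (∀ j, l j (d2 c) = 0) ∧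
      ∀ i j, l j (z i) = if i = j then 1 else 0) :
    b ≤ Module.finrank ℚ H := by
  classical
  let v : Fin b → H := fun i => e.symm (Submodule.Quotient.mk ⟨z i, hz i⟩)
  have hv : LinearIndependent ℚ v := by
    rw [Fintype.linearIndependent_iff]
    intro g hg j
    have h1 : ∑ i, g i • e (v i) = 0 := by
      have := congrArg e hg
      simpa using this
    simp only [v, LinearEquiv.apply_symm_apply] at h1
    have h2 : Submodule.Quotient.mk (p := (LinearMap.range d2).comap (LinearMap.ker d1).subtype)
        (∑ i, g i • (⟨z i, hz i⟩ : LinearMap.ker d1)) = 0 := by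
      rw [← h1]
      simp only [← Submodule.mkQ_apply, map_sum, map_smul]
    rw [Submodule.Quotient.mk_eq_zero] at h2
    obtain ⟨c, hc⟩ := h2
    obtain ⟨l, hl, hlz⟩ := h c
    have h3 := hl j
    rw [hc] at h3
    simp [hlz] at h3
    exact h3
  simpa using hv.fintype_card_le_finrank

theorem la_upper {C2 C1 C0 H : Type} [AddCommGroup C2] [Module ℚ C2] [AddCommGroup C1]
    [Module ℚ C1] [AddCommGroup C0] [Module ℚ C0] [AddCommGroup H] [Module ℚ H]
    (d2 : C2 →ₗ[ℚ] C1) (d1 : C1 →ₗ[ℚ] C0)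
    (e : H ≃ₗ[ℚ] (LinearMap.ker d1 ⧸ (LinearMap.range d2).comap (LinearMap.ker d1).subtype))
    (b : ℕ) (z : Fin b → C1) (hz : ∀ i, d1 (z i) = 0)
    (h : ∀ c : C1, c ∈ Submodule.span ℚ (Set.range z) ⊔ LinearMap.range d2) :
    Module.finrank ℚ H ≤ b := by
  classical
  let v : Fin b → H := fun i => e.symm (Submodule.Quotient.mk ⟨z i, hz i⟩)
  have hsp : Submodule.span ℚ (Set.range v) = ⊤ := by
    rw [eq_top_iff]
    rintro x -
    obtain ⟨y, hy⟩ := Submodule.mkQ_surjective _ (e x)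
    obtain ⟨a, ha, c, hc, hac⟩ := Submodule.mem_sup.1 (h y)
    obtain ⟨g, rfl⟩ := (Submodule.mem_span_range_iff_exists_fun ℚ).1 ha
    have : x = ∑ i, g i • v i := by
      apply e.injective
      rw [← hy, map_sum]
      simp only [map_smul, v, LinearEquiv.apply_symm_apply]
      simp only [← Submodule.mkQ_apply, ← map_smul, ← map_sum]
      rw [← sub_eq_zero, ← map_sub, Submodule.mkQ_apply, Submodule.Quotient.mk_eq_zero]
      simp only [Submodule.mem_comap, map_sub, Submodule.subtype_apply, map_sum, map_smul]
      rw [← hac]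
      simpa using hc
    rw [this]
    exact Submodule.sum_mem _ fun i _ => Submodule.smul_mem _ _ (Submodule.subset_span ⟨i, rfl⟩)
  have := finrank_range_le_card (R := ℚ) v
  rw [Set.finrank, hsp, finrank_top] at this
  simpa using this

end Algebra

/-- Singular simplices. -/
abbrev Smp (n : ℕ) (X : Type) [TopologicalSpace X] := C(stdSimplex ℝ (Fin (n + 1)), X)

/-- Faces of a singular simplex. -/
def face {n : ℕ} {X : Type} [TopologicalSpace X] (i : Fin (n + 2)) (s : Smp (n + 1) X) : Smp n X :=
  s.comp ⟨stdSimplex.map (Fin.succAbove i), stdSimplex.continuous_map _⟩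

/-- comparison of chain groups -/
def chEquiv (X : Type) [TopologicalSpace X] (n : ℕ) :
    (singularChainComplex X).X n ≃ₗ[ℚ] (Smp n X →₀ ℚ) :=
  Finsupp.domLCongr (TopCat.toSSetObjEquiv (TopCat.of X) (Opposite.op (SimplexCategory.mk n)))

/-- boundary -/
def bd (X : Type) [TopologicalSpace X] (n : ℕ) : (Smp (n + 1) X →₀ ℚ) →ₗ[ℚ] (Smp n X →₀ ℚ) :=
  Finsupp.lsum ℚ fun s => LinearMap.toSpanSingleton ℚ _
    (∑ i : Fin (n + 2), (-1 : ℚ) ^ (i : ℕ) • Finsupp.single (face i s) 1)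

theorem bd_single (X : Type) [TopologicalSpace X] (n : ℕ) (s : Smp (n+1) X) (q : ℚ) :
    bd X n (Finsupp.single s q) =
      q • ∑ i : Fin (n + 2), (-1 : ℚ) ^ (i : ℕ) • Finsupp.single (face i s) 1 := by
  simp [bd]

theorem afm_d (Y : CategoryTheory.SimplicialObject (ModuleCat ℚ)) (n : ℕ)
    (x : Y.obj (Opposite.op (SimplexCategory.mk (n+1)))) :
    (((AlgebraicTopology.alternatingFaceMapComplex (ModuleCat ℚ)).obj Y).d (n+1) n).hom x =
      ∑ i : Fin (n+2), (-1 : ℤ) ^ (i : ℕ) • (Y.δ i).hom x := by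
  have h : (((AlgebraicTopology.alternatingFaceMapComplex (ModuleCat ℚ)).obj Y).d (n+1) n) =
    ∑ i : Fin (n+2), (-1 : ℤ) ^ (i : ℕ) • (Y.δ i) := by
      rw [AlgebraicTopology.alternatingFaceMapComplex_obj_d,
        AlgebraicTopology.AlternatingFaceMapComplex.objD]
  have h' : (((AlgebraicTopology.alternatingFaceMapComplex (ModuleCat ℚ)).obj Y).d (n+1) n).hom =
    ∑ i : Fin (n+2), (-1 : ℤ) ^ (i : ℕ) • (Y.δ i).hom := by
      rw [h]
      exact (ModuleCat.hom_sum _ _).trans (Finset.sum_congr rfl fun i _ => ModuleCat.hom_zsmul _ _)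
  exact (LinearMap.congr_fun h' x).trans (LinearMap.sum_apply _ _ _)

theorem chEquiv_d (X : Type) [TopologicalSpace X] (n : ℕ) (c : (singularChainComplex X).X (n+1)) :
    chEquiv X n (((singularChainComplex X).d (n+1) n).hom c) = bd X n (chEquiv X (n+1) c) := by
  have : (chEquiv X n).toLinearMap ∘ₗ ((singularChainComplex X).d (n+1) n).hom =
    bd X n ∘ₗ (chEquiv X (n+1)).toLinearMap := by
    refine Finsupp.lhom_ext fun s q => ?_
    have h1 : ∀ i : Fin (n+2), chEquiv X n (((((CategoryTheory.SimplicialObject.whiskering (Type)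
        (ModuleCat ℚ)).obj (ModuleCat.free ℚ)).obj
          (TopCat.toSSet.obj (TopCat.of X))).δ i).hom (Finsupp.single s q)) =
        Finsupp.single (face i (TopCat.toSSetObjEquiv (TopCat.of X)
          (Opposite.op (SimplexCategory.mk (n+1))) s)) q := by
      intro i
      have h0 : ((((CategoryTheory.SimplicialObject.whiskering (Type)
        (ModuleCat ℚ)).obj (ModuleCat.free ℚ)).obj
          (TopCat.toSSet.obj (TopCat.of X))).δ i).hom (Finsupp.single s q) =
          Finsupp.single ((TopCat.toSSet.obj (TopCat.of X)).δ i s) q :=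
        Finsupp.mapDomain_single
      rw [h0]
      exact Finsupp.equivMapDomain_single _ _ _
    have h2 := afm_d (((CategoryTheory.SimplicialObject.whiskering (Type)
        (ModuleCat ℚ)).obj (ModuleCat.free ℚ)).obj
          (TopCat.toSSet.obj (TopCat.of X))) n (Finsupp.single s q)
    have h3 : (chEquiv X (n+1)) (Finsupp.single s q) = Finsupp.single
      (TopCat.toSSetObjEquiv (TopCat.of X) (Opposite.op (SimplexCategory.mk (n+1))) s) q :=
      Finsupp.equivMapDomain_single _ _ _
    refine (congrArg (chEquiv X n) h2).trans ?_
    refine Eq.trans ?_ (congrArg (bd X n) h3).symm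
    rw [bd_single, Finset.smul_sum]
    refine (map_sum (chEquiv X n) _ _).trans ?_
    refine Finset.sum_congr rfl fun i _ => ?_
    refine (map_zsmul (chEquiv X n) _ _).trans ?_
    refine (congrArg (fun z => (-1 : ℤ) ^ (i : ℕ) • z) (h1 i)).trans ?_
    rw [smul_comm, Finsupp.smul_single_one]
    rcases Nat.even_or_odd (i : ℕ) with h | h <;> simp [h.neg_one_pow]
  exact LinearMap.congr_fun this c

theorem hm1_equiv (X : Type) [TopologicalSpace X] :
    Nonempty (singularHomology X 1 ≃ₗ[ℚ] (LinearMap.ker (bd X 0) ⧸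
      (LinearMap.range (bd X 1)).comap (LinearMap.ker (bd X 0)).subtype)) := by
  obtain ⟨e⟩ := hm_equiv (singularChainComplex X) 2 1 0 (by simp) (by simp)
  have hk : (LinearMap.ker ((singularChainComplex X).d 1 0).hom).map (chEquiv X 1).toLinearMap =
      LinearMap.ker (bd X 0) := by
    ext c
    constructor
    · rintro ⟨a, ha, rfl⟩
      have ha' : ((singularChainComplex X).d 1 0).hom a = 0 := ha
      have := chEquiv_d X 0 a
      rw [ha', map_zero] at this
      exact this.symm
    · intro hc
      refine ⟨(chEquiv X 1).symm c, ?_, by simp⟩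
      have := chEquiv_d X 0 ((chEquiv X 1).symm c)
      rw [LinearEquiv.apply_symm_apply, LinearMap.mem_ker.1 hc] at this
      exact (chEquiv X 0).map_eq_zero_iff.1 this
  let E := (chEquiv X 1).submoduleMap (LinearMap.ker ((singularChainComplex X).d 1 0).hom) ≪≫ₗ
    LinearEquiv.ofEq _ _ hk
  have hE : ∀ x, ((E x : LinearMap.ker (bd X 0)) : Smp 1 X →₀ ℚ) = chEquiv X 1 x := fun x => rfl
  refine ⟨e.trans (Submodule.Quotient.equiv _ _ E ?_)⟩
  ext c
  constructor
  · rintro ⟨a, ⟨b, hb⟩, rfl⟩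
    refine ⟨chEquiv X 2 b, ?_⟩
    rw [← chEquiv_d X 1 b, hb]
    rfl
  · rintro ⟨b, hb⟩
    refine ⟨E.symm c, ⟨(chEquiv X 2).symm b, ?_⟩, by simp⟩
    apply (chEquiv X 1).injective
    rw [chEquiv_d X 1, LinearEquiv.apply_symm_apply, hb]
    have := hE (E.symm c)
    rw [LinearEquiv.apply_symm_apply] at this
    exact this

theorem hm0_equiv (X : Type) [TopologicalSpace X] :
    Nonempty (singularHomology X 0 ≃ₗ[ℚ] (LinearMap.ker (0 : (Smp 0 X →₀ ℚ) →ₗ[ℚ] ℚ) ⧸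
      (LinearMap.range (bd X 0)).comap
        (LinearMap.ker (0 : (Smp 0 X →₀ ℚ) →ₗ[ℚ] ℚ)).subtype)) := by
  obtain ⟨e⟩ := hm_equiv (singularChainComplex X) 1 0 0 (by simp) (by simp)
  have hk : (LinearMap.ker ((singularChainComplex X).d 0 0).hom).map (chEquiv X 0).toLinearMap =
      LinearMap.ker (0 : (Smp 0 X →₀ ℚ) →ₗ[ℚ] ℚ) := by
    have : ((singularChainComplex X).d 0 0) = 0 :=
      (singularChainComplex X).shape _ _ (by simp)
    rw [this]
    ext c
    constructor
    · intro _
      simp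
    · intro hc
      exact ⟨(chEquiv X 0).symm c, by simp, by simp⟩
  let E := (chEquiv X 0).submoduleMap (LinearMap.ker ((singularChainComplex X).d 0 0).hom) ≪≫ₗ
    LinearEquiv.ofEq _ _ hk
  have hE : ∀ x, ((E x : LinearMap.ker (0 : (Smp 0 X →₀ ℚ) →ₗ[ℚ] ℚ)) : Smp 0 X →₀ ℚ)
    = chEquiv X 0 x := fun x => rfl
  refine ⟨e.trans (Submodule.Quotient.equiv _ _ E ?_)⟩
  ext c
  constructor
  · rintro ⟨a, ⟨b, hb⟩, rfl⟩
    refine ⟨chEquiv X 1 b, ?_⟩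
    rw [← chEquiv_d X 0 b, hb]
    rfl
  · rintro ⟨b, hb⟩
    refine ⟨E.symm c, ⟨(chEquiv X 1).symm b, ?_⟩, by simp⟩
    apply (chEquiv X 0).injective
    rw [chEquiv_d X 0, LinearEquiv.apply_symm_apply, hb]
    have := hE (E.symm c)
    rw [LinearEquiv.apply_symm_apply] at this
    exact this

section Raw
variable {E : Type} [TopologicalSpace E]

/-- raw paths in `X` -/
def IsP (X : Set E) (γ : ℝ → E) : Prop := ContinuousOn γ (Icc 0 1) ∧ MapsTo γ (Icc 0 1) X

/-- the standard triangle -/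
def T2 : Set (ℝ × ℝ) := {w | 0 ≤ w.1 ∧ 0 ≤ w.2 ∧ w.1 + w.2 ≤ 1}

theorem smp_mem (s : stdSimplex ℝ (Fin 2)) : s 1 ∈ Icc (0:ℝ) 1 :=
  ⟨stdSimplex.zero_le s 1, stdSimplex.le_one s 1⟩

theorem smp_cont {n : ℕ} (i : Fin n) : Continuous fun s : stdSimplex ℝ (Fin n) => s i :=
  (continuous_apply i).comp continuous_subtype_val

/-- simplex of a path -/
def toS {X : Set E} {γ : ℝ → E} (h : IsP X γ) : Smp 1 X where
  toFun s := ⟨γ (s 1), h.2 (smp_mem s)⟩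
  continuous_toFun := Continuous.subtype_mk (h.1.comp_continuous (smp_cont 1) smp_mem) _

theorem mk_mem {t : ℝ} (h : t ∈ Icc (0:ℝ) 1) : ![1 - t, t] ∈ stdSimplex ℝ (Fin 2) := by
  refine ⟨fun i => ?_, by simp [Fin.sum_univ_two]⟩
  fin_cases i
  · simpa using h.2
  · simpa using h.1

theorem mk3_mem {w : ℝ × ℝ} (h : w ∈ T2) : ![1 - w.1 - w.2, w.1, w.2] ∈ stdSimplex ℝ (Fin 3) := by
  obtain ⟨h1, h2, h3⟩ := h
  refine ⟨fun i => ?_, by simp [Fin.sum_univ_three]; ring⟩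
  fin_cases i
  · simp; linarith
  · simpa using h1
  · simpa using h2

open Classical in
/-- path of a simplex -/
def ofS {X : Set E} (σ : Smp 1 X) (t : ℝ) : E :=
  if h : t ∈ Icc (0:ℝ) 1 then (σ ⟨_, mk_mem h⟩ : E) else (σ ⟨_, mk_mem (by simp : (0:ℝ) ∈ Icc (0:ℝ) 1)⟩ : E)

open Classical in
/-- raw triangle of a simplex -/
def ofT {X : Set E} (σ : Smp 2 X) (t : ℝ × ℝ) : E :=
  if h : t ∈ T2 then (σ ⟨_, mk3_mem h⟩ : E) else (σ ⟨_, mk3_mem (by simp [T2] : (0:ℝ×ℝ) ∈ T2)⟩ : E)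

theorem ofS_isP {X : Set E} (σ : Smp 1 X) : IsP X (ofS σ) := by
  constructor
  · rw [continuousOn_iff_continuous_domRestrict]
    have : (Icc (0:ℝ) 1).domRestrict (ofS σ) = fun t => (σ ⟨_, mk_mem t.2⟩ : E) := by
      ext t
      simp only [domRestrict_apply, ofS, dif_pos t.2]
    rw [this]
    refine continuous_subtype_val.comp (σ.continuous.comp (Continuous.subtype_mk ?_ _))
    refine continuous_pi fun i => ?_
    fin_cases i <;> simp <;> fun_prop
  · intro t ht
    rw [ofS, dif_pos ht]
    exact Subtype.coe_prop _

theorem ofT_isP {X : Set E} (σ : Smp 2 X) : ContinuousOn (ofT σ) T2 ∧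
    ∀ t ∈ T2, ofT σ t ∈ (Subtype.val '' range σ) := by
  constructor
  · rw [continuousOn_iff_continuous_domRestrict]
    have : (T2 : Set (ℝ × ℝ)).domRestrict (ofT σ) = fun t => (σ ⟨_, mk3_mem t.2⟩ : E) := by
      ext t
      simp only [domRestrict_apply, ofT, dif_pos t.2]
    rw [this]
    refine continuous_subtype_val.comp (σ.continuous.comp (Continuous.subtype_mk ?_ _))
    refine continuous_pi fun i => ?_
    fin_cases i <;> simp <;> fun_prop
  · intro t ht
    rw [ofT, dif_pos ht]
    exact ⟨_, ⟨_, rfl⟩, rfl⟩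

theorem toS_ofS {X : Set E} (σ : Smp 1 X) : toS (ofS_isP σ) = σ := by
  ext s
  have : ofS σ (s 1) = σ s := by
    rw [ofS, dif_pos (smp_mem s)]
    congr 2
    apply Subtype.ext
    funext i
    have : s.1 0 + s.1 1 = 1 := stdSimplex.add_eq_one s
    fin_cases i
    · show 1 - s.1 1 = s.1 0
      linarith
    · rfl
  exact this

theorem ofS_toS {X : Set E} {γ : ℝ → E} (h : IsP X γ) : EqOn (ofS (toS h)) γ (Icc 0 1) := by
  intro t ht
  rw [ofS, dif_pos ht]
  simp [toS]
  rfl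

/-- 2-simplex of a raw triangle. -/
def toT {X : Set E} {φ : ℝ × ℝ → E} (h : ContinuousOn φ T2) (h' : MapsTo φ T2 X) : Smp 2 X where
  toFun s := ⟨φ (s 1, s 2), h' ⟨stdSimplex.zero_le s 1, stdSimplex.zero_le s 2, by
    have := stdSimplex.sum_eq_one s
    rw [Fin.sum_univ_three] at this
    have h0 := stdSimplex.zero_le s 0
    dsimp only
    linarith⟩⟩
  continuous_toFun := Continuous.subtype_mk (h.comp_continuous
    ((smp_cont 1).prodMk (smp_cont 2)) fun s => ⟨stdSimplex.zero_le s 1, stdSimplex.zero_le s 2, by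
    have := stdSimplex.sum_eq_one s
    rw [Fin.sum_univ_three] at this
    have h0 := stdSimplex.zero_le s 0
    dsimp only
    linarith⟩) _

theorem map_sa0 (s : stdSimplex ℝ (Fin 2)) : ⇑(stdSimplex.map (Fin.succAbove (0 : Fin 3)) s) =
    ![0, s 0, s 1] := by
  ext i
  rw [stdSimplex.map_coe, FunOnFinite.linearMap_apply_apply, Finset.sum_filter, Fin.sum_univ_two]
  fin_cases i <;> simp [Fin.succAbove, Fin.lt_def, Fin.ext_iff]

theorem map_sa1 (s : stdSimplex ℝ (Fin 2)) : ⇑(stdSimplex.map (Fin.succAbove (1 : Fin 3)) s) =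
    ![s 0, 0, s 1] := by
  ext i
  rw [stdSimplex.map_coe, FunOnFinite.linearMap_apply_apply, Finset.sum_filter, Fin.sum_univ_two]
  fin_cases i <;> simp [Fin.succAbove, Fin.lt_def, Fin.ext_iff]

theorem map_sa2 (s : stdSimplex ℝ (Fin 2)) : ⇑(stdSimplex.map (Fin.succAbove (2 : Fin 3)) s) =
    ![s 0, s 1, 0] := by
  ext i
  rw [stdSimplex.map_coe, FunOnFinite.linearMap_apply_apply, Finset.sum_filter, Fin.sum_univ_two]
  fin_cases i <;> simp [Fin.succAbove, Fin.lt_def, Fin.ext_iff]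

/-- raw edges of triangle -/
def edg0 (φ : ℝ × ℝ → E) (t : ℝ) : E := φ (1 - t, t)
/-- raw edges of triangle -/
def edg1 (φ : ℝ × ℝ → E) (t : ℝ) : E := φ (0, t)
/-- raw edges of triangle -/
def edg2 (φ : ℝ × ℝ → E) (t : ℝ) : E := φ (t, 0)

theorem edg_isP {X : Set E} {φ : ℝ × ℝ → E} (h : ContinuousOn φ T2) (h' : MapsTo φ T2 X) :
    IsP X (edg0 φ) ∧ IsP X (edg1 φ) ∧ IsP X (edg2 φ) := by
  have h0 : MapsTo (fun t : ℝ => (1 - t, t)) (Icc 0 1) T2 := by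
    rintro t ⟨h1, h2⟩; exact ⟨by simpa using h2, h1, by simp⟩
  have h1 : MapsTo (fun t : ℝ => ((0:ℝ), t)) (Icc 0 1) T2 := by
    rintro t ⟨h1, h2⟩; exact ⟨by simp, h1, by simpa using h2⟩
  have h2 : MapsTo (fun t : ℝ => (t, (0:ℝ))) (Icc 0 1) T2 := by
    rintro t ⟨h1, h2⟩; exact ⟨h1, by simp, by simpa using h2⟩
  exact ⟨⟨h.comp (by fun_prop) h0, h'.comp h0⟩, ⟨h.comp (by fun_prop) h1, h'.comp h1⟩,
    ⟨h.comp (by fun_prop) h2, h'.comp h2⟩⟩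

theorem face_toT {X : Set E} {φ : ℝ × ℝ → E} (h : ContinuousOn φ T2) (h' : MapsTo φ T2 X) :
    face 0 (toT h h') = toS (edg_isP h h').1 ∧ face 1 (toT h h') = toS (edg_isP h h').2.1 ∧
    face 2 (toT h h') = toS (edg_isP h h').2.2 := by
  refine ⟨?_, ?_, ?_⟩ <;> ext s
  · have := stdSimplex.add_eq_one s
    show φ (stdSimplex.map (Fin.succAbove (0 : Fin 3)) s 1,
      stdSimplex.map (Fin.succAbove (0 : Fin 3)) s 2) = φ (1 - s 1, s 1)
    rw [map_sa0, show 1 - s 1 = s 0 by linarith]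
    rfl
  · show φ (stdSimplex.map (Fin.succAbove (1 : Fin 3)) s 1,
      stdSimplex.map (Fin.succAbove (1 : Fin 3)) s 2) = φ (0, s 1)
    rw [map_sa1]
    rfl
  · show φ (stdSimplex.map (Fin.succAbove (2 : Fin 3)) s 1,
      stdSimplex.map (Fin.succAbove (2 : Fin 3)) s 2) = φ (s 1, 0)
    rw [map_sa2]
    rfl

theorem toT_ofT {X : Set E} (σ : Smp 2 X) : toT (ofT_isP σ).1
    (fun t ht => by obtain ⟨a, -, h⟩ := (ofT_isP σ).2 t ht; rw [← h]; exact a.2) = σ := by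
  ext s
  have hs := stdSimplex.sum_eq_one s
  rw [Fin.sum_univ_three] at hs
  have : ofT σ (s 1, s 2) = σ s := by
    rw [ofT, dif_pos ⟨stdSimplex.zero_le s 1, stdSimplex.zero_le s 2, by
      have h0 := stdSimplex.zero_le s 0
      dsimp only
      linarith⟩]
    congr 2
    apply Subtype.ext
    funext i
    have hs' : s.1 0 + s.1 1 + s.1 2 = 1 := hs
    fin_cases i
    · show 1 - s.1 1 - s.1 2 = s.1 0
      linarith
    · rfl
    · rfl
  exact this

/-- value of a 0-simplex -/
def pt0 {X : Type} [TopologicalSpace X] (s : Smp 0 X) : X := s (stdSimplex.vertex 0)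

theorem pt0_face {X : Set E} (s : Smp 1 X) : (pt0 (face 0 s)).1 = ofS s 1 ∧
    (pt0 (face 1 s)).1 = ofS s 0 := by
  constructor
  · rw [ofS, dif_pos (by simp)]
    simp only [pt0, face, ContinuousMap.comp_apply, ContinuousMap.coe_mk, stdSimplex.map_vertex]
    congr 2
    apply Subtype.ext; funext i; fin_cases i <;> simp
  · rw [ofS, dif_pos (by simp)]
    simp only [pt0, face, ContinuousMap.comp_apply, ContinuousMap.coe_mk, stdSimplex.map_vertex]
    congr 2
    apply Subtype.ext; funext i; fin_cases i <;> simp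

theorem pt0_inj {X : Type} [TopologicalSpace X] {s t : Smp 0 X} (h : pt0 s = pt0 t) : s = t := by
  ext x
  have : x = stdSimplex.vertex 0 := Subsingleton.elim (α := stdSimplex ℝ (Fin 1)) _ _
  rw [this]; exact h

/-- constant 0-simplex -/
def c0 {X : Type} [TopologicalSpace X] (x : X) : Smp 0 X := ContinuousMap.const _ x

theorem pt0_c0 {X : Type} [TopologicalSpace X] (x : X) : pt0 (c0 x) = x := rfl

theorem bd_bd (X : Type) [TopologicalSpace X] (c : Smp 2 X →₀ ℚ) : bd X 0 (bd X 1 c) = 0 := by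
  have h := chEquiv_d X 1 ((chEquiv X 2).symm c)
  rw [LinearEquiv.apply_symm_apply] at h
  rw [← h, ← chEquiv_d X 0]
  have := LinearMap.congr_fun (congrArg ModuleCat.Hom.hom ((singularChainComplex X).d_comp_d 2 1 0))
    ((chEquiv X 2).symm c)
  exact (congrArg (chEquiv X 0) this).trans (map_zero _)

theorem bd1_single (X : Type) [TopologicalSpace X] (s : Smp 2 X) (q : ℚ) :
    bd X 1 (Finsupp.single s q) = Finsupp.single (face 0 s) q - Finsupp.single (face 1 s) q
      + Finsupp.single (face 2 s) q := by
  rw [bd_single, Fin.sum_univ_three]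
  simp [smul_add, sub_eq_add_neg]

theorem bd0_single (X : Type) [TopologicalSpace X] (s : Smp 1 X) (q : ℚ) :
    bd X 0 (Finsupp.single s q) = Finsupp.single (face 0 s) q - Finsupp.single (face 1 s) q := by
  rw [bd_single, Fin.sum_univ_two]
  simp [smul_add, sub_eq_add_neg]

open Classical in
/-- Interface A. -/
theorem ifA (X : Set E) (hX : FiniteBetti ↥X 1) :
    ∃ (m : ℕ) (γ : Fin m → ℝ → E) (q : Fin (bettiNumber X 1) → Fin m → ℚ)
      (L : Fin (bettiNumber X 1) → (ℝ → E) → ℚ),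
      (∀ k, IsP X (γ k)) ∧ (∀ i (u : E → ℚ), ∑ k, q i k * (u (γ k 1) - u (γ k 0)) = 0) ∧
      (∀ j (φ : ℝ × ℝ → E), ContinuousOn φ T2 → MapsTo φ T2 X →
        L j (edg0 φ) - L j (edg1 φ) + L j (edg2 φ) = 0) ∧
      (∀ j γ γ', EqOn γ γ' (Icc 0 1) → L j γ = L j γ') ∧
      ∀ i j, ∑ k, q i k * L j (γ k) = if i = j then 1 else 0 := by
  obtain ⟨e⟩ := hm1_equiv X
  have : FiniteDimensional ℚ (singularHomology X 1) := hX
  obtain ⟨z, l, hz, hl, hzl⟩ : ∃ (z : Fin (bettiNumber X 1) → (Smp 1 X →₀ ℚ))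
      (l : Fin (bettiNumber X 1) → ((Smp 1 X →₀ ℚ) →ₗ[ℚ] ℚ)),
      (∀ i, bd X 0 (z i) = 0) ∧ (∀ j c, l j (bd X 1 c) = 0) ∧
      ∀ i j, l j (z i) = if i = j then 1 else 0 := by
    have := la_extract (bd X 1) (bd X 0) (bd_bd X) e
    obtain ⟨z, l, h1, h2, h3⟩ := this
    exact ⟨z, l, h1, h2, h3⟩
  set S : Finset (Smp 1 X) := Finset.univ.biUnion fun i => (z i).support with hS
  have hsum : ∀ i (w : Smp 1 X → ℚ), ∑ k : Fin S.card, z i (S.equivFin.symm k) *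
      w (S.equivFin.symm k) = (z i).sum fun s r => r * w s := by
    intro i w
    rw [Equiv.sum_comp S.equivFin.symm (fun s => z i s * w s),
      Finset.sum_coe_sort S (fun s => z i s * w s), Finsupp.sum]
    symm
    apply Finset.sum_subset
    · intro s hs
      exact Finset.mem_biUnion.2 ⟨i, Finset.mem_univ _, hs⟩
    · intro s _ hs
      rw [Finsupp.notMem_support_iff.1 hs, zero_mul]
  let LL : Fin (bettiNumber X 1) → (ℝ → E) → ℚ := fun j γ =>
    if h : IsP X γ then l j (Finsupp.single (toS h) 1) else 0
  have hcongr : ∀ j γ γ', EqOn γ γ' (Icc 0 1) → LL j γ = LL j γ' := by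
    intro j γ γ' h
    have hiff : IsP X γ ↔ IsP X γ' := by
      constructor
      · rintro ⟨h1, h2⟩; exact ⟨h1.congr h.symm, h2.congr h⟩
      · rintro ⟨h1, h2⟩; exact ⟨h1.congr h, h2.congr h.symm⟩
    by_cases h1 : IsP X γ
    · have h2 := hiff.1 h1
      have : toS h1 = toS h2 := by
        ext s
        exact h (smp_mem s)
      simp only [LL]
      rw [dif_pos h1, dif_pos h2, this]
    · simp only [LL]
      rw [dif_neg h1, dif_neg (fun h2 => h1 (hiff.2 h2))]
  refine ⟨S.card, fun k => ofS (S.equivFin.symm k : Smp 1 X), fun i k => z i (S.equivFin.symm k),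
    LL, fun k => ofS_isP _, fun i u => ?_, ?_, hcongr, fun i j => ?_⟩
  · rw [hsum i (fun s => u (ofS s 1) - u (ofS s 0))]
    have h1 : ∀ c : Smp 1 X →₀ ℚ, (c.sum fun s r => r * (u (ofS s 1) - u (ofS s 0))) =
        Finsupp.lsum ℚ (fun s : Smp 0 X => LinearMap.toSpanSingleton ℚ ℚ (u (pt0 s).1)) (bd X 0 c) := by
      intro c
      induction c using Finsupp.induction_linear with
      | zero => simp
      | add a b ha hb =>
        rw [Finsupp.sum_add_index', ha, hb, map_add, map_add] <;> intros <;> ring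
      | single s q =>
        rw [Finsupp.sum_single_index (by simp), bd0_single, map_sub]
        simp only [Finsupp.lsum_single, LinearMap.toSpanSingleton_apply, smul_eq_mul]
        rw [(pt0_face s).1, (pt0_face s).2]; ring
    rw [h1, hz, map_zero]
  · intro j φ h h'
    have := hl j (Finsupp.single (toT h h') 1)
    rw [bd1_single, map_add, map_sub] at this
    obtain ⟨f0, f1, f2⟩ := face_toT h h'
    obtain ⟨e0, e1, e2⟩ := edg_isP h h'
    rw [f0, f1, f2] at this
    simp only [LL]
    rw [dif_pos e0, dif_pos e1, dif_pos e2]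
    exact this
  · rw [hsum i (fun s => LL j (ofS s)), ← hzl i j]
    have h1 : ∀ s : Smp 1 X, LL j (ofS s) = l j (Finsupp.single s 1) := by
      intro s
      simp only [LL]
      rw [dif_pos (ofS_isP s), toS_ofS]
    simp only [h1]
    conv_rhs => rw [← Finsupp.sum_single (z i), Finsupp.sum, map_sum]
    refine Finset.sum_congr rfl fun s _ => ?_
    show z i s * (l j (Finsupp.single s 1)) = _
    rw [← smul_eq_mul, ← map_smul]
    simp

open Classical in
/-- Interface B'. -/
theorem ifB (X : Set E) (hX : FiniteBetti ↥X 1) (b m : ℕ) (γ : Fin m → ℝ → E)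
    (q : Fin b → Fin m → ℚ) (hγ : ∀ k, IsP X (γ k))
    (hq : ∀ i (u : E → ℚ), ∑ k, q i k * (u (γ k 1) - u (γ k 0)) = 0)
    (H : ∀ K ⊆ X, IsCompact K → ∃ L : Fin b → (ℝ → E) → ℚ,
      (∀ j (φ : ℝ × ℝ → E), ContinuousOn φ T2 → MapsTo φ T2 K →
        L j (edg0 φ) - L j (edg1 φ) + L j (edg2 φ) = 0) ∧
      (∀ j γ γ', EqOn γ γ' (Icc 0 1) → L j γ = L j γ') ∧
      ∀ i j, ∑ k, q i k * L j (γ k) = if i = j then 1 else 0) :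
    b ≤ bettiNumber X 1 := by
  obtain ⟨e⟩ := hm1_equiv X
  have : FiniteDimensional ℚ (singularHomology X 1) := hX
  refine la_lower (bd X 1) (bd X 0) e b (fun i => ∑ k, Finsupp.single (toS (hγ k)) (q i k)) ?_ ?_
  · intro i
    rw [map_sum]
    ext s
    have := hq i (fun x => if x = (pt0 s).1 then 1 else 0)
    rw [Finsupp.finsetSum_apply, Finsupp.zero_apply, ← this]
    refine Finset.sum_congr rfl fun k _ => ?_
    have h0 : ∀ s' : Smp 0 X, s' = s ↔ (pt0 s').1 = (pt0 s).1 := fun s' =>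
      ⟨fun h => by rw [h], fun h => pt0_inj (Subtype.ext h)⟩
    have h1 := ofS_toS (hγ k) (by simp : (1:ℝ) ∈ Icc (0:ℝ) 1)
    have h2 := ofS_toS (hγ k) (by simp : (0:ℝ) ∈ Icc (0:ℝ) 1)
    rw [bd0_single, Finsupp.sub_apply, Finsupp.single_apply, Finsupp.single_apply]
    simp only [h0, (pt0_face _).1, (pt0_face _).2, h1, h2]
    split_ifs <;> simp
  · intro c
    obtain ⟨L, hL, hLc, hLq⟩ := H (⋃ s ∈ c.support, Subtype.val '' range s)
      (by
        intro x hx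
        simp only [mem_iUnion] at hx
        obtain ⟨s, _, y, _, rfl⟩ := hx
        exact y.2)
      (c.support.isCompact_biUnion fun s _ =>
        (isCompact_range s.continuous).image continuous_subtype_val)
    refine ⟨fun j => Finsupp.lsum ℚ (fun s : Smp 1 X => LinearMap.toSpanSingleton ℚ ℚ (L j (ofS s))),
      fun j => ?_, fun i j => ?_⟩
    · conv_lhs => rw [← Finsupp.sum_single c, Finsupp.sum, map_sum, map_sum]
      refine Finset.sum_eq_zero fun s hs => ?_
      have h := hL j (ofT s) (ofT_isP s).1 (fun t ht => mem_biUnion hs ((ofT_isP s).2 t ht))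
      have hX' : MapsTo (ofT s) T2 X :=
        (fun t ht => by obtain ⟨a, -, h⟩ := (ofT_isP s).2 t ht; rw [← h]; exact a.2)
      obtain ⟨f0, f1, f2⟩ := face_toT (ofT_isP s).1 hX'
      rw [toT_ofT] at f0 f1 f2
      rw [bd1_single, map_add, map_sub]
      simp only [Finsupp.lsum_single, LinearMap.toSpanSingleton_apply, smul_eq_mul]
      rw [f0, f1, f2, hLc j _ _ (ofS_toS _), hLc j _ _ (ofS_toS _), hLc j _ _ (ofS_toS _)]
      rw [← mul_sub, ← mul_add, h, mul_zero]
    · rw [← hLq i j, map_sum]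
      refine Finset.sum_congr rfl fun k _ => ?_
      simp only [Finsupp.lsum_single, LinearMap.toSpanSingleton_apply, smul_eq_mul]
      rw [hLc j _ _ (ofS_toS _)]

theorem joined_simplex {X : Set E} {x y : E} (h : JoinedIn X x y) :
    ∃ (hx : x ∈ X) (hy : y ∈ X), ∀ q : ℚ, ∃ c, bd X 0 c = Finsupp.single (c0 ⟨y, hy⟩) q -
      Finsupp.single (c0 ⟨x, hx⟩) q := by
  obtain ⟨γ, hγ⟩ := h
  have hP : IsP X γ.extend := by
    refine ⟨γ.continuous_extend.continuousOn, fun t ht => ?_⟩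
    rw [γ.extend_apply ht]; exact hγ _
  refine ⟨by simpa using hγ 0, by simpa using hγ 1, fun q => ⟨Finsupp.single (toS hP) q, ?_⟩⟩
  rw [bd0_single]
  congr 2
  · apply pt0_inj; apply Subtype.ext
    rw [(pt0_face _).1, ofS_toS hP (by simp)]; simp [pt0_c0]
  · apply pt0_inj; apply Subtype.ext
    rw [(pt0_face _).2, ofS_toS hP (by simp)]; simp [pt0_c0]

theorem ifC (X : Set E) (m : ℕ) (x : Fin m → E) (hx : ∀ i, x i ∈ X)
    (h : ∀ y ∈ X, ∃ i, JoinedIn X (x i) y) : bettiNumber X 0 ≤ m := by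
  obtain ⟨e⟩ := hm0_equiv X
  refine la_upper (bd X 0) _ e m (fun i => Finsupp.single (c0 ⟨x i, hx i⟩) 1) (by simp) ?_
  intro c
  induction c using Finsupp.induction_linear with
  | zero => exact zero_mem _
  | add a b ha hb => exact add_mem ha hb
  | single s q =>
    obtain ⟨i, hi⟩ := h (pt0 s).1 (pt0 s).2
    obtain ⟨h1, h2, h3⟩ := joined_simplex hi
    obtain ⟨c, hc⟩ := h3 q
    have : Finsupp.single s q = Finsupp.single (c0 ⟨x i, hx i⟩) q + bd X 0 c := by
      rw [hc, show c0 ⟨(pt0 s).1, h2⟩ = s from pt0_inj (Subtype.ext rfl)]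
      abel
    rw [this]
    refine Submodule.add_mem_sup ?_ ⟨c, rfl⟩
    rw [← Finsupp.smul_single_one]
    exact Submodule.smul_mem _ _ (Submodule.subset_span ⟨i, rfl⟩)

open Classical in
theorem ifD (X : Set E) (hX : FiniteBetti ↥X 0) (m : ℕ) (x : Fin m → E) (hx : ∀ i, x i ∈ X)
    (h : ∀ i j, JoinedIn X (x i) (x j) → i = j) : m ≤ bettiNumber X 0 := by
  obtain ⟨e⟩ := hm0_equiv X
  have : FiniteDimensional ℚ (singularHomology X 0) := hX
  refine la_lower (bd X 0) _ e m (fun i => Finsupp.single (c0 ⟨x i, hx i⟩) 1) (by simp) ?_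
  intro c
  refine ⟨fun j => Finsupp.lsum ℚ (fun s : Smp 0 X => LinearMap.toSpanSingleton ℚ ℚ
    (if JoinedIn X (x j) (pt0 s).1 then 1 else 0)), fun j => ?_, fun i j => ?_⟩
  · conv_lhs => rw [← Finsupp.sum_single c, Finsupp.sum, map_sum, map_sum]
    refine Finset.sum_eq_zero fun s hs => ?_
    rw [bd0_single, map_sub]
    simp only [Finsupp.lsum_single, LinearMap.toSpanSingleton_apply, smul_eq_mul]
    rw [(pt0_face s).1, (pt0_face s).2]
    have hj : JoinedIn X (ofS s 0) (ofS s 1) := by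
      obtain ⟨h1, h2⟩ := ofS_isP s
      refine JoinedIn.ofLine h1 rfl rfl ?_
      rintro _ ⟨t, ht, rfl⟩; exact h2 ht
    have : JoinedIn X (x j) (ofS s 1) ↔ JoinedIn X (x j) (ofS s 0) :=
      ⟨fun h => h.trans hj.symm, fun h => h.trans hj⟩
    simp [this]
  · simp only [Finsupp.lsum_single, LinearMap.toSpanSingleton_apply, smul_eq_mul, one_mul, pt0_c0]
    by_cases hij : i = j
    · subst hij
      simp [JoinedIn.refl (hx i)]
    · rw [if_neg hij]
      exact if_neg fun hh => hij (h _ _ hh).symm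

end Raw

section AS
variable {Y Z : Type} [TopologicalSpace Y] [TopologicalSpace Z]

/-- `g` is a local primitive of `f` on `A`. -/
def Prm (f : Y → Y → ℚ) (A : Set Y) (g : Y → ℚ) : Prop :=
  ∀ x ∈ A, ∃ W ∈ 𝓝 x, ∀ a ∈ W ∩ A, ∀ b ∈ W ∩ A, f a b = g b - g a

/-- cocycles -/
def Coc (f : Y → Y → ℚ) (A : Set Y) : Prop :=
  ∀ x ∈ A, ∃ W ∈ 𝓝 x, ∃ g : Y → ℚ, ∀ a ∈ W ∩ A, ∀ b ∈ W ∩ A, f a b = g b - g a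

/-- coboundaries -/
def Exa (f : Y → Y → ℚ) (A : Set Y) : Prop := ∃ g, Prm f A g

theorem Prm.mono {f : Y → Y → ℚ} {A B : Set Y} {g} (h : Prm f B g) (hA : A ⊆ B) : Prm f A g := by
  intro x hx
  obtain ⟨W, hW, hg⟩ := h x (hA hx)
  exact ⟨W, hW, fun a ha b hb => hg a ⟨ha.1, hA ha.2⟩ b ⟨hb.1, hA hb.2⟩⟩

theorem Exa.mono {f : Y → Y → ℚ} {A B : Set Y} (h : Exa f B) (hA : A ⊆ B) : Exa f A :=
  ⟨h.choose, h.choose_spec.mono hA⟩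

theorem Coc.mono {f : Y → Y → ℚ} {A B : Set Y} (h : Coc f B) (hA : A ⊆ B) : Coc f A := by
  intro x hx
  obtain ⟨W, hW, g, hg⟩ := h x (hA hx)
  exact ⟨W, hW, g, fun a ha b hb => hg a ⟨ha.1, hA ha.2⟩ b ⟨hb.1, hA hb.2⟩⟩

theorem Prm.pull {f : Y → Y → ℚ} {A : Set Y} {g} (h : Prm f A g) {A' : Set Z} {φ : Z → Y}
    (hc : ContinuousOn φ A') (hm : MapsTo φ A' A) :
    Prm (fun a b => f (φ a) (φ b)) A' (fun a => g (φ a)) := by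
  intro x hx
  obtain ⟨W, hW, hg⟩ := h _ (hm hx)
  have := hc x hx hW
  rw [mem_map, mem_nhdsWithin_iff_exists_mem_nhds_inter] at this
  obtain ⟨V, hV, hVW⟩ := this
  exact ⟨V, hV, fun a ha b hb => hg _ ⟨hVW ha, hm ha.2⟩ _ ⟨hVW hb, hm hb.2⟩⟩

theorem Coc.pull {f : Y → Y → ℚ} {A : Set Y} (h : Coc f A) {A' : Set Z} {φ : Z → Y}
    (hc : ContinuousOn φ A') (hm : MapsTo φ A' A) : Coc (fun a b => f (φ a) (φ b)) A' := by
  intro x hx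
  obtain ⟨W, hW, g, hg⟩ := h _ (hm hx)
  have := hc x hx hW
  rw [mem_map, mem_nhdsWithin_iff_exists_mem_nhds_inter] at this
  obtain ⟨V, hV, hVW⟩ := this
  exact ⟨V, hV, fun a => g (φ a), fun a ha b hb => hg _ ⟨hVW ha, hm ha.2⟩ _ ⟨hVW hb, hm hb.2⟩⟩

theorem Exa.pull {f : Y → Y → ℚ} {A : Set Y} (h : Exa f A) {A' : Set Z} {φ : Z → Y}
    (hc : ContinuousOn φ A') (hm : MapsTo φ A' A) : Exa (fun a b => f (φ a) (φ b)) A' :=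
  ⟨_, h.choose_spec.pull hc hm⟩

theorem Prm.coc {f : Y → Y → ℚ} {A : Set Y} {g} (h : Prm f A g) : Coc f A := by
  intro x hx
  obtain ⟨W, hW, hg⟩ := h x hx
  exact ⟨W, hW, g, hg⟩

theorem Exa.coc {f : Y → Y → ℚ} {A : Set Y} (h : Exa f A) : Coc f A := h.choose_spec.coc

theorem Prm.add {f f' : Y → Y → ℚ} {A : Set Y} {g g'} (h : Prm f A g) (h' : Prm f' A g') :
    Prm (fun a b => f a b + f' a b) A (fun a => g a + g' a) := by
  intro x hx
  obtain ⟨W, hW, hg⟩ := h x hx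
  obtain ⟨W', hW', hg'⟩ := h' x hx
  refine ⟨W ∩ W', inter_mem hW hW', fun a ha b hb => ?_⟩
  simp only
  rw [hg a ⟨ha.1.1, ha.2⟩ b ⟨hb.1.1, hb.2⟩, hg' a ⟨ha.1.2, ha.2⟩ b ⟨hb.1.2, hb.2⟩]
  ring

theorem Exa.trans {f f' f'' : Y → Y → ℚ} {A : Set Y} (h : Exa (fun a b => f a b - f' a b) A)
    (h' : Exa (fun a b => f' a b - f'' a b) A) : Exa (fun a b => f a b - f'' a b) A := by
  have := h.choose_spec.add h'.choose_spec
  simp only [sub_add_sub_cancel] at this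
  exact ⟨_, this⟩

theorem Prm.uniq {f : Y → Y → ℚ} {A : Set Y} {g g'} (h : Prm f A g) (h' : Prm f A g')
    (hA : IsPreconnected A) {x y : Y} (hx : x ∈ A) (hy : y ∈ A) : g y - g x = g' y - g' x := by
  refine hA.induction₂ (fun x y => g y - g x = g' y - g' x) ?_ ?_ ?_ hx hy
  · intro x hx
    obtain ⟨W, hW, hg⟩ := h x hx
    obtain ⟨W', hW', hg'⟩ := h' x hx
    filter_upwards [mem_nhdsWithin_of_mem_nhds hW, mem_nhdsWithin_of_mem_nhds hW',
      self_mem_nhdsWithin] with y h1 h2 h3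
    rw [← hg x ⟨mem_of_mem_nhds hW, hx⟩ y ⟨h1, h3⟩, hg' x ⟨mem_of_mem_nhds hW', hx⟩ y ⟨h2, h3⟩]
  · intro x y z _ _ _ h1 h2; linarith
  · intro x y _ _ h1; linarith

/-- gluing -/
theorem glue {Y : Type} [MetricSpace Y] {f : Y → Y → ℚ} {X O1 O2 : Set Y} (h1 : IsOpen O1)
    (h2 : IsOpen O2) (hf : Coc f (X ∩ O1)) (he : Exa f (X ∩ (O1 ∩ O2))) :
    ∃ f', Coc f' (X ∩ (O1 ∪ O2)) ∧ Exa (fun a b => f' a b - f a b) (X ∩ O1) := by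
  classical
  obtain ⟨g, hg⟩ := he
  obtain ⟨U, V, hU, hV, hCU, hCV, hUV⟩ : SeparatedNhds ((X ∩ O1) \ O2) ((X ∩ O2) \ O1) := by
    rw [separatedNhds_iff_disjoint]
    apply CompletelyNormalSpace.completely_normal
    · refine Disjoint.mono_left (closure_minimal (t := O2ᶜ) (fun x hx => hx.2) h2.isClosed_compl) ?_
      exact disjoint_left.2 fun x hx hx' => hx hx'.1.2
    · refine Disjoint.mono_right (closure_minimal (t := O1ᶜ) (fun x hx => hx.2) h1.isClosed_compl) ?_
      exact disjoint_left.2 fun x hx hx' => hx' hx.1.2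
  refine ⟨fun a b => if a ∈ U ∧ b ∈ U then f a b - (g b - g a) else 0, ?_, fun a => - g a, ?_⟩
  · intro x hx
    by_cases hx2 : x ∈ O2
    · by_cases hx1 : x ∈ O1
      · obtain ⟨W, hW, hWg⟩ := hg x ⟨hx.1, hx1, hx2⟩
        refine ⟨W ∩ (O1 ∩ O2), inter_mem hW ((h1.inter h2).mem_nhds ⟨hx1, hx2⟩), 0, ?_⟩
        intro a ha b hb
        have := hWg a ⟨ha.1.1, ha.2.1, ha.1.2⟩ b ⟨hb.1.1, hb.2.1, hb.1.2⟩
        simp [this]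
      · have hxV : x ∈ V := hCV ⟨⟨hx.1, hx2⟩, hx1⟩
        refine ⟨V, hV.mem_nhds hxV, 0, ?_⟩
        intro a ha b hb
        have : a ∉ U := disjoint_right.1 hUV ha.1
        simp [this]
    · have hx1 : x ∈ O1 := hx.2.resolve_right hx2
      obtain ⟨W, hW, k, hk⟩ := hf x ⟨hx.1, hx1⟩
      refine ⟨W ∩ (O1 ∩ U), inter_mem hW ((h1.inter hU).mem_nhds ⟨hx1, hCU ⟨⟨hx.1, hx1⟩, hx2⟩⟩),
        fun a => k a - g a, ?_⟩
      intro a ha b hb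
      have := hk a ⟨ha.1.1, ha.2.1, ha.1.2.1⟩ b ⟨hb.1.1, hb.2.1, hb.1.2.1⟩
      simp only [ha.1.2.2, hb.1.2.2, and_self, if_true, this]
      ring
  · intro x hx
    by_cases hx2 : x ∈ O2
    · obtain ⟨W, hW, hWg⟩ := hg x ⟨hx.1, hx.2, hx2⟩
      refine ⟨W ∩ (O1 ∩ O2), inter_mem hW ((h1.inter h2).mem_nhds ⟨hx.2, hx2⟩), ?_⟩
      intro a ha b hb
      have := hWg a ⟨ha.1.1, ha.2.1, ha.1.2⟩ b ⟨hb.1.1, hb.2.1, hb.1.2⟩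
      simp [this]
      ring
    · refine ⟨U, hU.mem_nhds (hCU ⟨hx, hx2⟩), fun a ha b hb => ?_⟩
      simp only [ha.1, hb.1, and_self, if_true]
      ring

theorem Coc.leb {Y : Type} [MetricSpace Y] {f : Y → Y → ℚ} {A : Set Y} (h : Coc f A)
    (hA : IsCompact A) : ∃ δ > 0, ∀ x ∈ A, ∃ g : Y → ℚ, ∀ a ∈ Metric.ball x δ ∩ A,
      ∀ b ∈ Metric.ball x δ ∩ A, f a b = g b - g a := by
  choose! W hW g hg using h
  obtain ⟨δ, hδ, H⟩ := lebesgue_number_lemma_of_metric (c := fun x : A => interior (W x)) hA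
    (fun _ => isOpen_interior) (fun x hx => mem_iUnion.2 ⟨⟨x, hx⟩, mem_interior_iff_mem_nhds.2 (hW x hx)⟩)
  refine ⟨δ, hδ, fun x hx => ?_⟩
  obtain ⟨i, hi⟩ := H x hx
  exact ⟨g i, fun a ha b hb => hg i i.2 a ⟨interior_subset (hi ha.1), ha.2⟩ b
    ⟨interior_subset (hi hb.1), hb.2⟩⟩

open Classical in
/-- integration of a cocycle along a path -/
def Intg (f : Y → Y → ℚ) (γ : ℝ → Y) : ℚ :=
  if h : Exa (fun a b => f (γ a) (γ b)) (Icc (0:ℝ) 1) then h.choose 1 - h.choose 0 else 0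

theorem Intg_eq {f : Y → Y → ℚ} {γ : ℝ → Y} {g} (h : Prm (fun a b => f (γ a) (γ b)) (Icc (0:ℝ) 1) g) :
    Intg f γ = g 1 - g 0 := by
  have h' : Exa (fun a b => f (γ a) (γ b)) (Icc (0:ℝ) 1) := ⟨g, h⟩
  rw [Intg, dif_pos h']
  exact h'.choose_spec.uniq h isPreconnected_Icc (by simp) (by simp)

theorem Prm.congr_left {f f' : Y → Y → ℚ} {A : Set Y} {g} (h : Prm f A g)
    (hf : ∀ a ∈ A, ∀ b ∈ A, f a b = f' a b) : Prm f' A g := by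
  intro x hx
  obtain ⟨W, hW, hg⟩ := h x hx
  exact ⟨W, hW, fun a ha b hb => by rw [← hf a ha.2 b hb.2]; exact hg a ha b hb⟩

theorem Intg_congr {f : Y → Y → ℚ} {γ γ' : ℝ → Y} (h : EqOn γ γ' (Icc 0 1)) :
    Intg f γ = Intg f γ' := by
  by_cases h1 : Exa (fun a b => f (γ a) (γ b)) (Icc (0:ℝ) 1)
  · obtain ⟨g, hg⟩ := h1
    rw [Intg_eq hg, Intg_eq (hg.congr_left (f' := fun a b => f (γ' a) (γ' b))
      fun a ha b hb => by simp only [h ha, h hb])]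
  · rw [Intg, dif_neg h1, Intg, dif_neg]
    rintro ⟨g, hg⟩
    exact h1 ⟨g, hg.congr_left fun a ha b hb => by simp only [h ha, h hb]⟩

theorem Intg_prm {f : Y → Y → ℚ} {γ : ℝ → Y} {A : Set Y} {g} (h : Prm f A g) (hγ : IsP A γ) :
    Intg f γ = g (γ 1) - g (γ 0) :=
  Intg_eq (h.pull hγ.1 hγ.2)

end AS

section CL

/-- grid curl -/
def curl (h v : ℤ → ℤ → ℚ) (i j : ℤ) : ℚ := h i j + v (i + 1) j - h i (j + 1) - v i j

/-- A cell is good if there is an edge cochain off `S` whose curl is its indicator. -/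
def GoodC (n : ℤ) (S : ℤ → ℤ → Prop) (a b : ℤ) : Prop :=
  ∃ h v : ℤ → ℤ → ℚ, (∀ i j, S i j → h i j = 0 ∧ h i (j + 1) = 0 ∧ v i j = 0 ∧ v (i + 1) j = 0) ∧
    ∀ i j, 0 ≤ i → i < n → 0 ≤ j → j < n → curl h v i j = if i = a ∧ j = b then 1 else 0

theorem goodC_out {n : ℤ} {S : ℤ → ℤ → Prop} {a b : ℤ}
    (h : ¬ (0 ≤ a ∧ a < n ∧ 0 ≤ b ∧ b < n)) : GoodC n S a b := by
  refine ⟨fun _ _ => 0, fun _ _ => 0, by simp, fun i j h1 h2 h3 h4 => ?_⟩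
  rw [if_neg]
  · simp [curl]
  · rintro ⟨rfl, rfl⟩; exact h ⟨h1, h2, h3, h4⟩

theorem goodC_h {n : ℤ} {S : ℤ → ℤ → Prop} {a b : ℤ} (h0 : ¬ S a b) (h1 : ¬ S (a + 1) b) :
    GoodC n S a b ↔ GoodC n S (a + 1) b := by
  have key : ∀ i j, S i j → ¬ (i = a + 1 ∧ j = b) ∧ ¬ (i + 1 = a + 1 ∧ j = b) := by
    intro i j hS
    refine ⟨?_, ?_⟩
    · rintro ⟨rfl, rfl⟩; exact h1 hS
    · rintro ⟨h, rfl⟩; obtain rfl : i = a := by omega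
      exact h0 hS
  constructor
  · rintro ⟨h, v, hS, hc⟩
    refine ⟨h, fun i j => v i j - if i = a + 1 ∧ j = b then 1 else 0, ?_, ?_⟩
    · intro i j hij
      obtain ⟨e1, e2, e3, e4⟩ := hS i j hij
      simp only [e1, e2, e3, e4, if_neg (key i j hij).1, if_neg (key i j hij).2, sub_zero, and_self]
    · intro i j g1 g2 g3 g4
      have := hc i j g1 g2 g3 g4
      simp only [curl] at this ⊢
      have e : (i + 1 = a + 1 ∧ j = b) ↔ (i = a ∧ j = b) := by omega
      simp only [e]
      linarith
  · rintro ⟨h, v, hS, hc⟩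
    refine ⟨h, fun i j => v i j + if i = a + 1 ∧ j = b then 1 else 0, ?_, ?_⟩
    · intro i j hij
      obtain ⟨e1, e2, e3, e4⟩ := hS i j hij
      simp only [e1, e2, e3, e4, if_neg (key i j hij).1, if_neg (key i j hij).2, add_zero, and_self]
    · intro i j g1 g2 g3 g4
      have := hc i j g1 g2 g3 g4
      simp only [curl] at this ⊢
      have e : (i + 1 = a + 1 ∧ j = b) ↔ (i = a ∧ j = b) := by omega
      simp only [e]
      linarith

theorem goodC_v {n : ℤ} {S : ℤ → ℤ → Prop} {a b : ℤ} (h0 : ¬ S a b) (h1 : ¬ S a (b + 1)) :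
    GoodC n S a b ↔ GoodC n S a (b + 1) := by
  have key : ∀ i j, S i j → ¬ (i = a ∧ j = b + 1) ∧ ¬ (i = a ∧ j + 1 = b + 1) := by
    intro i j hS
    refine ⟨?_, ?_⟩
    · rintro ⟨rfl, rfl⟩; exact h1 hS
    · rintro ⟨rfl, h⟩; obtain rfl : j = b := by omega
      exact h0 hS
  constructor
  · rintro ⟨h, v, hS, hc⟩
    refine ⟨fun i j => h i j + if i = a ∧ j = b + 1 then 1 else 0, v, ?_, ?_⟩
    · intro i j hij
      obtain ⟨e1, e2, e3, e4⟩ := hS i j hij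
      simp only [e1, e2, e3, e4, if_neg (key i j hij).1, if_neg (key i j hij).2, add_zero, and_self]
    · intro i j g1 g2 g3 g4
      have := hc i j g1 g2 g3 g4
      simp only [curl] at this ⊢
      have e : (i = a ∧ j + 1 = b + 1) ↔ (i = a ∧ j = b) := by omega
      simp only [e]
      linarith
  · rintro ⟨h, v, hS, hc⟩
    refine ⟨fun i j => h i j - if i = a ∧ j = b + 1 then 1 else 0, v, ?_, ?_⟩
    · intro i j hij
      obtain ⟨e1, e2, e3, e4⟩ := hS i j hij
      simp only [e1, e2, e3, e4, if_neg (key i j hij).1, if_neg (key i j hij).2, sub_zero, and_self]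
    · intro i j g1 g2 g3 g4
      have := hc i j g1 g2 g3 g4
      simp only [curl] at this ⊢
      have e : (i = a ∧ j + 1 = b + 1) ↔ (i = a ∧ j = b) := by omega
      simp only [e]
      linarith

theorem grid_prim (n : ℕ) (h v : ℤ → ℤ → ℚ)
    (hc : ∀ i j : ℕ, i < n → j < n → curl h v i j = 0) :
    ∃ G : ℕ → ℕ → ℚ, ∀ i j : ℕ, i ≤ n → j ≤ n → (i < n → G (i + 1) j - G i j = h i j) ∧
      (j < n → G i (j + 1) - G i j = v i j) := by
  refine ⟨fun i j => ∑ k ∈ Finset.range i, h k 0 + ∑ l ∈ Finset.range j, v i l, ?_⟩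
  intro i j hi hj
  constructor
  · intro hi'
    induction j with
    | zero => simp [Finset.sum_range_succ]
    | succ j ih =>
      have := ih (by omega)
      have h2 := hc i j hi' (by omega)
      simp only [Finset.sum_range_succ, curl, Nat.cast_add, Nat.cast_one] at this h2 ⊢
      linarith
  · intro _
    simp [Finset.sum_range_succ]

theorem CL (n : ℕ) (S : ℤ → ℤ → Prop) (h v : ℤ → ℤ → ℚ)
    (hc : ∀ i j, S i j → curl h v i j = 0)
    (hg : ∀ i j, ¬ S i j → GoodC n S i j) :
    ∃ G : ℕ → ℕ → ℚ, ∀ i j : ℕ, i < n → j < n → S i j →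
      G (i + 1) j - G i j = h i j ∧ G (i + 1) (j + 1) - G i (j + 1) = h i (j + 1) ∧
      G i (j + 1) - G i j = v i j ∧ G (i + 1) (j + 1) - G (i + 1) j = v (i + 1) j := by
  classical
  choose! bh bv hb hbc using hg
  let R := ((Finset.range n) ×ˢ (Finset.range n)).filter fun q => ¬ S q.1 q.2
  obtain ⟨G, hG⟩ := grid_prim n
    (fun i j => h i j - ∑ q ∈ R, curl h v q.1 q.2 * bh q.1 q.2 i j)
    (fun i j => v i j - ∑ q ∈ R, curl h v q.1 q.2 * bv q.1 q.2 i j) (by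
      intro i j hi hj
      have e : curl (fun i j => h i j - ∑ q ∈ R, curl h v q.1 q.2 * bh q.1 q.2 i j)
          (fun i j => v i j - ∑ q ∈ R, curl h v q.1 q.2 * bv q.1 q.2 i j) i j =
          curl h v i j - ∑ q ∈ R, curl h v q.1 q.2 * curl (bh q.1 q.2) (bv q.1 q.2) i j := by
        simp only [curl, mul_add, mul_sub, Finset.sum_add_distrib, Finset.sum_sub_distrib]
        ring
      rw [e]
      have e2 : ∑ q ∈ R, curl h v q.1 q.2 * curl (bh q.1 q.2) (bv q.1 q.2) i j =
          ∑ q ∈ R, if q = (i, j) then curl h v i j else 0 := by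
        refine Finset.sum_congr rfl fun q hq => ?_
        obtain ⟨_, hq2⟩ := Finset.mem_filter.1 hq
        rw [hbc q.1 q.2 hq2 i j (by positivity) (by exact_mod_cast hi) (by positivity)
          (by exact_mod_cast hj)]
        by_cases hh : q = (i, j)
        · subst hh; simp
        · rw [if_neg hh, if_neg, mul_zero]
          rintro ⟨h1, h2⟩
          exact hh (Prod.ext (by exact_mod_cast h1.symm) (by exact_mod_cast h2.symm))
      rw [e2, Finset.sum_ite_eq']
      by_cases hS : S i j
      · simp [hc _ _ hS]
      · rw [if_pos, sub_self]
        simp [R, hi, hj, hS])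
  refine ⟨G, fun i j hi hj hS => ?_⟩
  have hz : ∀ q ∈ R, bh q.1 q.2 i j = 0 ∧ bh q.1 q.2 i (j + 1) = 0 ∧ bv q.1 q.2 i j = 0 ∧
      bv q.1 q.2 (i + 1) j = 0 := fun q hq =>
    hb q.1 q.2 (Finset.mem_filter.1 hq).2 i j hS
  have h1 := (hG i j (by omega) (by omega)).1 (by omega)
  have h2 := (hG i (j + 1) (by omega) (by omega)).1 (by omega)
  have h3 := (hG i j (by omega) (by omega)).2 (by omega)
  have h4 := (hG (i + 1) j (by omega) (by omega)).2 (by omega)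
  rw [Finset.sum_eq_zero fun q hq => by rw [(hz q hq).1, mul_zero]] at h1
  rw [Finset.sum_eq_zero fun q hq => by
    push_cast; rw [(hz q hq).2.1, mul_zero]] at h2
  rw [Finset.sum_eq_zero fun q hq => by rw [(hz q hq).2.2.1, mul_zero]] at h3
  rw [Finset.sum_eq_zero fun q hq => by
    push_cast; rw [(hz q hq).2.2.2, mul_zero]] at h4
  push_cast at h1 h2 h3 h4
  exact ⟨by linarith, by linarith, by linarith, by linarith⟩

end CL

section PL

/-- unit square -/
def Qs : Set (ℝ × ℝ) := Icc 0 1 ×ˢ Icc 0 1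

theorem Qs_compact : IsCompact Qs := isCompact_Icc.prod isCompact_Icc

/-- grid interval -/
def gI (n : ℕ) (i : ℤ) : Set ℝ := Icc ((i : ℝ) / n) (((i : ℝ) + 1) / n)

/-- grid cell -/
def gC (n : ℕ) (i j : ℤ) : Set (ℝ × ℝ) := gI n i ×ˢ gI n j

theorem gI_near {n : ℕ} (hn : 0 < n) (a : ℝ) : ∀ᶠ b : ℝ in 𝓝 a, ∃ i : ℤ, a ∈ gI n i ∧ b ∈ gI n i := by
  have hn' : (0:ℝ) < n := by exact_mod_cast hn
  have h1 : ∀ᶠ b : ℝ in 𝓝 a, b * n < (⌊a * n⌋ : ℝ) + 1 :=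
    (by fun_prop : Continuous fun b : ℝ => b * n).continuousAt.eventually
      (gt_mem_nhds (Int.lt_floor_add_one _))
  have h2 : ∀ᶠ b : ℝ in 𝓝 a, (⌈a * n⌉ : ℝ) - 1 < b * n :=
    (by fun_prop : Continuous fun b : ℝ => b * n).continuousAt.eventually
      (lt_mem_nhds (by linarith [Int.ceil_lt_add_one (a * n)]))
  filter_upwards [h1, h2] with b hb1 hb2
  rcases le_total a b with h | h
  · refine ⟨⌊a * n⌋, ⟨?_, ?_⟩, ⟨?_, ?_⟩⟩
    · rw [div_le_iff₀ hn']; exact Int.floor_le _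
    · rw [le_div_iff₀ hn']; exact (Int.lt_floor_add_one _).le
    · rw [div_le_iff₀ hn']; exact (Int.floor_le _).trans (by gcongr)
    · rw [le_div_iff₀ hn']; exact hb1.le
  · refine ⟨⌈a * n⌉ - 1, ⟨?_, ?_⟩, ⟨?_, ?_⟩⟩
    · rw [div_le_iff₀ hn']; push_cast; linarith [Int.ceil_lt_add_one (a * n)]
    · rw [le_div_iff₀ hn']; push_cast; linarith [Int.le_ceil (a * n)]
    · rw [div_le_iff₀ hn']; push_cast; linarith
    · rw [le_div_iff₀ hn']; push_cast
      have : b * n ≤ a * n := by gcongr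
      linarith [Int.le_ceil (a * n)]

theorem gI_adj {n : ℕ} (hn : 0 < n) {a b : ℝ} (hab : |a - b| < 1 / n) {i j : ℤ} (hi : a ∈ gI n i)
    (hj : b ∈ gI n j) : j ≤ i + 1 ∧ i ≤ j + 1 := by
  have hn' : (0:ℝ) < n := by exact_mod_cast hn
  obtain ⟨h1, h2⟩ := hi
  obtain ⟨h3, h4⟩ := hj
  rw [div_le_iff₀ hn'] at h1 h3
  rw [le_div_iff₀ hn'] at h2 h4
  have h5 : |a - b| * n < 1 := by rwa [lt_div_iff₀ hn'] at hab
  have h6 : (a - b) * n < 1 := lt_of_le_of_lt (by gcongr; exact le_abs_self _) h5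
  have h7 : (b - a) * n < 1 := lt_of_le_of_lt (by gcongr; rw [abs_sub_comm]; exact le_abs_self _) h5
  constructor
  · have : (j : ℝ) < i + 2 := by nlinarith
    have : j < i + 2 := by exact_mod_cast this
    omega
  · have : (i : ℝ) < j + 2 := by nlinarith
    have : i < j + 2 := by exact_mod_cast this
    omega

theorem gI_exists {n : ℕ} (hn : 0 < n) {a : ℝ} (ha : a ∈ Icc (0:ℝ) 1) :
    ∃ i : ℕ, i < n ∧ a ∈ gI n i := by
  have hn' : (0:ℝ) < n := by exact_mod_cast hn
  by_cases h : a = 1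
  · refine ⟨n - 1, by omega, ⟨?_, ?_⟩⟩
    · rw [div_le_iff₀ hn', h]; push_cast [Nat.cast_sub (show 1 ≤ n from hn)]; linarith
    · rw [le_div_iff₀ hn', h]; push_cast [Nat.cast_sub (show 1 ≤ n from hn)]; linarith
  · have h0 : 0 ≤ a * n := mul_nonneg ha.1 hn'.le
    refine ⟨⌊a * n⌋₊, ?_, ⟨?_, ?_⟩⟩
    · rw [Nat.floor_lt h0]
      have : a < 1 := lt_of_le_of_ne ha.2 h
      nlinarith
    · rw [div_le_iff₀ hn']; exact_mod_cast Nat.floor_le h0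
    · rw [le_div_iff₀ hn']; exact_mod_cast (Nat.lt_floor_add_one _).le

theorem gI_dist {n : ℕ} (hn : 0 < n) {a b : ℝ} {i : ℤ} (ha : a ∈ gI n i) (hb : b ∈ gI n i) :
    |a - b| ≤ 1 / n := by
  have hn' : (0:ℝ) < n := by exact_mod_cast hn
  obtain ⟨h1, h2⟩ := ha
  obtain ⟨h3, h4⟩ := hb
  have : ((i:ℝ) + 1) / n = i / n + 1 / n := by ring
  rw [abs_le]; constructor <;> linarith

theorem gC_dist {n : ℕ} (hn : 0 < n) {a b : ℝ × ℝ} {i j : ℤ} (ha : a ∈ gC n i j)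
    (hb : b ∈ gC n i j) : dist a b ≤ 1 / n := by
  rw [Prod.dist_eq, max_le_iff, Real.dist_eq, Real.dist_eq]
  exact ⟨gI_dist hn ha.1 hb.1, gI_dist hn ha.2 hb.2⟩

/-- grid point -/
def gP (n : ℕ) (i j : ℤ) : ℝ × ℝ := ((i : ℝ) / n, (j : ℝ) / n)

theorem gI_left {n : ℕ} (i : ℤ) : (i : ℝ) / n ∈ gI n i := by
  refine ⟨le_rfl, ?_⟩; gcongr; linarith

theorem gI_right {n : ℕ} (i : ℤ) : ((i + 1 : ℤ) : ℝ) / n ∈ gI n i := by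
  push_cast
  refine ⟨?_, le_rfl⟩; gcongr; linarith

theorem gI_sub {n : ℕ} (hn : 0 < n) {i : ℤ} (h0 : 0 ≤ i) (h1 : i < n) : gI n i ⊆ Icc 0 1 := by
  have hn' : (0:ℝ) < n := by exact_mod_cast hn
  rintro x ⟨h2, h3⟩
  refine ⟨le_trans (by positivity) h2, h3.trans ?_⟩
  rw [div_le_one hn']
  exact_mod_cast h1

theorem PL {Ψ : ℝ × ℝ → ℝ} (hΨ : ContinuousOn Ψ Qs)
    (hmax : ∀ x, Qs ∈ 𝓝 x → ¬ IsLocalMax Ψ x) {f : ℝ × ℝ → ℝ × ℝ → ℚ} {s s' : ℝ}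
    (hs : s' < s) (hf : Coc f {w ∈ Qs | Ψ w < s}) : Exa f {w ∈ Qs | Ψ w ≤ s'} := by
  classical
  obtain ⟨s₂, hs1, hs2⟩ := exists_between hs
  have hK : IsCompact {w ∈ Qs | Ψ w ≤ s₂} := by
    have := hΨ.preimage_isClosed_of_isClosed Qs_compact.isClosed (isClosed_Iic (a := s₂))
    exact Qs_compact.of_isClosed_subset this fun x hx => hx.1
  obtain ⟨δ, hδ, hleb⟩ := (hf.mono (A := {w ∈ Qs | Ψ w ≤ s₂})
    fun x hx => ⟨hx.1, hx.2.trans_lt hs2⟩).leb hK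
  obtain ⟨δ₂, hδ₂, hunif⟩ := Metric.uniformContinuousOn_iff.1
    (Qs_compact.uniformContinuousOn_of_continuous hΨ) (s₂ - s') (by linarith)
  obtain ⟨m, hm⟩ := exists_nat_one_div_lt (lt_min hδ hδ₂)
  obtain ⟨n, hn, hnδ⟩ : ∃ n : ℕ, 0 < n ∧ 1 / (n:ℝ) < min δ δ₂ := ⟨m + 1, by omega, by
    push_cast; exact hm⟩
  have hn' : (0:ℝ) < n := by exact_mod_cast hn
  have hn1 : 1 / (n:ℝ) < δ := hnδ.trans_le (min_le_left _ _)
  have hn2 : 1 / (n:ℝ) < δ₂ := hnδ.trans_le (min_le_right _ _)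
  let box : ℤ → ℤ → Prop := fun i j => 0 ≤ i ∧ i < n ∧ 0 ≤ j ∧ j < n
  have hbox : ∀ i j, box i j → gC n i j ⊆ Qs := fun i j h =>
    prod_mono (gI_sub hn h.1 h.2.1) (gI_sub hn h.2.2.1 h.2.2.2)
  let S : ℤ → ℤ → Prop := fun i j => box i j ∧ ∀ w ∈ gC n i j, Ψ w ≤ s₂
  have hSK : ∀ i j, S i j → gC n i j ⊆ {w ∈ Qs | Ψ w ≤ s₂} := fun i j h w hw =>
    ⟨hbox i j h.1 hw, h.2 w hw⟩
  -- exactness on S cells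
  have hex : ∀ i j, S i j → ∀ p ∈ gC n i j, ∃ g : ℝ × ℝ → ℚ, ∀ a ∈ gC n i j, ∀ b ∈ gC n i j,
      f a b = g b - g a := by
    intro i j hS p hp
    obtain ⟨g, hg⟩ := hleb p (hSK i j hS hp)
    exact ⟨g, fun a ha b hb => hg a ⟨(gC_dist hn ha hp).trans_lt hn1, hSK i j hS ha⟩ b
      ⟨(gC_dist hn hb hp).trans_lt hn1, hSK i j hS hb⟩⟩
  have hv00 : ∀ i j, gP n i j ∈ gC n i j := fun i j => ⟨gI_left i, gI_left j⟩
  have hv10 : ∀ i j, gP n (i + 1) j ∈ gC n i j := fun i j => ⟨gI_right i, gI_left j⟩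
  have hv01 : ∀ i j, gP n i (j + 1) ∈ gC n i j := fun i j => ⟨gI_left i, gI_right j⟩
  have hv11 : ∀ i j, gP n (i + 1) (j + 1) ∈ gC n i j := fun i j => ⟨gI_right i, gI_right j⟩
  -- goodness
  have hgood : ∀ i j, ¬ S i j → GoodC n S i j := by
    by_contra! hcon
    obtain ⟨i₀, j₀, hS₀, hG₀⟩ := hcon
    let T : Finset (ℤ × ℤ) := ((Finset.Ico (0:ℤ) n) ×ˢ (Finset.Ico (0:ℤ) n)).filter
      fun q => ¬ S q.1 q.2 ∧ ¬ GoodC n S q.1 q.2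
    have hT : ∀ i j, ¬ S i j → ¬ GoodC n S i j → (i, j) ∈ T := by
      intro i j h1 h2
      have hb : box i j := by
        by_contra hb
        exact h2 (goodC_out hb)
      simp only [T, Finset.mem_filter, Finset.mem_product, Finset.mem_Ico]
      exact ⟨⟨⟨hb.1, hb.2.1⟩, hb.2.2⟩, h1, h2⟩
    have hTb : ∀ q ∈ T, box q.1 q.2 := by
      intro q hq
      simp only [T, Finset.mem_filter, Finset.mem_product, Finset.mem_Ico] at hq
      exact ⟨hq.1.1.1, hq.1.1.2, hq.1.2⟩
    have hUc : IsCompact (⋃ q ∈ T, gC n q.1 q.2) :=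
      T.isCompact_biUnion fun q _ => isCompact_Icc.prod isCompact_Icc
    have hUQ : (⋃ q ∈ T, gC n q.1 q.2) ⊆ Qs := iUnion₂_subset fun q hq => hbox _ _ (hTb q hq)
    obtain ⟨x, hxU, hxm⟩ := hUc.exists_isMaxOn
      ⟨gP n i₀ j₀, mem_biUnion (hT i₀ j₀ hS₀ hG₀) (hv00 i₀ j₀)⟩ (hΨ.mono hUQ)
    obtain ⟨q₀, hq₀, hxq⟩ := mem_iUnion₂.1 hxU
    have hq₀' := (Finset.mem_filter.1 hq₀).2
    have hxs : s₂ < Ψ x := by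
      by_contra! hle
      apply hq₀'.1
      refine ⟨hTb _ hq₀, fun w hw => ?_⟩
      have h3 : Ψ w ≤ Ψ x := hxm (mem_biUnion hq₀ hw)
      linarith
    have hnS : ∀ i j, x ∈ gC n i j → ¬ S i j := fun i j hx h => by
      have := h.2 x hx
      linarith
    have h1 : ∀ i, x.1 ∈ gI n i → ¬ GoodC n S i q₀.2 := by
      intro i hi
      obtain ⟨e1, e2⟩ := gI_adj hn (by simpa using hn) hi hxq.1
      have hn0 := hnS _ _ hxq
      have hn1 := hnS i q₀.2 ⟨hi, hxq.2⟩
      rcases (by omega : q₀.1 = i ∨ q₀.1 = i + 1 ∨ i = q₀.1 + 1) with e | e | e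
      · rw [← e]; exact hq₀'.2
      · rw [goodC_h hn1 (e ▸ hn0), ← e]; exact hq₀'.2
      · rw [e, ← goodC_h hn0 (e ▸ hn1)]; exact hq₀'.2
    have h2 : ∀ i j, x ∈ gC n i j → ¬ GoodC n S i j := by
      intro i j hij
      obtain ⟨e1, e2⟩ := gI_adj hn (by simpa using hn) hij.2 hxq.2
      have hn0 := hnS i q₀.2 ⟨hij.1, hxq.2⟩
      have hn1 := hnS i j hij
      have hg := h1 i hij.1
      rcases (by omega : q₀.2 = j ∨ q₀.2 = j + 1 ∨ j = q₀.2 + 1) with e | e | e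
      · rw [← e]; exact hg
      · rw [goodC_v hn1 (e ▸ hn0), ← e]; exact hg
      · rw [e, ← goodC_v hn0 (e ▸ hn1)]; exact hg
    have hnear : ∀ᶠ y in 𝓝 x, y ∈ ⋃ q ∈ T, gC n q.1 q.2 := by
      have e1 := continuous_fst.continuousAt.eventually (gI_near hn x.1)
      have e2 := continuous_snd.continuousAt.eventually (gI_near hn x.2)
      filter_upwards [e1, e2] with y ⟨i, hi, hi'⟩ ⟨j, hj, hj'⟩
      exact mem_biUnion (hT i j (hnS i j ⟨hi, hj⟩) (h2 i j ⟨hi, hj⟩)) (⟨hi', hj'⟩ : y ∈ gC n i j)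
    exact hmax x (mem_of_superset hnear hUQ) (by
      filter_upwards [hnear] with y hy using hxm hy)
  obtain ⟨G, hG⟩ := CL n S (fun i j => f (gP n i j) (gP n (i + 1) j))
    (fun i j => f (gP n i j) (gP n i (j + 1))) (by
      intro i j hS
      obtain ⟨g, hg⟩ := hex i j hS _ (hv00 i j)
      simp only [curl]
      rw [hg _ (hv00 i j) _ (hv10 i j), hg _ (hv10 i j) _ (hv11 i j), hg _ (hv01 i j) _ (hv11 i j),
        hg _ (hv00 i j) _ (hv01 i j)]
      ring) hgood
  -- moving between the vertices
  have hmove : ∀ i j : ℕ, i < n → j < n → S i j → ∀ x ∈ gC n i j, ∀ i' j' : ℕ,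
      (i' = i ∨ i' = i + 1) → (j' = j ∨ j' = j + 1) →
      gP n i' j' ∈ gC n i j ∧ G i' j' + f (gP n i' j') x = G i j + f (gP n i j) x := by
    intro i j hi hj hS x hx i' j' hi' hj'
    obtain ⟨g, hg⟩ := hex i j hS _ (hv00 i j)
    obtain ⟨e1, e2, e3, e4⟩ := hG i j hi hj hS
    rw [hg _ (hv00 i j) _ (hv10 i j)] at e1
    rw [hg _ (hv01 i j) _ (hv11 i j)] at e2
    rw [hg _ (hv00 i j) _ (hv01 i j)] at e3
    rw [hg _ (hv10 i j) _ (hv11 i j)] at e4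
    rcases hi' with rfl | rfl <;> rcases hj' with rfl | rfl <;> push_cast
    · exact ⟨hv00 _ _, rfl⟩
    · refine ⟨hv01 _ _, ?_⟩
      rw [hg _ (hv01 _ _) _ hx, hg _ (hv00 _ _) _ hx]; linarith
    · refine ⟨hv10 _ _, ?_⟩
      rw [hg _ (hv10 _ _) _ hx, hg _ (hv00 _ _) _ hx]; linarith
    · refine ⟨hv11 _ _, ?_⟩
      rw [hg _ (hv11 _ _) _ hx, hg _ (hv00 _ _) _ hx]; linarith
  have hcell : ∀ x ∈ Qs, ∃ q : ℕ × ℕ, q.1 < n ∧ q.2 < n ∧ x ∈ gC n q.1 q.2 := by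
    intro x hx
    obtain ⟨i, hi, hi'⟩ := gI_exists hn hx.1
    obtain ⟨j, hj, hj'⟩ := gI_exists hn hx.2
    exact ⟨(i, j), hi, hj, hi', hj'⟩
  choose! c hc1 hc2 hc using hcell
  refine ⟨fun x => G (c x).1 (c x).2 + f (gP n (c x).1 (c x).2) x, ?_⟩
  have hSc : ∀ x, x ∈ Qs → Ψ x ≤ s' → S (c x).1 (c x).2 := by
    intro x hx hxs
    have hb : box (c x).1 (c x).2 := ⟨by positivity, by exact_mod_cast hc1 x hx, by positivity,
      by exact_mod_cast hc2 x hx⟩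
    refine ⟨hb, fun w hw => ?_⟩
    have := hunif w (hbox _ _ hb hw) x hx ((gC_dist hn hw (hc x hx)).trans_lt hn2)
    rw [Real.dist_eq, abs_lt] at this
    linarith [this.2]
  intro x hx
  refine ⟨Metric.ball x (1 / n / 2), Metric.ball_mem_nhds _ (by positivity), ?_⟩
  rintro a ⟨ha1, ha2, ha3⟩ b ⟨hb1, hb2, hb3⟩
  have hab : dist a b < 1 / n := by
    have := dist_triangle_right a b x
    rw [Metric.mem_ball] at ha1 hb1
    linarith
  rw [Prod.dist_eq, max_lt_iff, Real.dist_eq, Real.dist_eq] at hab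
  have hSa := hSc a ha2 ha3
  have hSb := hSc b hb2 hb3
  have d1 := gI_adj hn hab.1 (hc a ha2).1 (hc b hb2).1
  have d2 := gI_adj hn hab.2 (hc a ha2).2 (hc b hb2).2
  have ma := hmove _ _ (hc1 a ha2) (hc2 a ha2) hSa a (hc a ha2)
    (max (c a).1 (c b).1) (max (c a).2 (c b).2) (by omega) (by omega)
  have mb := hmove _ _ (hc1 b hb2) (hc2 b hb2) hSb b (hc b hb2)
    (max (c a).1 (c b).1) (max (c a).2 (c b).2) (by omega) (by omega)
  show f a b = (G (c b).1 (c b).2 + f (gP n (c b).1 (c b).2) b) - (G (c a).1 (c a).2 + f (gP n (c a).1 (c a).2) a)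
  rw [← ma.2, ← mb.2]
  set V := gP n (max (c a).1 (c b).1 : ℕ) (max (c a).2 (c b).2 : ℕ) with hV
  have hVK := hSK _ _ hSa ma.1
  obtain ⟨g, hg⟩ := hleb V hVK
  have ga : a ∈ Metric.ball V δ ∩ {w ∈ Qs | Ψ w ≤ s₂} :=
    ⟨(gC_dist hn (hc a ha2) ma.1).trans_lt hn1, ha2, ha3.trans hs1.le⟩
  have gb : b ∈ Metric.ball V δ ∩ {w ∈ Qs | Ψ w ≤ s₂} :=
    ⟨(gC_dist hn (hc b hb2) mb.1).trans_lt hn1, hb2, hb3.trans hs1.le⟩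
  have gV : V ∈ Metric.ball V δ ∩ {w ∈ Qs | Ψ w ≤ s₂} := ⟨Metric.mem_ball_self hδ, hVK⟩
  rw [hg a ga b gb, hg V gV a ga, hg V gV b gb]
  ring

theorem exa_Qs {f : ℝ × ℝ → ℝ × ℝ → ℚ} (hf : Coc f Qs) : Exa f Qs := by
  refine (PL (Ψ := fun w => w.1) (s := 3) (s' := 2) (by fun_prop) ?_ (by norm_num)
    (hf.mono fun x hx => hx.1)).mono ?_
  · intro x _ hm
    have hc : ContinuousAt (fun t : ℝ => (t, x.2)) x.1 := by fun_prop
    have h1 : ∀ᶠ t in 𝓝 x.1, t ≤ x.1 := hc.eventually hm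
    have h2 : ∀ᶠ t in 𝓝[>] x.1, t ≤ x.1 := nhdsWithin_le_nhds h1
    obtain ⟨t, ht, ht'⟩ := (h2.and self_mem_nhdsWithin).exists
    exact absurd ht (not_le.2 ht')
  · intro x hx
    exact ⟨hx, by linarith [hx.1.2]⟩

theorem exa_T2 {f : ℝ × ℝ → ℝ × ℝ → ℚ} (hf : Coc f T2) : Exa f T2 := by
  have h1 : Coc (fun a b => f ((fun w : ℝ × ℝ => (w.1, min w.2 (1 - w.1))) a)
      ((fun w : ℝ × ℝ => (w.1, min w.2 (1 - w.1))) b)) Qs := by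
    refine hf.pull (by fun_prop) ?_
    rintro x ⟨⟨h1, h2⟩, h3, h4⟩
    refine ⟨h1, le_min h3 (by linarith), ?_⟩
    have := min_le_right x.2 (1 - x.1)
    dsimp only; linarith
  obtain ⟨g, hg⟩ := exa_Qs h1
  have hg' : Prm _ T2 g := hg.mono (by
    rintro x ⟨h1, h2, h3⟩; exact ⟨⟨h1, by linarith⟩, h2, by linarith⟩)
  refine ⟨g, hg'.congr_left ?_⟩
  have : ∀ a ∈ T2, ((a.1, min a.2 (1 - a.1)) : ℝ × ℝ) = a := by
    rintro x ⟨h1, h2, h3⟩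
    rw [min_eq_left (by linarith)]
  intro a ha b hb
  simp only [this a ha, this b hb]

theorem exa_I {f : ℝ → ℝ → ℚ} (hf : Coc f (Icc 0 1)) : Exa f (Icc 0 1) := by
  have h1 : Coc (fun a b => f (Prod.fst a) (Prod.fst b)) Qs :=
    hf.pull (φ := Prod.fst) (by fun_prop) fun x hx => hx.1
  have := (exa_Qs h1).pull (φ := fun t : ℝ => (t, (0:ℝ))) (A' := Icc 0 1) (by fun_prop)
    (fun x hx => ⟨hx, by simp⟩)
  exact this

variable {Y : Type} [TopologicalSpace Y]

theorem Intg_tri {f : Y → Y → ℚ} {A : Set Y} (hf : Coc f A) {φ : ℝ × ℝ → Y}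
    (h : ContinuousOn φ T2) (h' : MapsTo φ T2 A) :
    Intg f (edg0 φ) - Intg f (edg1 φ) + Intg f (edg2 φ) = 0 := by
  obtain ⟨g, hg⟩ := exa_T2 (hf.pull h h')
  have h0 : MapsTo (fun t : ℝ => (1 - t, t)) (Icc 0 1) T2 := by
    rintro t ⟨h1, h2⟩; exact ⟨by simpa using h2, h1, by simp⟩
  have h1 : MapsTo (fun t : ℝ => ((0:ℝ), t)) (Icc 0 1) T2 := by
    rintro t ⟨h1, h2⟩; exact ⟨by simp, h1, by simpa using h2⟩
  have h2 : MapsTo (fun t : ℝ => (t, (0:ℝ))) (Icc 0 1) T2 := by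
    rintro t ⟨h1, h2⟩; exact ⟨h1, by simp, by simpa using h2⟩
  rw [Intg_eq (γ := edg0 φ) (hg.pull (by fun_prop) h0),
    Intg_eq (γ := edg1 φ) (hg.pull (by fun_prop) h1),
    Intg_eq (γ := edg2 φ) (hg.pull (by fun_prop) h2)]
  simp

theorem Intg_sub {f f' : Y → Y → ℚ} {A : Set Y} (hf : Coc f A) {g}
    (he : Prm (fun a b => f' a b - f a b) A g) {γ : ℝ → Y} (hγ : IsP A γ) :
    Intg f' γ = Intg f γ + (g (γ 1) - g (γ 0)) := by
  obtain ⟨k, hk⟩ := exa_I (hf.pull hγ.1 hγ.2)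
  have := hk.add (he.pull hγ.1 hγ.2)
  simp only [add_sub_cancel] at this
  rw [Intg_eq hk, Intg_eq this]
  ring

end PL

section Chart

open Metric in
theorem fderiv_cont {E F : Type} [NormedAddCommGroup E] [NormedSpace ℂ E] [NormedAddCommGroup F]
    [NormedSpace ℂ F] {f : E → F} {U : Set E} (hU : IsOpen U) (hf : DifferentiableOn ℂ f U) :
    ContinuousOn (fderiv ℂ f) U := by
  intro x hx
  apply ContinuousAt.continuousWithinAt
  rw [Metric.continuousAt_iff]
  intro ε hε
  have hd := (hf.differentiableAt (hU.mem_nhds hx)).hasFDerivAt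
  have h1 : ∀ᶠ y in 𝓝 x, ‖f y - f x - fderiv ℂ f x (y - x)‖ ≤ ε / 8 * ‖y - x‖ :=
    (hasFDerivAt_iff_isLittleO.1 hd).def (by positivity)
  obtain ⟨r, hr, hrU⟩ := Metric.eventually_nhds_iff_ball.1 (h1.and (hU.eventually_mem hx))
  refine ⟨r / 2, by positivity, fun y hy => ?_⟩
  have hyU := (hrU y (by rw [mem_ball]; linarith)).2
  have hsub : ball y (r / 2) ⊆ ball x r := fun z hz => by
    rw [mem_ball] at *
    linarith [dist_triangle z y x]
  have hdf : DifferentiableOn ℂ (fun z => f z - fderiv ℂ f x z) (ball y (r / 2)) :=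
    (hf.mono fun z hz => (hrU z (hsub hz)).2).sub (fderiv ℂ f x).differentiable.differentiableOn
  have key := Complex.norm_fderiv_le_div_of_mapsTo_ball (R₂ := ε / 4 * r) hdf (by
    intro z hz
    rw [mem_closedBall, dist_eq_norm]
    have e1 := (hrU z (hsub hz)).1
    have e2 := (hrU y (hsub (mem_ball_self (by positivity)))).1
    have e3 : ‖z - x‖ < r := by rw [← dist_eq_norm]; exact hsub hz
    have e4 : ‖y - x‖ < r := by rw [← dist_eq_norm]; exact hsub (mem_ball_self (by positivity))
    have : f z - fderiv ℂ f x z - (f y - fderiv ℂ f x y) =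
      (f z - f x - fderiv ℂ f x (z - x)) - (f y - f x - fderiv ℂ f x (y - x)) := by
      simp only [map_sub]; abel
    rw [this]
    refine (norm_sub_le _ _).trans ?_
    nlinarith) (by positivity)
  have h2 : fderiv ℂ (fun z => f z - fderiv ℂ f x z) y = fderiv ℂ f y - fderiv ℂ f x := by
    have := ((hf.differentiableAt (hU.mem_nhds hyU)).hasFDerivAt.sub (fderiv ℂ f x).hasFDerivAt (x := y)).fderiv
    exact this
  rw [h2] at key
  rw [dist_eq_norm]
  refine key.trans_lt ?_
  have : ε / 4 * r / (r / 2) = ε / 2 := by field_simp; norm_num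
  rw [this]; linarith

theorem holo_contDiff {E F : Type} [NormedAddCommGroup E] [NormedSpace ℂ E] [NormedAddCommGroup F]
    [NormedSpace ℂ F] {f : E → F} {U : Set E} (hU : IsOpen U) (hf : DifferentiableOn ℂ f U) {x : E}
    (hx : x ∈ U) : ContDiffAt ℂ 1 f x :=
  contDiffAt_one_iff.2 ⟨fderiv ℂ f, U, hU.mem_nhds hx, fderiv_cont hU hf, fun _ hy =>
    (hf.differentiableAt (hU.mem_nhds hy)).hasFDerivAt⟩

/-- local product chart -/
def HasChart {N n : ℕ} (M : Set (Fin N → ℂ)) (p : (Fin N → ℂ) → (Fin n → ℂ)) (x0 : Fin N → ℂ) :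
    Prop :=
  ∃ (H : (Fin n → ℂ) → ℂ → (Fin N → ℂ)) (κ : (Fin N → ℂ) → ℂ) (ρ δ : ℝ), 0 < ρ ∧ 0 < δ ∧
    Continuous κ ∧
    ContinuousOn (fun z : (Fin n → ℂ) × ℂ => H z.1 z.2)
      (Metric.closedBall (p x0) ρ ×ˢ Metric.closedBall 0 ρ) ∧
    (∀ t ∈ Metric.closedBall (p x0) ρ, ∀ w ∈ Metric.closedBall (0:ℂ) ρ,
      H t w ∈ M ∧ p (H t w) = t ∧ κ (H t w) = w ∧ DifferentiableAt ℂ (H t) w) ∧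
    H (p x0) 0 = x0 ∧ κ x0 = 0 ∧
    ∀ y ∈ M, dist y x0 < δ → p y ∈ Metric.closedBall (p x0) ρ ∧ κ y ∈ Metric.ball 0 (ρ / 2) ∧
      H (p y) (κ y) = y

open Metric in
theorem chart_lemma {N n : ℕ} (hNn : n + 1 ≤ N) {M : Set (Fin N → ℂ)}
    {p : (Fin N → ℂ) → (Fin n → ℂ)} {U : Set (Fin N → ℂ)} (hU : IsOpen U) (hMU : M ⊆ U)
    (hp : DifferentiableOn ℂ p U) {x0 : Fin N → ℂ} (hx0 : x0 ∈ M)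
    (hs : SubmersionAt (N - (n + 1)) M p x0) : HasChart M p x0 := by
  obtain ⟨V, g, ⟨hV, hxV, hg, hgs, hMV⟩, hsub⟩ := hs
  have hgx : g x0 = 0 := by
    have : x0 ∈ M ∩ V := ⟨hx0, hxV⟩
    rw [hMV] at this; exact this.2
  have hg's := hgs x0 hxV hgx
  set g' := fderiv ℂ g x0 with hg'
  set p' := fderiv ℂ p x0 with hp'
  set Q : (Fin N → ℂ) →L[ℂ] (Fin (N - (n + 1)) → ℂ) × (Fin n → ℂ) := g'.prod p' with hQ
  have hQs : Function.Surjective Q := by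
    rintro ⟨a, b⟩
    obtain ⟨x, hx⟩ := hg's a
    have : b - p' x ∈ Submodule.map p'.toLinearMap (LinearMap.ker g'.toLinearMap) := by
      rw [hsub]; trivial
    obtain ⟨y, hy, hy'⟩ := this
    refine ⟨x + y, ?_⟩
    have hy1 : g' y = 0 := hy
    have hy2 : p' y = b - p' x := hy'
    simp [hQ, hy1, hy2, hx]
  have hker : Module.finrank ℂ (LinearMap.ker Q.toLinearMap) = 1 := by
    have h1 := LinearMap.finrank_range_add_finrank_ker Q.toLinearMap
    rw [LinearMap.range_eq_top.2 hQs] at h1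
    simp at h1
    omega
  obtain ⟨v, hv0, hv⟩ := finrank_eq_one_iff'.1 hker
  have hv0' : (v : Fin N → ℂ) ≠ 0 := fun h => hv0 (Subtype.ext h)
  obtain ⟨i, hi⟩ := Function.ne_iff.1 hv0'
  set A : (Fin N → ℂ) →L[ℂ] ((Fin (N - (n + 1)) → ℂ) × (Fin n → ℂ)) × ℂ :=
    Q.prod (ContinuousLinearMap.proj i) with hA
  have hAinj : Function.Injective A := by
    rw [injective_iff_map_eq_zero]
    intro x hx
    have hx1 : Q x = 0 := congrArg Prod.fst hx
    have hx2 : x i = 0 := congrArg Prod.snd hx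
    obtain ⟨c, hc⟩ := hv ⟨x, hx1⟩
    have hc' : c • (v : Fin N → ℂ) = x := congrArg Subtype.val hc
    rw [← hc'] at hx2
    have : c = 0 := by
      simp only [Pi.smul_apply, smul_eq_mul, mul_eq_zero] at hx2
      exact hx2.resolve_right hi
    rw [← hc', this, zero_smul]
  have hdim : Module.finrank ℂ (Fin N → ℂ) =
      Module.finrank ℂ (((Fin (N - (n + 1)) → ℂ) × (Fin n → ℂ)) × ℂ) := by
    simp; omega
  set Ae : (Fin N → ℂ) ≃L[ℂ] ((Fin (N - (n + 1)) → ℂ) × (Fin n → ℂ)) × ℂ :=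
    (LinearEquiv.ofInjectiveOfFinrankEq A.toLinearMap hAinj hdim).toContinuousLinearEquiv with hAe
  have hAe' : (Ae : (Fin N → ℂ) →L[ℂ] ((Fin (N - (n + 1)) → ℂ) × (Fin n → ℂ)) × ℂ) = A := by
    ext1 x; rfl
  set Φ : (Fin N → ℂ) → ((Fin (N - (n + 1)) → ℂ) × (Fin n → ℂ)) × ℂ :=
    fun y => ((g y, p y), y i - x0 i) with hΦ
  have hΦd : HasFDerivAt Φ (Ae : (Fin N → ℂ) →L[ℂ] _) x0 := by
    rw [hAe']
    exact ((hg.differentiableAt (hV.mem_nhds hxV)).hasFDerivAt.prodMk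
      (hp.differentiableAt (hU.mem_nhds (hMU hx0))).hasFDerivAt).prodMk
      ((ContinuousLinearMap.proj (R := ℂ) (φ := fun _ : Fin N => ℂ) i).hasFDerivAt.sub_const (x0 i))
  have hΦc : ContDiffAt ℂ 1 Φ x0 := by
    refine holo_contDiff (hV.inter hU) (U := V ∩ U) ?_ ⟨hxV, hMU hx0⟩
    refine ((hg.mono inter_subset_left).prodMk (hp.mono inter_subset_right)).prodMk ?_
    exact ((ContinuousLinearMap.proj (R := ℂ) (φ := fun _ : Fin N => ℂ) i).differentiable.sub_const
      (x0 i)).differentiableOn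
  set e := hΦc.toOpenPartialHomeomorph Φ hΦd one_ne_zero with he
  have hecoe : ∀ y, e y = Φ y := fun y => rfl
  have hes : x0 ∈ e.source := hΦc.mem_toOpenPartialHomeomorph_source hΦd one_ne_zero
  have het : Φ x0 ∈ e.target := hΦc.image_mem_toOpenPartialHomeomorph_target hΦd one_ne_zero
  have hed : ContDiffAt ℂ 1 e.symm (Φ x0) := hΦc.to_localInverse hΦd one_ne_zero
  have hΦx : Φ x0 = ((0, p x0), 0) := by simp [hΦ, hgx]
  have hsx : e.symm (Φ x0) = x0 := e.left_inv hes
  have hev : ∀ᶠ z in 𝓝 (Φ x0), z ∈ e.target ∧ DifferentiableAt ℂ e.symm z ∧ e.symm z ∈ V := by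
    refine (e.open_target.eventually_mem het).and (Filter.Eventually.and ?_ ?_)
    · filter_upwards [hed.eventually (by simp)] with z hz using hz.differentiableAt (by simp)
    · exact hed.continuousAt.eventually (hV.eventually_mem (by rw [hsx]; exact hxV))
  obtain ⟨ρ, hρ, hb⟩ := Metric.nhds_basis_closedBall.eventually_iff.1 hev
  rw [hΦx] at hb
  have hin : ∀ t ∈ closedBall (p x0) ρ, ∀ w ∈ closedBall (0:ℂ) ρ,
      (((0 : Fin (N - (n + 1)) → ℂ), t), w) ∈
        closedBall (((0 : Fin (N - (n + 1)) → ℂ), p x0), (0:ℂ)) ρ := by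
    intro t ht w hw
    rw [← closedBall_prod_same, ← closedBall_prod_same]
    exact ⟨⟨mem_closedBall_self hρ.le, ht⟩, hw⟩
  have hc2 : ContinuousAt p x0 := (hp.differentiableAt (hU.mem_nhds (hMU hx0))).continuousAt
  have hc3 : Continuous fun y : Fin N → ℂ => y i - x0 i := by fun_prop
  have hev2 : ∀ᶠ y in 𝓝 x0, y ∈ e.source ∧ y ∈ V ∧ p y ∈ closedBall (p x0) ρ ∧
      y i - x0 i ∈ ball (0:ℂ) (ρ / 2) := by
    refine (e.open_source.eventually_mem hes).and ((hV.eventually_mem hxV).and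
      (Filter.Eventually.and ?_ ?_))
    · exact hc2.eventually (closedBall_mem_nhds _ hρ)
    · exact hc3.continuousAt.eventually (isOpen_ball.eventually_mem (by simpa using hρ))
  obtain ⟨δ, hδ, hδb⟩ := Metric.eventually_nhds_iff.1 hev2
  refine ⟨fun t w => e.symm ((0, t), w), fun y => y i - x0 i, ρ, δ, hρ, hδ, hc3, ?_, ?_, ?_, ?_, ?_⟩
  · intro z hz
    have h1 := (hb (hin z.1 hz.1 z.2 hz.2)).2.1.continuousAt
    exact (h1.comp (f := fun z : (Fin n → ℂ) × ℂ => (((0 : Fin (N - (n + 1)) → ℂ), z.1), z.2)) (x := z)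
      (by fun_prop)).continuousWithinAt
  · intro t ht w hw
    obtain ⟨h1, h2, h3⟩ := hb (hin t ht w hw)
    have h4 : Φ (e.symm ((0, t), w)) = ((0, t), w) := e.right_inv h1
    simp only [hΦ, Prod.mk.injEq] at h4
    refine ⟨?_, h4.1.2, h4.2, ?_⟩
    · have : e.symm ((0, t), w) ∈ M ∩ V := by rw [hMV]; exact ⟨h3, h4.1.1⟩
      exact this.1
    · have : DifferentiableAt ℂ (fun w : ℂ => (((0 : Fin (N - (n + 1)) → ℂ), t), w)) w := by fun_prop
      exact h2.comp w this
  · rw [hΦx] at hsx; exact hsx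
  · simp
  · intro y hy hyd
    obtain ⟨h1, h2, h3, h4⟩ := hδb hyd
    refine ⟨h3, h4, ?_⟩
    have h5 : g y = 0 := by
      have : y ∈ M ∩ V := ⟨hy, h2⟩
      rw [hMV] at this; exact this.2
    have := e.left_inv h1
    rw [hecoe] at this
    simp only [hΦ, h5] at this
    exact this

end Chart

section Ext

variable {N : ℕ}

/-- squared euclidean norm -/
def Nsq (z : Fin N → ℂ) : ℝ := ∑ i, ‖z i‖ ^ 2

theorem Nsq_cont : Continuous (Nsq (N := N)) := by unfold Nsq; fun_prop

theorem Nsq_nonneg (z : Fin N → ℂ) : 0 ≤ Nsq z := Finset.sum_nonneg fun _ _ => by positivity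

theorem norm_sq_le (z : Fin N → ℂ) : ‖z‖ ^ 2 ≤ Nsq z := by
  have h : ‖z‖ ≤ Real.sqrt (Nsq z) := by
    rw [pi_norm_le_iff_of_nonneg (Real.sqrt_nonneg _)]
    intro i
    apply Real.le_sqrt_of_sq_le
    exact Finset.single_le_sum (f := fun i => ‖z i‖ ^ 2) (fun _ _ => by positivity) (Finset.mem_univ i)
  calc ‖z‖ ^ 2 ≤ Real.sqrt (Nsq z) ^ 2 := by gcongr
    _ = Nsq z := Real.sq_sqrt (Nsq_nonneg z)

theorem Nsq_para (z a : Fin N → ℂ) : Nsq z - 1 / 2 * Nsq (z - a) = 1 / 2 * Nsq (z + a) - Nsq a := by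
  simp only [Nsq]
  rw [Finset.mul_sum, Finset.mul_sum, ← Finset.sum_sub_distrib, ← Finset.sum_sub_distrib]
  refine Finset.sum_congr rfl fun i _ => ?_
  have := parallelogram_law_with_norm ℝ (z i) (a i)
  simp only [Pi.add_apply, Pi.sub_apply]
  nlinarith

theorem Nsq_bdd (s : ℝ) : IsCompact {z : Fin N → ℂ | Nsq z ≤ s} := by
  refine Metric.isCompact_of_isClosed_isBounded (isClosed_le Nsq_cont continuous_const) ?_
  rw [isBounded_iff_forall_norm_le]
  refine ⟨max 1 s, fun z hz => ?_⟩
  by_contra! h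
  have h1 := norm_sq_le z
  have h2 : Nsq z ≤ s := hz
  have h3 := le_max_left 1 s
  have h4 := le_max_right 1 s
  nlinarith

/-- exhaustion with bumps -/
def Psi (ε : ℝ) : List (Fin N → ℂ) → (Fin N → ℂ) → ℝ
  | [], z => Nsq z
  | a :: L, z => max (Psi ε L z) (Nsq z + ε - 1 / 2 * Nsq (z - a))

theorem Psi_cont (ε : ℝ) (L : List (Fin N → ℂ)) : Continuous (Psi ε L) := by
  induction L with
  | nil => exact Nsq_cont
  | cons a L ih =>
    have h1 := Nsq_cont (N := N)
    exact ih.max (by fun_prop)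

theorem Nsq_le_Psi (ε : ℝ) (L : List (Fin N → ℂ)) (z) : Nsq z ≤ Psi ε L z := by
  induction L with
  | nil => exact le_rfl
  | cons a L ih => exact ih.trans (le_max_left _ _)

theorem Psi_le {ε : ℝ} (hε : 0 ≤ ε) (L : List (Fin N → ℂ)) (z) : Psi ε L z ≤ Nsq z + ε := by
  induction L with
  | nil => simpa [Psi] using hε
  | cons a L ih => exact max_le ih (by linarith [Nsq_nonneg (z - a)])

theorem lt_Psi {ε : ℝ} (L : List (Fin N → ℂ)) (z) {a} (ha : a ∈ L) (h : Nsq (z - a) < ε) :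
    Nsq z + ε / 2 < Psi ε L z := by
  induction L with
  | nil => simp at ha
  | cons b L ih =>
    rcases List.mem_cons.1 ha with rfl | ha
    · exact lt_max_of_lt_right (by linarith)
    · exact lt_max_of_lt_left (ih ha)

/-- uniform chart of a curve -/
def LC (X : Set (Fin N → ℂ)) (a : Fin N → ℂ) (δ : ℝ) : Prop :=
  ∃ (h : ℂ → (Fin N → ℂ)) (κ : (Fin N → ℂ) → ℂ) (ρ : ℝ), 0 < ρ ∧ Continuous κ ∧
    (∀ w ∈ Metric.closedBall (0:ℂ) ρ, h w ∈ X ∧ κ (h w) = w ∧ DifferentiableAt ℂ h w) ∧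
    ∀ y ∈ X, dist y a < δ → κ y ∈ Metric.ball 0 (ρ / 2) ∧ h (κ y) = y

theorem Nsq_no_max {h : ℂ → (Fin N → ℂ)} {κ : (Fin N → ℂ) → ℂ} {w0 : ℂ}
    (hd : ∀ᶠ w in 𝓝 w0, DifferentiableAt ℂ h w ∧ κ (h w) = w) (a : Fin N → ℂ) :
    ¬ IsLocalMax (fun w => Nsq (h w + a)) w0 := by
  intro hm
  set f : ℂ → EuclideanSpace ℂ (Fin N) := fun w => WithLp.toLp 2 (h w + a) with hf
  have hfn : ∀ w, ‖f w‖ = Real.sqrt (Nsq (h w + a)) := fun w => by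
    rw [EuclideanSpace.norm_eq]; rfl
  have hfd : ∀ᶠ w in 𝓝 w0, DifferentiableAt ℂ f w := by
    filter_upwards [hd] with w hw
    rw [differentiableAt_euclidean]
    intro i
    have := differentiableAt_pi.1 (hw.1.add_const a) i
    exact this
  have hc : IsLocalMax (norm ∘ f) w0 := by
    filter_upwards [hm] with w hw
    simp only [Function.comp, hfn]
    exact Real.sqrt_le_sqrt hw
  have h1 := Complex.eventually_eq_of_isLocalMax_norm hfd hc
  have h2 : ∀ᶠ w in 𝓝 w0, w = w0 := by
    have h0 := hd.self_of_nhds.2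
    filter_upwards [h1, hd] with w hw hw'
    have : h w + a = h w0 + a := by
      have := congrArg (WithLp.ofLp) hw
      exact this
    rw [← hw'.2, add_right_cancel this, h0]
  obtain ⟨w, hw, hw'⟩ := ((h2.filter_mono nhdsWithin_le_nhds).and
    (self_mem_nhdsWithin (a := w0) (s := {w0}ᶜ))).exists
  exact hw' hw

theorem Psi_no_max {h : ℂ → (Fin N → ℂ)} {κ : (Fin N → ℂ) → ℂ} {w0 : ℂ}
    (hd : ∀ᶠ w in 𝓝 w0, DifferentiableAt ℂ h w ∧ κ (h w) = w) (ε : ℝ) (L : List (Fin N → ℂ)) :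
    ¬ IsLocalMax (fun w => Psi ε L (h w)) w0 := by
  induction L with
  | nil =>
    have := Nsq_no_max hd 0
    simpa [Psi] using this
  | cons a L ih =>
    intro hm
    rcases le_total (Psi ε L (h w0)) (Nsq (h w0) + ε - 1 / 2 * Nsq (h w0 - a)) with hle | hle
    · apply Nsq_no_max hd a
      filter_upwards [hm] with w hw
      simp only [Psi, max_eq_right hle] at hw
      have h1 := (le_max_right _ _).trans hw
      have h2 := Nsq_para (h w) a
      have h3 := Nsq_para (h w0) a
      linarith
    · apply ih
      filter_upwards [hm] with w hw
      simp only [Psi, max_eq_left hle] at hw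
      exact (le_max_left _ _).trans hw

/-- parametrize a square in the disc -/
def sg (ρ : ℝ) (x : ℝ × ℝ) : ℂ := ⟨(2 * x.1 - 1) * (ρ / 2), (2 * x.2 - 1) * (ρ / 2)⟩

/-- inverse of the parametrization -/
def sgi (ρ : ℝ) (w : ℂ) : ℝ × ℝ := ((2 * w.re / ρ + 1) / 2, (2 * w.im / ρ + 1) / 2)

theorem sg_cont (ρ : ℝ) : Continuous (sg ρ) := by
  have : sg ρ = fun x => ((((2 * x.1 - 1) * (ρ / 2) : ℝ)) : ℂ) + (((2 * x.2 - 1) * (ρ / 2) : ℝ)) * Complex.I := by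
    funext x; exact Complex.mk_eq_add_mul_I _ _
  rw [this]; fun_prop

theorem sgi_cont (ρ : ℝ) : Continuous (sgi ρ) := by
  unfold sgi; fun_prop

theorem sg_sgi {ρ : ℝ} (hρ : 0 < ρ) (w : ℂ) : sg ρ (sgi ρ w) = w := by
  apply Complex.ext <;> simp only [sg, sgi] <;> field_simp <;> ring

theorem sgi_sg {ρ : ℝ} (hρ : 0 < ρ) (x : ℝ × ℝ) : sgi ρ (sg ρ x) = x := by
  apply Prod.ext <;> simp only [sg, sgi] <;> field_simp <;> ring

theorem sg_mem {ρ : ℝ} (hρ : 0 < ρ) {x : ℝ × ℝ} (hx : x ∈ Qs) : sg ρ x ∈ Metric.ball (0:ℂ) ρ := by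
  obtain ⟨⟨h1, h2⟩, h3, h4⟩ := hx
  rw [mem_ball_zero_iff, ← sq_lt_sq₀ (norm_nonneg _) hρ.le, Complex.sq_norm, Complex.normSq_apply]
  simp only [sg]
  have e1 : (2 * x.1 - 1) ^ 2 ≤ 1 := by nlinarith
  have e2 : (2 * x.2 - 1) ^ 2 ≤ 1 := by nlinarith
  have e3 : 0 < (ρ / 2) ^ 2 := by positivity
  nlinarith

theorem sgi_mem {ρ : ℝ} (hρ : 0 < ρ) {w : ℂ} (hw : w ∈ Metric.ball (0:ℂ) (ρ / 2)) : sgi ρ w ∈ Qs := by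
  rw [mem_ball_zero_iff] at hw
  have h1 := (Complex.abs_re_le_norm w).trans_lt hw
  have h2 := (Complex.abs_im_le_norm w).trans_lt hw
  rw [abs_lt] at h1 h2
  have key : ∀ r : ℝ, -(ρ / 2) < r → r < ρ / 2 → (2 * r / ρ + 1) / 2 ∈ Icc (0:ℝ) 1 := by
    intro r h1 h2
    have e1 : -1 < 2 * r / ρ := by rw [lt_div_iff₀ hρ]; linarith
    have e2 : 2 * r / ρ < 1 := by rw [div_lt_iff₀ hρ]; linarith
    constructor <;> linarith
  exact ⟨key _ h1.1 h1.2, key _ h2.1 h2.2⟩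

theorem exa_chart {X : Set (Fin N → ℂ)} {a : Fin N → ℂ} {δ : ℝ} (hc : LC X a δ) {ε s s' : ℝ}
    (hs : s' < s) {L : List (Fin N → ℂ)} {f : (Fin N → ℂ) → (Fin N → ℂ) → ℚ}
    (hf : Coc f (X ∩ {z | Psi ε L z < s})) :
    Exa f (X ∩ {z | dist z a < δ ∧ Psi ε L z < s'}) := by
  obtain ⟨h, κ, ρ, hρ, hκ, hh, hy⟩ := hc
  have hcl : ∀ x ∈ Qs, sg ρ x ∈ Metric.closedBall (0:ℂ) ρ := fun x hx =>
    Metric.ball_subset_closedBall (sg_mem hρ hx)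
  have hcont : ContinuousOn (fun x => h (sg ρ x)) Qs := fun x hx =>
    ((hh _ (hcl x hx)).2.2.continuousAt.comp (sg_cont ρ).continuousAt).continuousWithinAt
  have h1 := PL (f := fun x y => f (h (sg ρ x)) (h (sg ρ y))) (Ψ := fun x => Psi ε L (h (sg ρ x)))
    (s := s) (s' := s') ((Psi_cont ε L).comp_continuousOn hcont) (by
      intro x hx hm
      have hxQ : x ∈ Qs := mem_of_mem_nhds hx
      have hopen := Metric.isOpen_ball.eventually_mem (sg_mem hρ hxQ)
      refine Psi_no_max (h := h) (κ := κ) (w0 := sg ρ x) ?_ ε L ?_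
      · filter_upwards [hopen] with w hw
        have := hh w (Metric.ball_subset_closedBall hw)
        exact ⟨this.2.2, this.2.1⟩
      · have hcc : Tendsto (sgi ρ) (𝓝 (sg ρ x)) (𝓝 x) := by
          have := (sgi_cont ρ).tendsto (sg ρ x)
          rwa [sgi_sg hρ] at this
        filter_upwards [hcc.eventually hm] with w hw
        rw [sg_sgi hρ] at hw
        exact hw) hs (hf.pull (hcont.mono fun x hx => hx.1)
      (fun x hx => ⟨(hh _ (hcl x hx.1)).1, hx.2⟩))
  have h2 := h1.pull (φ := fun z => sgi ρ (κ z)) (A' := X ∩ {z | dist z a < δ ∧ Psi ε L z < s'})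
    ((sgi_cont ρ).comp hκ).continuousOn (by
      rintro z ⟨hz, hz1, hz2⟩
      have := hy z hz hz1
      refine ⟨sgi_mem hρ this.1, ?_⟩
      simp only [sg_sgi hρ, this.2]
      exact le_of_lt hz2)
  obtain ⟨g, hg⟩ := h2
  refine ⟨g, hg.congr_left ?_⟩
  rintro z ⟨hz, hz1, hz2⟩ z' ⟨hz', hz1', hz2'⟩
  simp only [sg_sgi hρ, (hy z hz hz1).2, (hy z' hz' hz1').2]

theorem ext_step {X : Set (Fin N → ℂ)} {a : Fin N → ℂ} {δ : ℝ} (hδ : 0 < δ) (hc : LC X a δ)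
    {ε s s' : ℝ} (hε : 0 < ε) (hεδ : 4 * ε ≤ δ ^ 2)
    (hs : s' < s) {L : List (Fin N → ℂ)} {f : (Fin N → ℂ) → (Fin N → ℂ) → ℚ}
    (hf : Coc f (X ∩ {z | Psi ε (a :: L) z < s})) :
    ∃ f', Coc f' (X ∩ {z | Psi ε L z < s'}) ∧
      Exa (fun x y => f' x y - f x y) (X ∩ {z | Psi ε (a :: L) z < s'}) := by
  have hN : Continuous fun z : Fin N → ℂ => Nsq (z - a) := Nsq_cont.comp (by fun_prop)
  obtain ⟨f', h1, h2⟩ := glue (f := f) (X := X) (O1 := {z | Psi ε (a :: L) z < s'})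
    (O2 := {z | Psi ε L z < s'} ∩ {z | Nsq (z - a) < 4 * ε})
    (isOpen_lt (Psi_cont _ _) continuous_const)
    ((isOpen_lt (Psi_cont _ _) continuous_const).inter (isOpen_lt hN continuous_const))
    (hf.mono fun z hz => ⟨hz.1, lt_trans hz.2 hs⟩)
    ((exa_chart hc hs hf).mono (by
      rintro z ⟨hz, hz1, hz2, hz3⟩
      refine ⟨hz, ?_, hz1⟩
      rw [dist_eq_norm]
      have h1 := norm_sq_le (z - a)
      have h2 : Nsq (z - a) < 4 * ε := hz3
      exact lt_of_pow_lt_pow_left₀ 2 hδ.le (by linarith)))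
  refine ⟨f', h1.mono ?_, h2⟩
  rintro z ⟨hz, hz1⟩
  refine ⟨hz, ?_⟩
  by_cases h : Nsq (z - a) < 4 * ε
  · exact Or.inr ⟨hz1, h⟩
  · left
    have hz1' : Psi ε L z < s' := hz1
    refine max_lt hz1' ?_
    have := Nsq_le_Psi ε L z
    linarith

theorem ext_list {X : Set (Fin N → ℂ)} {δ : ℝ} (hδ : 0 < δ)
    {ε : ℝ} (hε : 0 < ε) (hεδ : 4 * ε ≤ δ ^ 2) (L : List (Fin N → ℂ)) (hc : ∀ a ∈ L, LC X a δ) :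
    ∀ {s s' : ℝ} (_ : s' < s) {f : (Fin N → ℂ) → (Fin N → ℂ) → ℚ}
    (_ : Coc f (X ∩ {z | Psi ε L z < s})),
    ∃ f', Coc f' (X ∩ {z | Nsq z < s'}) ∧
      Exa (fun x y => f' x y - f x y) (X ∩ {z | Psi ε L z < s'}) := by
  induction L with
  | nil =>
    intro s s' hs f hf
    exact ⟨f, hf.mono fun z hz => ⟨hz.1, lt_trans hz.2 hs⟩, fun _ => 0, fun x _ =>
      ⟨univ, univ_mem, fun a _ b _ => by simp⟩⟩
  | cons a L ih =>
    intro s s' hs f hf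
    obtain ⟨f1, h1, h2⟩ := ext_step hδ (hc a (by simp)) hε hεδ (s' := (s + s') / 2) (by linarith) hf
    obtain ⟨f2, h3, h4⟩ := ih (fun b hb => hc b (by simp [hb])) (s' := s') (by linarith) h1
    refine ⟨f2, h3, Exa.trans (h4.mono ?_) (h2.mono ?_)⟩
    · rintro z ⟨hz, hz'⟩
      have h : Psi ε (a :: L) z < s' := hz'
      exact ⟨hz, show Psi ε L z < s' from lt_of_le_of_lt (le_max_left _ _) h⟩
    · rintro z ⟨hz, hz'⟩
      have h : Psi ε (a :: L) z < s' := hz'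
      exact ⟨hz, show Psi ε (a :: L) z < (s + s') / 2 by linarith⟩

theorem LC_unif {X K : Set (Fin N → ℂ)} (hK : IsCompact K) (hX : ∀ x ∈ K, ∃ δ > 0, LC X x δ) :
    ∃ δ > 0, ∀ x ∈ K, LC X x δ := by
  choose! δ hδ hc using hX
  obtain ⟨r, hr, H⟩ := lebesgue_number_lemma_of_metric (c := fun x : K => Metric.ball (x : Fin N → ℂ) (δ x)) hK
    (fun _ => Metric.isOpen_ball) (fun x hx => mem_iUnion.2 ⟨⟨x, hx⟩, Metric.mem_ball_self (hδ x hx)⟩)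
  refine ⟨r, hr, fun x hx => ?_⟩
  obtain ⟨i, hi⟩ := H x hx
  obtain ⟨h, κ, ρ, h1, h2, h3, h4⟩ := hc i i.2
  exact ⟨h, κ, ρ, h1, h2, h3, fun y hy hyd => h4 y hy (hi hyd)⟩

theorem ext_main {X : Set (Fin N → ℂ)} (hX : IsClosed X) (hc : ∀ x ∈ X, ∃ δ > 0, LC X x δ)
    {s s' : ℝ} (hs : s' < s) (s1 : ℝ) {f : (Fin N → ℂ) → (Fin N → ℂ) → ℚ}
    (hf : Coc f (X ∩ {z | Nsq z < s})) :
    ∃ f', Coc f' (X ∩ {z | Nsq z < s1}) ∧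
      Exa (fun x y => f' x y - f x y) (X ∩ {z | Nsq z < s'}) := by
  have hE0 : ∀ A : Set (Fin N → ℂ), Exa (fun x y => f x y - f x y) A := fun A => ⟨fun _ => 0, fun x _ =>
      ⟨univ, univ_mem, fun a _ b _ => by simp⟩⟩
  rcases le_total s1 s with hs1 | hs1
  · exact ⟨f, hf.mono fun z hz => ⟨hz.1, lt_of_lt_of_le hz.2 hs1⟩, hE0 _⟩
  have hK : IsCompact (X ∩ {z | Nsq z ≤ s1 + 1}) := (Nsq_bdd _).inter_left hX
  obtain ⟨δ, hδ, hcδ⟩ := LC_unif hK fun x hx => hc x hx.1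
  obtain ⟨ε, hε, hε1, hε2, hε3⟩ : ∃ ε > 0, ε ≤ 1 ∧ ε ≤ s - s' ∧ 4 * ε ≤ δ ^ 2 :=
    ⟨min 1 (min (s - s') (δ ^ 2 / 4)), by
      have : 0 < s - s' := by linarith
      positivity, min_le_left _ _, (min_le_right _ _).trans (min_le_left _ _), by
      have := (min_le_right 1 _).trans (min_le_right (s - s') (δ ^ 2 / 4))
      linarith⟩
  have hN : ∀ a, Continuous fun z : Fin N → ℂ => Nsq (z - a) := fun a => Nsq_cont.comp (by fun_prop)
  obtain ⟨T, hT, hTc⟩ := hK.elim_nhds_subcover (fun a => {z | Nsq (z - a) < ε}) (fun a _ =>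
    (isOpen_lt (hN a) continuous_const).mem_nhds (by simpa [Nsq] using hε))
  have hstep : ∀ (r : ℝ) (f : (Fin N → ℂ) → (Fin N → ℂ) → ℚ), r ≤ s1 → Coc f (X ∩ {z | Nsq z < r}) →
      ∃ f', Coc f' (X ∩ {z | Nsq z < r + ε / 4}) ∧
      Exa (fun x y => f' x y - f x y) (X ∩ {z | Nsq z < r - ε}) := by
    intro r f hr hf
    obtain ⟨f', h1, h2⟩ := ext_list hδ hε hε3 T.toList (fun a ha => hcδ a (hT a (by simpa using ha)))
      (s := r + ε / 2) (s' := r + ε / 4) (by linarith) (f := f) (hf.mono (by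
        rintro z ⟨hz, hz'⟩
        refine ⟨hz, ?_⟩
        have hz2 : Psi ε T.toList z < r + ε / 2 := hz'
        have hz3 := Nsq_le_Psi ε T.toList z
        obtain ⟨a, ha, haz⟩ := mem_iUnion₂.1 (hTc ⟨hz, show Nsq z ≤ s1 + 1 by linarith⟩)
        have := lt_Psi T.toList z (by simpa using ha) haz
        show Nsq z < r
        linarith))
    refine ⟨f', h1, h2.mono ?_⟩
    rintro z ⟨hz, hz'⟩
    have hz2 : Nsq z < r - ε := hz'
    have := Psi_le hε.le T.toList z
    exact ⟨hz, show Psi ε T.toList z < r + ε / 4 by linarith⟩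
  have hind : ∀ k : ℕ, ∃ f', Coc f' (X ∩ {z | Nsq z < min (s + k * (ε / 4)) s1}) ∧
      Exa (fun x y => f' x y - f x y) (X ∩ {z | Nsq z < s'}) := by
    intro k
    induction k with
    | zero => exact ⟨f, hf.mono fun z hz => ⟨hz.1, lt_of_lt_of_le hz.2 ((min_le_left _ _).trans (by simp : s + ((0:ℕ):ℝ) * (ε / 4) ≤ s))⟩, hE0 _⟩
    | succ k ih =>
      obtain ⟨f1, h1, h2⟩ := ih
      obtain ⟨f2, h3, h4⟩ := hstep _ f1 (min_le_right _ _) h1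
      have hle : s ≤ min (s + k * (ε / 4)) s1 := le_min (by
        have : 0 ≤ k * (ε / 4) := by positivity
        linarith) hs1
      refine ⟨f2, h3.mono ?_, Exa.trans (h4.mono ?_) h2⟩
      · rintro z ⟨hz, hz'⟩
        have h : Nsq z < min (s + ((k + 1 : ℕ) : ℝ) * (ε / 4)) s1 := hz'
        refine ⟨hz, show Nsq z < min (s + k * (ε / 4)) s1 + ε / 4 from lt_of_lt_of_le h ?_⟩
        push_cast
        rw [← min_add_add_right, add_one_mul, ← add_assoc]
        exact min_le_min le_rfl (by linarith)
      · rintro z ⟨hz, hz'⟩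
        have h : Nsq z < s' := hz'
        exact ⟨hz, show Nsq z < min (s + k * (ε / 4)) s1 - ε by linarith⟩
  obtain ⟨k, hk⟩ := exists_nat_gt ((s1 - s) / (ε / 4))
  rw [div_lt_iff₀ (by positivity)] at hk
  obtain ⟨f', h1, h2⟩ := hind k
  rw [min_eq_right (by linarith)] at h1
  exact ⟨f', h1, h2⟩

theorem chart_LC {n : ℕ} {M : Set (Fin N → ℂ)} {p : (Fin N → ℂ) → (Fin n → ℂ)} {x0 : Fin N → ℂ}
    (h : HasChart M p x0) : ∃ δ > 0, LC (M ∩ p ⁻¹' {p x0}) x0 δ := by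
  obtain ⟨H, κ, ρ, δ, hρ, hδ, hκ, hc, h1, h2, h2', h3⟩ := h
  refine ⟨δ, hδ, H (p x0), κ, ρ, hρ, hκ, fun w hw => ?_, ?_⟩
  · obtain ⟨e1, e2, e3, e4⟩ := h1 (p x0) (Metric.mem_closedBall_self hρ.le) w hw
    exact ⟨⟨e1, e2⟩, e3, e4⟩
  · rintro y ⟨hy, hy'⟩ hyd
    obtain ⟨e1, e2, e3⟩ := h3 y hy hyd
    have : p y = p x0 := hy'
    rw [this] at e3
    exact ⟨e2, e3⟩

end Ext

section Fam

variable {N n : ℕ} {M : Set (Fin N → ℂ)} {p : (Fin N → ℂ) → (Fin n → ℂ)}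

/-- the fibre -/
abbrev Fb (M : Set (Fin N → ℂ)) (p : (Fin N → ℂ) → (Fin n → ℂ)) (t : Fin n → ℂ) :
    Set (Fin N → ℂ) := M ∩ p ⁻¹' {t}

open Metric in
theorem ulpc (hp : ContinuousOn p M) {x0 : Fin N → ℂ} (hx0 : x0 ∈ M) (h : HasChart M p x0) {ε : ℝ}
    (hε : 0 < ε) : ∃ δ > 0,
      (∀ t, dist t (p x0) < δ → ∃ y ∈ Fb M p t, dist y x0 < ε) ∧
      ∀ t, ∀ a ∈ Fb M p t, dist a x0 < δ → ∀ b ∈ Fb M p t, dist b x0 < δ →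
        ∃ γ, IsP (Fb M p t ∩ ball x0 ε) γ ∧ γ 0 = a ∧ γ 1 = b := by
  obtain ⟨H, κ, ρ, δ, hρ, hδ, hκ, hc, h1, h2, h2', h3⟩ := h
  have hmem : ((p x0, (0:ℂ))) ∈ closedBall (p x0) ρ ×ˢ closedBall (0:ℂ) ρ :=
    ⟨mem_closedBall_self hρ.le, mem_closedBall_self hρ.le⟩
  obtain ⟨η, hη, hη'⟩ := Metric.continuousOn_iff.1 hc _ hmem ε hε
  simp only [h2] at hη'
  have hcl : ∀ t w, dist t (p x0) < min η ρ → dist w 0 < min η ρ → dist (H t w) x0 < ε := by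
    intro t w ht hw
    refine hη' (t, w) ⟨(ht.trans_le (min_le_right _ _)).le, (hw.trans_le (min_le_right _ _)).le⟩ ?_
    rw [Prod.dist_eq, max_lt_iff]
    exact ⟨ht.trans_le (min_le_left _ _), hw.trans_le (min_le_left _ _)⟩
  have hm : 0 < min η ρ := lt_min hη hρ
  obtain ⟨d1, hd1, hd1'⟩ := Metric.continuousOn_iff.1 hp x0 hx0 _ hm
  obtain ⟨d2, hd2, hd2'⟩ := Metric.continuous_iff.1 hκ x0 _ hm
  refine ⟨min (min η ρ) (min δ (min d1 d2)), by positivity, fun t ht => ?_, ?_⟩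
  · have ht' := ht.trans_le (min_le_left _ _)
    obtain ⟨e1, e2, e3, e4⟩ := h1 t (ht'.trans_le (min_le_right _ _)).le 0 (mem_closedBall_self hρ.le)
    exact ⟨H t 0, ⟨e1, e2⟩, hcl t 0 ht' (by simpa using ⟨hη, hρ⟩)⟩
  · rintro t a ⟨ha, rfl⟩ had b ⟨hb, hbt⟩ hbd
    rw [lt_min_iff (b := min η ρ), lt_min_iff (b := δ), lt_min_iff (b := d1)] at had hbd
    have hbt' : p b = p a := hbt
    obtain ⟨a1, a2, a3⟩ := h3 a ha had.2.1
    obtain ⟨b1, b2, b3⟩ := h3 b hb hbd.2.1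
    rw [hbt'] at b3
    have ka := hd2' a had.2.2.2
    have kb := hd2' b hbd.2.2.2
    have pa := hd1' a ha had.2.2.1
    rw [h2'] at ka kb
    have hseg : ∀ s ∈ Icc (0:ℝ) 1, dist (AffineMap.lineMap (k := ℝ) (κ a) (κ b) s) (0:ℂ) < min η ρ := by
      intro s hs
      exact (convex_ball (0:ℂ) (min η ρ)).lineMap_mem ka kb hs
    have hlc : Continuous fun s : ℝ => AffineMap.lineMap (k := ℝ) (κ a) (κ b) s :=
      AffineMap.lineMap_continuous
    refine ⟨fun s => H (p a) (AffineMap.lineMap (k := ℝ) (κ a) (κ b) s), ⟨?_, ?_⟩, ?_, ?_⟩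
    · have hcc : ContinuousOn (fun s : ℝ => ((p a, AffineMap.lineMap (k := ℝ) (κ a) (κ b) s) : (Fin n → ℂ) × ℂ))
          (Icc 0 1) := (by fun_prop : Continuous _).continuousOn
      exact hc.comp hcc fun s hs =>
        ⟨a1, ((hseg s hs).trans_le (min_le_right _ _)).le⟩
    · intro s hs
      have hs' := hseg s hs
      obtain ⟨e1, e2, e3, e4⟩ := h1 (p a) a1 _ (hs'.trans_le (min_le_right _ _)).le
      exact ⟨⟨e1, e2⟩, hcl _ _ pa hs'⟩
    · simp [a3]
    · simp [b3]

open Metric in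
theorem ulpc_unif (hp : ContinuousOn p M) {lam : Fin n → ℂ} (hch : ∀ x ∈ Fb M p lam, HasChart M p x)
    {K : Set (Fin N → ℂ)} (hK : IsCompact K) (hKF : K ⊆ Fb M p lam) {ε : ℝ}
    (hε : 0 < ε) : ∃ δ > 0, ∀ x0 ∈ K,
      (∀ t, dist t lam < δ → ∃ y ∈ Fb M p t, dist y x0 < ε) ∧
      ∀ t, ∀ a ∈ Fb M p t, dist a x0 < δ → ∀ b ∈ Fb M p t, dist b x0 < δ →
        ∃ γ, IsP (Fb M p t ∩ ball x0 ε) γ ∧ γ 0 = a ∧ γ 1 = b := by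
  suffices H : ∃ δ > 0, ∀ x0 ∈ K, x0 ∈ K →
      (∀ t, dist t lam < δ → ∃ y ∈ Fb M p t, dist y x0 < ε) ∧
      ∀ t, ∀ a ∈ Fb M p t, dist a x0 < δ → ∀ b ∈ Fb M p t, dist b x0 < δ →
        ∃ γ, IsP (Fb M p t ∩ ball x0 ε) γ ∧ γ 0 = a ∧ γ 1 = b by
    obtain ⟨δ, h1, h2⟩ := H
    exact ⟨δ, h1, fun x hx => h2 x hx hx⟩
  refine hK.induction_on (p := fun S => ∃ δ > 0, ∀ x0 ∈ S, x0 ∈ K →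
      (∀ t, dist t lam < δ → ∃ y ∈ Fb M p t, dist y x0 < ε) ∧
      ∀ t, ∀ a ∈ Fb M p t, dist a x0 < δ → ∀ b ∈ Fb M p t, dist b x0 < δ →
        ∃ γ, IsP (Fb M p t ∩ ball x0 ε) γ ∧ γ 0 = a ∧ γ 1 = b) ?_ ?_ ?_ ?_
  · exact ⟨1, one_pos, by simp⟩
  · rintro s t hst ⟨δ, h1, h2⟩
    exact ⟨δ, h1, fun x hx => h2 x (hst hx)⟩
  · rintro s t ⟨δ, h1, h2⟩ ⟨δ', h1', h2'⟩
    refine ⟨min δ δ', lt_min h1 h1', ?_⟩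
    rintro x (hx | hx) hxK
    · exact ⟨fun t ht => (h2 x hx hxK).1 t (ht.trans_le (min_le_left _ _)), fun t a ha had b hb hbd =>
        (h2 x hx hxK).2 t a ha (had.trans_le (min_le_left _ _)) b hb (hbd.trans_le (min_le_left _ _))⟩
    · exact ⟨fun t ht => (h2' x hx hxK).1 t (ht.trans_le (min_le_right _ _)), fun t a ha had b hb hbd =>
        (h2' x hx hxK).2 t a ha (had.trans_le (min_le_right _ _)) b hb (hbd.trans_le (min_le_right _ _))⟩
  · intro x hx
    have hxF := hKF hx
    have hpx : p x = lam := hxF.2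
    obtain ⟨δ, hδ, e1, e2⟩ := ulpc hp hxF.1 (hch x hxF) (half_pos hε)
    rw [hpx] at e1
    refine ⟨ball x (min (δ / 2) (ε / 2)), mem_nhdsWithin_of_mem_nhds (ball_mem_nhds _ (by positivity)),
      δ / 2, by positivity, ?_⟩
    intro x0 hx0 _
    rw [mem_ball, lt_min_iff] at hx0
    refine ⟨fun t ht => ?_, fun t a ha had b hb hbd => ?_⟩
    · obtain ⟨y, hy, hyd⟩ := e1 t (by linarith)
      refine ⟨y, hy, ?_⟩
      have := dist_triangle_right y x0 x
      linarith
    · obtain ⟨γ, ⟨g1, g2⟩, g3⟩ := e2 t a ha (by linarith [dist_triangle a x0 x]) b hb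
        (by linarith [dist_triangle b x0 x])
      refine ⟨γ, ⟨g1, fun s hs => ⟨(g2 hs).1, ?_⟩⟩, g3⟩
      have h1 := (g2 hs).2
      rw [mem_ball] at *
      have := dist_triangle_right (γ s) x0 x
      linarith

theorem Fb_closed (hM : IsClosed M) (hp : ContinuousOn p M) (t) : IsClosed (Fb M p t) :=
  hp.preimage_isClosed_of_isClosed hM isClosed_singleton

theorem fb_near (hM : IsClosed M) (hp : ContinuousOn p M) (lam : Fin n → ℂ) {K : Set (Fin N → ℂ)}
    (hK : IsCompact K) {ε : ℝ} (hε : 0 < ε) : ∃ δ > 0, ∀ t, dist t lam < δ → ∀ y ∈ Fb M p t,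
      y ∈ K → ∃ x ∈ Fb M p lam, dist y x < ε := by
  set S : Set (Fin N → ℂ) := K ∩ (M ∩ ⋂ x ∈ Fb M p lam, {y | ε ≤ dist y x}) with hS
  have hSc : IsCompact S := hK.inter_right (hM.inter (isClosed_biInter fun x _ =>
    isClosed_le continuous_const (by fun_prop)))
  have hpS : IsCompact (p '' S) := hSc.image_of_continuousOn (hp.mono fun y hy => hy.2.1)
  have hl : lam ∉ p '' S := by
    rintro ⟨y, hy, hyl⟩
    have h1 := mem_iInter₂.1 hy.2.2 y ⟨hy.2.1, hyl⟩
    simp only [mem_ofPred_eq, dist_self] at h1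
    linarith
  obtain ⟨δ, hδ, hb⟩ := Metric.mem_nhds_iff.1 (hpS.isClosed.isOpen_compl.mem_nhds hl)
  refine ⟨δ, hδ, fun t ht y hy hyK => ?_⟩
  by_contra! hcon
  exact hb (Metric.mem_ball.2 ht) ⟨y, ⟨hyK, hy.1, mem_iInter₂.2 hcon⟩, hy.2⟩

/-- nearby points of nearby fibres get joined -/
def Rj (M : Set (Fin N → ℂ)) (p : (Fin N → ℂ) → (Fin n → ℂ)) (lam : Fin n → ℂ)
    (x x' : Fin N → ℂ) : Prop :=
  ∃ η > 0, ∀ t, dist t lam < η → ∀ a ∈ Fb M p t, dist a x < η → ∀ b ∈ Fb M p t, dist b x' < η →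
    JoinedIn (Fb M p t) a b

theorem IsP.joinedIn {X : Set (Fin N → ℂ)} {γ : ℝ → Fin N → ℂ} (h : IsP X γ) :
    JoinedIn X (γ 0) (γ 1) := JoinedIn.ofLine h.1 rfl rfl h.2.image_subset

theorem rj_of_joined (hp : ContinuousOn p M) {lam : Fin n → ℂ}
    (hch : ∀ x ∈ Fb M p lam, HasChart M p x) {x x' : Fin N → ℂ} (h : JoinedIn (Fb M p lam) x x') :
    Rj M p lam x x' := by
  obtain ⟨γ, hγ⟩ := h
  have hpre : IsPreconnected (range γ) := isPreconnected_range γ.continuous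
  refine hpre.induction₂ (Rj M p lam) ?_ ?_ ?_ ⟨0, γ.source⟩ ⟨1, γ.target⟩
  · rintro _ ⟨s, rfl⟩
    obtain ⟨δ, hδ, e1, e2⟩ := ulpc hp (hγ s).1 (hch _ (hγ s)) one_pos
    filter_upwards [mem_nhdsWithin_of_mem_nhds (Metric.ball_mem_nhds (γ s) (half_pos hδ))] with y hy
    refine ⟨δ / 2, half_pos hδ, fun t ht a ha had b hb hbd => ?_⟩
    rw [Metric.mem_ball] at hy
    obtain ⟨τ, h1, h2, h3⟩ := e2 t a ha (by linarith) b hb (by linarith [dist_triangle b y (γ s)])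
    rw [← h2, ← h3]
    exact h1.joinedIn.mono inter_subset_left
  · rintro a _ c ha ⟨s, rfl⟩ hc ⟨η, hη, h1⟩ ⟨η', hη', h2⟩
    obtain ⟨δ, hδ, e1, e2⟩ := ulpc hp (hγ s).1 (hch _ (hγ s)) (lt_min hη hη')
    have hps : p (γ s) = lam := (hγ s).2
    rw [hps] at e1
    refine ⟨min δ (min η η'), by positivity, fun t ht a ha had b hb hbd => ?_⟩
    rw [lt_min_iff, lt_min_iff] at ht had hbd
    obtain ⟨y, hy, hyd⟩ := e1 t ht.1
    rw [lt_min_iff] at hyd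
    exact (h1 t ht.2.1 a ha had.2.1 y hy hyd.1).trans (h2 t ht.2.2 y hy hyd.2 b hb hbd.2.2)
  · rintro a b ha hb ⟨η, hη, h1⟩
    exact ⟨η, hη, fun t ht a ha had b hb hbd => (h1 t ht b hb hbd a ha had).symm⟩

theorem comp_joined (hp : ContinuousOn p M) {t : Fin n → ℂ}
    (hch : ∀ x ∈ Fb M p t, HasChart M p x) {y z : Fin N → ℂ} (hy : y ∈ Fb M p t)
    (hz : z ∈ connectedComponentIn (Fb M p t) y) : JoinedIn (Fb M p t) y z := by
  have hsub := connectedComponentIn_subset (Fb M p t) y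
  refine isPreconnected_connectedComponentIn.induction₂ (JoinedIn (Fb M p t)) ?_ ?_ ?_
    (mem_connectedComponentIn hy) hz
  · intro x hx
    have hxF := hsub hx
    obtain ⟨δ, hδ, e1, e2⟩ := ulpc hp hxF.1 (hch _ hxF) one_pos
    filter_upwards [mem_nhdsWithin_of_mem_nhds (Metric.ball_mem_nhds x hδ), self_mem_nhdsWithin] with w hw hw'
    obtain ⟨τ, h1, h2, h3⟩ := e2 t x hxF (by simpa using hδ) w (hsub hw') hw
    rw [← h2, ← h3]
    exact h1.joinedIn.mono inter_subset_left
  · intro a b c _ _ _ h1 h2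
    exact h1.trans h2
  · intro a b _ _ h1
    exact h1.symm

theorem b0_le (hM : IsClosed M) (hp : ContinuousOn p M) {lam : Fin n → ℂ} {B : Set (Fin n → ℂ)}
    {D : Set (Fin n → ℂ)} (hD : D ∈ 𝓝 lam) (hDB : D ⊆ B)
    (hch : ∀ x ∈ M, p x ∈ D → HasChart M p x)
    (hfin : FiniteBetti ↥(Fb M p lam) 0)
    (hnv : ¬ HasVanishingComponentAtInfinity M p B lam) :
    ∃ δ > 0, ∀ t, dist t lam < δ → bettiNumber ↥(Fb M p t) 0 ≤ bettiNumber ↥(Fb M p lam) 0 := by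
  classical
  have hchl : ∀ x ∈ Fb M p lam, HasChart M p x := fun x hx => hch x hx.1 (by
    rw [show p x = lam from hx.2]; exact mem_of_mem_nhds hD)
  obtain ⟨δ0, hδ0, hδD⟩ := Metric.mem_nhds_iff.1 hD
  -- no vanishing
  obtain ⟨R, δ1, hδ1, hR⟩ : ∃ R : ℝ, ∃ δ1 > 0, ∀ t ∈ B, dist t lam < δ1 → ∀ y ∈ Fb M p t,
      (connectedComponentIn (Fb M p t) y ∩ Metric.closedBall 0 R).Nonempty := by
    by_contra! hcon
    choose t ht1 ht2 x hx1 hx2 using fun k : ℕ => hcon k (1 / ((k : ℝ) + 1)) (by positivity)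
    apply hnv
    refine ⟨t, x, ht1, ?_, hx1, fun K hK => ?_⟩
    · rw [tendsto_iff_dist_tendsto_zero]
      exact squeeze_zero (fun _ => dist_nonneg) (fun k => (ht2 k).le)
        tendsto_one_div_add_atTop_nhds_zero_nat
    · obtain ⟨r, hr⟩ := hK.isBounded.subset_closedBall 0
      obtain ⟨k0, hk0⟩ := exists_nat_gt r
      filter_upwards [eventually_ge_atTop k0] with k hk
      have hkr : r ≤ k := hk0.le.trans (by exact_mod_cast hk)
      have := hx2 k
      refine subset_empty_iff.1 fun z hz => ?_
      rw [← this]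
      exact ⟨hz.1, Metric.closedBall_subset_closedBall hkr (hr hz.2)⟩
  -- maximal system
  obtain ⟨m, x, hx, hm, hmax⟩ : ∃ (m : ℕ) (x : Fin m → Fin N → ℂ), (∀ i, x i ∈ Fb M p lam) ∧
      m ≤ bettiNumber ↥(Fb M p lam) 0 ∧ ∀ y ∈ Fb M p lam, ∃ i, JoinedIn (Fb M p lam) (x i) y := by
    let P : ℕ → Prop := fun m => ∃ x : Fin m → Fin N → ℂ, (∀ i, x i ∈ Fb M p lam) ∧
      ∀ i j, JoinedIn (Fb M p lam) (x i) (x j) → i = j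
    have hPb : ∀ m, P m → m ≤ bettiNumber ↥(Fb M p lam) 0 := by
      rintro m ⟨x, hx, hx'⟩
      exact ifD _ hfin m x hx hx'
    have hP0 : P 0 := ⟨Fin.elim0, fun i => i.elim0, fun i => i.elim0⟩
    have hPm := Nat.findGreatest_spec (P := P) (Nat.zero_le (bettiNumber ↥(Fb M p lam) 0)) hP0
    set m := Nat.findGreatest P (bettiNumber ↥(Fb M p lam) 0) with hmdef
    obtain ⟨x, hx, hx'⟩ := hPm
    refine ⟨m, x, hx, hPb m ⟨x, hx, hx'⟩, fun y hy => ?_⟩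
    by_contra! hcon
    have hP1 : P (m + 1) := by
      refine ⟨Fin.cons y x, fun i => ?_, fun i j => ?_⟩
      · refine Fin.cases ?_ ?_ i
        · simpa using hy
        · intro i; simpa using hx i
      · refine Fin.cases ?_ ?_ i <;> refine Fin.cases ?_ ?_ j
        · intro _; rfl
        · intro j hj
          simp only [Fin.cons_zero, Fin.cons_succ] at hj
          exact absurd hj.symm (hcon j)
        · intro j hj
          simp only [Fin.cons_zero, Fin.cons_succ] at hj
          exact absurd hj (hcon j)
        · intro i j hj
          simp only [Fin.cons_succ] at hj
          rw [hx' _ _ hj]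
    have := Nat.le_findGreatest (hPb _ hP1) hP1
    omega
  -- uniform joining
  have hKc : IsCompact (Fb M p lam ∩ Metric.closedBall 0 (R + 1)) :=
    (isCompact_closedBall _ _).inter_left (Fb_closed hM hp lam)
  obtain ⟨η, hη, hjoin⟩ : ∃ η > 0, ∀ t, dist t lam < η → ∀ y ∈ Fb M p t,
      ∀ z ∈ Fb M p lam ∩ Metric.closedBall 0 (R + 1), dist y z < η →
      ∃ i, ∀ a ∈ Fb M p t, dist a (x i) < η → JoinedIn (Fb M p t) a y := by
    refine hKc.induction_on (p := fun S => ∃ η > 0, ∀ t, dist t lam < η → ∀ y ∈ Fb M p t,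
      ∀ z ∈ S, dist y z < η →
      ∃ i, ∀ a ∈ Fb M p t, dist a (x i) < η → JoinedIn (Fb M p t) a y) ?_ ?_ ?_ ?_
    · exact ⟨1, one_pos, by simp⟩
    · rintro s t hst ⟨δ, h1, h2⟩
      exact ⟨δ, h1, fun t ht y hy z hz => h2 t ht y hy z (hst hz)⟩
    · rintro s t ⟨δ, h1, h2⟩ ⟨δ', h1', h2'⟩
      refine ⟨min δ δ', lt_min h1 h1', ?_⟩
      rintro t ht y hy z (hz | hz) hyz
      · obtain ⟨i, hi⟩ := h2 t (ht.trans_le (min_le_left _ _)) y hy z hz (hyz.trans_le (min_le_left _ _))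
        exact ⟨i, fun a ha had => hi a ha (had.trans_le (min_le_left _ _))⟩
      · obtain ⟨i, hi⟩ := h2' t (ht.trans_le (min_le_right _ _)) y hy z hz (hyz.trans_le (min_le_right _ _))
        exact ⟨i, fun a ha had => hi a ha (had.trans_le (min_le_right _ _))⟩
    · intro z hz
      obtain ⟨i, hi⟩ := hmax z hz.1
      obtain ⟨η, hη, hj⟩ := rj_of_joined hp hchl hi
      refine ⟨Metric.ball z (η / 2), mem_nhdsWithin_of_mem_nhds (Metric.ball_mem_nhds _ (half_pos hη)),
        η / 2, half_pos hη, fun t ht y hy z' hz' hyz => ⟨i, fun a ha had => ?_⟩⟩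
      rw [Metric.mem_ball] at hz'
      exact hj t (by linarith) a ha (by linarith) y hy (by linarith [dist_triangle y z' z])
  obtain ⟨δ2, hδ2, hnear⟩ := fb_near hM hp lam (isCompact_closedBall (0 : Fin N → ℂ) R) (lt_min hη one_pos)
  obtain ⟨δ3, hδ3, hl⟩ := ulpc_unif hp hchl (K := range x) (finite_range x).isCompact
    (by rintro _ ⟨i, rfl⟩; exact hx i) hη
  refine ⟨min (min δ0 δ1) (min η (min δ2 δ3)), by positivity, fun t ht => ?_⟩
  simp only [lt_min_iff] at ht
  obtain ⟨⟨ht0, ht1⟩, htη, ht2, ht3⟩ := ht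
  have htD : t ∈ D := hδD ht0
  have hcht : ∀ x ∈ Fb M p t, HasChart M p x := fun x hx => hch x hx.1 (by
    rw [show p x = t from hx.2]; exact htD)
  choose l hl1 hl2 using fun i => (hl (x i) ⟨i, rfl⟩).1 t ht3
  refine (ifC (Fb M p t) m l hl1 fun y hy => ?_).trans hm
  obtain ⟨z, hz1, hz2⟩ := hR t (hDB htD) ht1 y hy
  have hzF := connectedComponentIn_subset _ _ hz1
  obtain ⟨w, hw, hwz⟩ := hnear t ht2 z hzF hz2
  rw [lt_min_iff] at hwz
  obtain ⟨i, hi⟩ := hjoin t htη z hzF w ⟨hw, by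
    rw [Metric.mem_closedBall] at *
    linarith [dist_triangle_left w 0 z]⟩ hwz.1
  exact ⟨i, (hi (l i) (hl1 i) (hl2 i)).trans (comp_joined hp hcht hy hz1).symm⟩

end Fam

section TRs

variable {N n : ℕ} {M : Set (Fin N → ℂ)} {p : (Fin N → ℂ) → (Fin n → ℂ)}

/-- triangle relation -/
def TR (X : Set (Fin N → ℂ)) (L : (ℝ → Fin N → ℂ) → ℚ) : Prop :=
  (∀ φ : ℝ × ℝ → Fin N → ℂ, ContinuousOn φ T2 → MapsTo φ T2 X →
        L (edg0 φ) - L (edg1 φ) + L (edg2 φ) = 0) ∧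
  ∀ γ γ', EqOn γ γ' (Icc 0 1) → L γ = L γ'

theorem TR.const {X : Set (Fin N → ℂ)} {L} (h : TR X L) {x} (hx : x ∈ X) : L (fun _ => x) = 0 := by
  have := h.1 (fun _ => x) continuousOn_const fun _ _ => hx
  have e0 : edg0 (fun _ : ℝ × ℝ => x) = fun _ => x := rfl
  have e1 : edg1 (fun _ : ℝ × ℝ => x) = fun _ => x := rfl
  have e2 : edg2 (fun _ : ℝ × ℝ => x) = fun _ => x := rfl
  rw [e0, e1, e2] at this
  linarith

theorem TR.piece {X : Set (Fin N → ℂ)} {L} (h : TR X L) {γ} (hγ : IsP X γ) {y y' : ℝ}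
    (hy : y ∈ Icc (0:ℝ) 1) (hy' : y' ∈ Icc (0:ℝ) 1) :
    L (fun t => γ ((1 - t) * y + t * y')) = L (fun t => γ (t * y')) - L (fun t => γ (t * y)) := by
  have hm : MapsTo (fun w : ℝ × ℝ => w.1 * y + w.2 * y') T2 (Icc 0 1) := by
    rintro w ⟨h1, h2, h3⟩
    obtain ⟨a1, a2⟩ := hy
    obtain ⟨b1, b2⟩ := hy'
    constructor
    · positivity
    · dsimp only; nlinarith
  have := h.1 (fun w => γ (w.1 * y + w.2 * y')) (hγ.1.comp (by fun_prop) hm) (hγ.2.comp hm)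
  have e0 : edg0 (fun w : ℝ × ℝ => γ (w.1 * y + w.2 * y')) = fun t => γ ((1 - t) * y + t * y') := rfl
  have e1 : edg1 (fun w : ℝ × ℝ => γ (w.1 * y + w.2 * y')) = fun t => γ (t * y') := by
    funext t; simp [edg1]
  have e2 : edg2 (fun w : ℝ × ℝ => γ (w.1 * y + w.2 * y')) = fun t => γ (t * y) := by
    funext t; simp [edg2]
  rw [e0, e1, e2] at this
  linarith

theorem TR.sum {X : Set (Fin N → ℂ)} {L} (h : TR X L) {γ} (hγ : IsP X γ) {ν : ℕ} (hν : 0 < ν) :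
    ∑ k ∈ Finset.range ν, L (fun t => γ ((1 - t) * ((k : ℝ) / ν) + t * (((k + 1 : ℕ) : ℝ) / ν))) = L γ := by
  have hν' : (0:ℝ) < ν := by exact_mod_cast hν
  have hI : ∀ k : ℕ, k ≤ ν → (k : ℝ) / ν ∈ Icc (0:ℝ) 1 := fun k hk => by
    refine ⟨by positivity, ?_⟩
    rw [div_le_one hν']; exact_mod_cast hk
  refine (Finset.sum_congr rfl ?_).trans
    ((Finset.sum_range_sub (fun k : ℕ => L (fun t => γ (t * ((k : ℝ) / ν)))) ν).trans ?_)
  rotate_left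
  · simp only [div_self hν'.ne', mul_one, Nat.cast_zero, zero_div, mul_zero]
    rw [h.const (hγ.2 (by simp)), sub_zero]
  · intro k hk
    rw [Finset.mem_range] at hk
    exact h.piece hγ (hI k hk.le) (hI (k + 1) hk)

theorem TR.square {X : Set (Fin N → ℂ)} {L} (h : TR X L) {φ : ℝ × ℝ → Fin N → ℂ}
    (hc : ContinuousOn φ Qs) (hm : MapsTo φ Qs X) :
    L (fun t => φ (t, 0)) + L (fun t => φ (1, t)) = L (fun t => φ (0, t)) + L (fun t => φ (t, 1)) := by
  have m1 : MapsTo (fun w : ℝ × ℝ => (w.1 + w.2, w.2)) T2 Qs := by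
    rintro w ⟨h1, h2, h3⟩
    exact ⟨⟨by positivity, h3⟩, h2, by linarith⟩
  have m2 : MapsTo (fun w : ℝ × ℝ => (w.2, w.1 + w.2)) T2 Qs := by
    rintro w ⟨h1, h2, h3⟩
    exact ⟨⟨h2, by linarith⟩, by positivity, h3⟩
  have t1 := h.1 (fun w => φ (w.1 + w.2, w.2)) (hc.comp (by fun_prop) m1) (hm.comp m1)
  have t2 := h.1 (fun w => φ (w.2, w.1 + w.2)) (hc.comp (by fun_prop) m2) (hm.comp m2)
  have a0 : edg0 (fun w : ℝ × ℝ => φ (w.1 + w.2, w.2)) = fun t => φ (1, t) := by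
    funext t; simp [edg0]
  have a1 : edg1 (fun w : ℝ × ℝ => φ (w.1 + w.2, w.2)) = fun t => φ (t, t) := by
    funext t; simp [edg1]
  have a2 : edg2 (fun w : ℝ × ℝ => φ (w.1 + w.2, w.2)) = fun t => φ (t, 0) := by
    funext t; simp [edg2]
  have b0 : edg0 (fun w : ℝ × ℝ => φ (w.2, w.1 + w.2)) = fun t => φ (t, 1) := by
    funext t; simp [edg0]
  have b1 : edg1 (fun w : ℝ × ℝ => φ (w.2, w.1 + w.2)) = fun t => φ (t, t) := by
    funext t; simp [edg1]
  have b2 : edg2 (fun w : ℝ × ℝ => φ (w.2, w.1 + w.2)) = fun t => φ (0, t) := by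
    funext t; simp [edg2]
  rw [a0, a1, a2] at t1
  rw [b0, b1, b2] at t2
  linarith

theorem TR.loc {X : Set (Fin N → ℂ)} {L} (h : TR X L) {x0 : Fin N → ℂ} {δ : ℝ} (hc : LC X x0 δ) :
    ∃ g : (Fin N → ℂ) → ℚ, ∀ γ, IsP (X ∩ Metric.ball x0 δ) γ → L γ = g (γ 1) - g (γ 0) := by
  obtain ⟨hh, κ, ρ, hρ, hκ, h1, h2⟩ := hc
  refine ⟨fun y => L (fun s : ℝ => hh (s * κ y)), fun γ hγ => ?_⟩
  have hb : ∀ u ∈ Icc (0:ℝ) 1, κ (γ u) ∈ Metric.ball (0:ℂ) (ρ / 2) ∧ hh (κ (γ u)) = γ u :=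
    fun u hu => h2 _ (hγ.2 hu).1 (hγ.2 hu).2
  have hin : ∀ w ∈ Qs, (w.1 : ℂ) * κ (γ w.2) ∈ Metric.closedBall (0:ℂ) ρ := by
    rintro w ⟨hw1, hw2⟩
    have := (hb w.2 hw2).1
    rw [mem_ball_zero_iff] at this
    rw [mem_closedBall_zero_iff, norm_mul, Complex.norm_real, Real.norm_of_nonneg hw1.1]
    have := norm_nonneg (κ (γ w.2))
    nlinarith [hw1.2, hw1.1]
  have hcont : ContinuousOn (fun w : ℝ × ℝ => (w.1 : ℂ) * κ (γ w.2)) Qs := by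
    refine ContinuousOn.mul (by fun_prop) (hκ.comp_continuousOn ?_)
    exact hγ.1.comp continuousOn_snd fun w hw => hw.2
  have hsq := h.square (φ := fun w => hh (w.1 * κ (γ w.2))) (fun w hw =>
    ContinuousAt.comp_continuousWithinAt (f := fun w : ℝ × ℝ => (w.1 : ℂ) * κ (γ w.2))
      (h1 _ (hin w hw)).2.2.continuousAt (hcont w hw)) (fun w hw => (h1 _ (hin w hw)).1)
  have e1 : L (fun t : ℝ => hh ((((1:ℝ), t) : ℝ × ℝ).1 * κ (γ (((1:ℝ), t) : ℝ × ℝ).2))) = L γ := by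
    apply h.2
    intro u hu
    simp [(hb u hu).2]
  have e2 : L (fun t : ℝ => hh ((((0:ℝ), t) : ℝ × ℝ).1 * κ (γ (((0:ℝ), t) : ℝ × ℝ).2))) = 0 := by
    simp only [Complex.ofReal_zero, zero_mul]
    exact h.const (h1 0 (Metric.mem_closedBall_self hρ.le)).1
  rw [e1, e2] at hsq
  dsimp only at hsq ⊢
  linarith

theorem lemF (hM : IsClosed M) (hp : ContinuousOn p M) {lam : Fin n → ℂ}
    (hch : ∀ x ∈ Fb M p lam, HasChart M p x) {K : Set (Fin N → ℂ)} (hK : IsCompact K) :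
    ∃ δ > 0, ∀ L, TR (Fb M p lam) L → ∃ f : (Fin N → ℂ) → (Fin N → ℂ) → ℚ,
      ∀ x ∈ Fb M p lam, x ∈ K → ∃ g : (Fin N → ℂ) → ℚ,
        (∀ a ∈ Fb M p lam, dist a x < δ → ∀ b ∈ Fb M p lam, dist b x < δ → f a b = g b - g a) ∧
        ∀ γ, IsP (Fb M p lam ∩ Metric.ball x δ) γ → L γ = g (γ 1) - g (γ 0) := by
  classical
  have hKc : IsCompact (Fb M p lam ∩ K) := hK.inter_left (Fb_closed hM hp lam)
  obtain ⟨δ1, hδ1, hc⟩ := LC_unif (X := Fb M p lam) hKc (fun x hx => by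
    have := chart_LC (hch x hx.1)
    rwa [show p x = lam from hx.1.2] at this)
  obtain ⟨δ3, hδ3, hu⟩ := ulpc_unif hp hch hKc inter_subset_left (ε := δ1 / 4) (by positivity)
  refine ⟨min δ3 (δ1 / 4), by positivity, fun L hL => ?_⟩
  let P : (Fin N → ℂ) → (Fin N → ℂ) → (ℝ → Fin N → ℂ) → Prop := fun a b γ =>
    IsP (Fb M p lam ∩ Metric.ball a (δ1 / 2)) γ ∧ γ 0 = a ∧ γ 1 = b
  refine ⟨fun a b => if h : ∃ γ, P a b γ then L h.choose else 0, fun x hx hxK => ?_⟩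
  obtain ⟨g, hg⟩ := hL.loc (hc x ⟨hx, hxK⟩)
  refine ⟨g, fun a ha had b hb hbd => ?_, fun γ hγ => hg γ ⟨hγ.1, fun s hs => ⟨(hγ.2 hs).1, ?_⟩⟩⟩
  · rw [lt_min_iff] at had hbd
    have hex : ∃ γ, P a b γ := by
      obtain ⟨γ, h1, h2⟩ := (hu x ⟨hx, hxK⟩).2 lam a ha had.1 b hb hbd.1
      refine ⟨γ, ⟨h1.1, fun s hs => ⟨(h1.2 hs).1, ?_⟩⟩, h2⟩
      have := (h1.2 hs).2
      rw [Metric.mem_ball] at *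
      linarith [dist_triangle_right (γ s) a x]
    show (if h : ∃ γ, P a b γ then L h.choose else 0) = g b - g a
    rw [dif_pos hex]
    obtain ⟨h1, h2, h3⟩ := hex.choose_spec
    rw [hg hex.choose ⟨h1.1, fun s hs => ⟨(h1.2 hs).1, ?_⟩⟩, h2, h3]
    have := (h1.2 hs).2
    rw [Metric.mem_ball] at *
    linarith [dist_triangle (hex.choose s) a x]
  · have := (hγ.2 hs).2
    rw [Metric.mem_ball, lt_min_iff] at this
    rw [Metric.mem_ball]
    linarith

end TRs

section Fin10

variable {N n : ℕ} {M : Set (Fin N → ℂ)} {p : (Fin N → ℂ) → (Fin n → ℂ)}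

theorem b1_core {X Y K K0 : Set (Fin N → ℂ)} (hY : IsClosed Y) (hYc : ∀ x ∈ Y, ∃ δ > 0, LC Y x δ)
    (hYf : FiniteBetti ↥Y 1) {b m : ℕ} (γ : Fin m → ℝ → Fin N → ℂ) (q : Fin b → Fin m → ℚ)
    (L : Fin b → (ℝ → Fin N → ℂ) → ℚ)
    (hγ : ∀ k, IsP X (γ k)) (hq : ∀ i (u : (Fin N → ℂ) → ℚ), ∑ k, q i k * (u (γ k 1) - u (γ k 0)) = 0)
    (hL : ∀ j, TR X (L j)) (hd : ∀ i j, ∑ k, q i k * L j (γ k) = if i = j then 1 else 0)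
    {S0 δ η ε1 : ℝ} (hη : 0 < η) (hηδ : 4 * η ≤ δ) (hηε : η ≤ ε1) (hεδ : ε1 ≤ δ / 2)
    (hK0X : K0 ⊆ X) (hK0K : K0 ⊆ K) (hγ0 : ∀ k, MapsTo (γ k) (Icc 0 1) K0)
    (hf : ∀ j, ∃ f : (Fin N → ℂ) → (Fin N → ℂ) → ℚ,
      ∀ x ∈ X, x ∈ K → ∃ g : (Fin N → ℂ) → ℚ,
        (∀ a ∈ X, dist a x < δ → ∀ b ∈ X, dist b x < δ → f a b = g b - g a) ∧
        ∀ γ, IsP (X ∩ Metric.ball x δ) γ → L j γ = g (γ 1) - g (γ 0))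
    (hr : ∀ y ∈ Y, Nsq y < S0 + 1 → ∃ x ∈ X, x ∈ K ∧ dist y x < η)
    (hl : ∀ x ∈ K0, ∃ y ∈ Y, dist y x < η)
    (hball : ∀ x ∈ K0, ∀ y, dist y x < ε1 → Nsq y < S0)
    (hpath : ∀ x ∈ K0, ∀ a ∈ Y, dist a x < 2 * η → ∀ b ∈ Y, dist b x < 2 * η →
      ∃ τ, IsP (Y ∩ Metric.ball x ε1) τ ∧ τ 0 = a ∧ τ 1 = b)
    {ν : ℕ} (hν : 0 < ν)
    (huc : ∀ k, ∀ u ∈ Icc (0:ℝ) 1, ∀ u' ∈ Icc (0:ℝ) 1, dist u u' ≤ 1 / ν → dist (γ k u) (γ k u') < η) :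
    b ≤ bettiNumber ↥Y 1 := by
  have hν' : (0:ℝ) < ν := by exact_mod_cast hν
  have hI : ∀ k : ℕ, k ≤ ν → (k : ℝ) / ν ∈ Icc (0:ℝ) 1 := fun k hk => by
    refine ⟨by positivity, ?_⟩
    rw [div_le_one hν']; exact_mod_cast hk
  have hr' : ∀ y, ∃ x, y ∈ Y → Nsq y < S0 + 1 → x ∈ X ∧ x ∈ K ∧ dist y x < η := fun y => by
    by_cases h : y ∈ Y ∧ Nsq y < S0 + 1
    · obtain ⟨x, hx⟩ := hr y h.1 h.2
      exact ⟨x, fun _ _ => hx⟩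
    · exact ⟨y, fun h1 h2 => absurd ⟨h1, h2⟩ h⟩
  choose r hr2 using hr'
  have hl' : ∀ x, ∃ y, x ∈ K0 → y ∈ Y ∧ dist y x < η := fun x => by
    by_cases h : x ∈ K0
    · obtain ⟨y, hy⟩ := hl x h
      exact ⟨y, fun _ => hy⟩
    · exact ⟨x, fun h1 => absurd h1 h⟩
  choose l hl2 using hl'
  choose f hf2 using hf
  set pt : Fin m → ℕ → Fin N → ℂ := fun k s => γ k ((s : ℝ) / ν) with hpt
  have hpt0 : ∀ k s, s ≤ ν → pt k s ∈ K0 := fun k s hs => hγ0 k (hI s hs)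
  have hstep : ∀ k s, s < ν → dist (pt k (s + 1)) (pt k s) < η := fun k s hs => by
    refine huc k _ (hI (s + 1) hs) _ (hI s hs.le) (le_of_eq ?_)
    rw [Real.dist_eq, ← sub_div, Nat.cast_add, Nat.cast_one, add_sub_cancel_left, abs_of_pos (by positivity)]
  have hτ : ∀ k s, ∃ τ : ℝ → Fin N → ℂ, s < ν → IsP (Y ∩ Metric.ball (pt k s) ε1) τ ∧
      τ 0 = l (pt k s) ∧ τ 1 = l (pt k (s + 1)) := fun k s => by
    by_cases h : s < ν
    · obtain ⟨τ, h'⟩ := hpath (pt k s) (hpt0 k s h.le) (l (pt k s)) (hl2 _ (hpt0 k s h.le)).1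
        (by linarith [(hl2 _ (hpt0 k s h.le)).2]) (l (pt k (s + 1))) (hl2 _ (hpt0 k (s + 1) h)).1
        (by linarith [(hl2 _ (hpt0 k (s + 1) h)).2, hstep k s h,
              dist_triangle (l (pt k (s + 1))) (pt k (s + 1)) (pt k s)])
      exact ⟨τ, fun _ => h'⟩
    · exact ⟨fun _ => 0, fun h' => absurd h' h⟩
  choose τ hτ2 using hτ
  have hsum : ∀ (F : Fin m → ℕ → ℚ) (i : Fin b),
      ∑ k : Fin (m * ν), q i (finProdFinEquiv.symm k).1 * F (finProdFinEquiv.symm k).1 (finProdFinEquiv.symm k).2 =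
      ∑ k, q i k * ∑ s ∈ Finset.range ν, F k s := fun F i => by
    rw [Equiv.sum_comp finProdFinEquiv.symm (fun x : Fin m × Fin ν => q i x.1 * F x.1 x.2),
      Fintype.sum_prod_type]
    refine Finset.sum_congr rfl fun k _ => ?_
    rw [Finset.mul_sum, ← Fin.sum_univ_eq_sum_range (fun s => q i k * F k s)]
  have htel : ∀ (u : (Fin N → ℂ) → ℚ) (i : Fin b),
      ∑ k, q i k * ∑ s ∈ Finset.range ν, (u (pt k (s + 1)) - u (pt k s)) = 0 := fun u i => by
    rw [← hq i u]
    refine Finset.sum_congr rfl fun k _ => ?_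
    rw [Finset.sum_range_sub (fun s => u (pt k s))]
    simp [hpt, div_self hν'.ne']
  have key : ∀ j k s, s < ν → Intg (fun a c => f j (r a) (r c)) (τ k s) =
      L j (fun t => γ k ((1 - t) * ((s : ℝ) / ν) + t * (((s + 1 : ℕ) : ℝ) / ν))) +
      ((fun x => f j x (r (l x))) (pt k (s + 1)) - (fun x => f j x (r (l x))) (pt k s)) := by
    intro j k s hs
    have hx0 := hpt0 k s hs.le
    have hx1 := hpt0 k (s + 1) hs
    obtain ⟨g, hg1, hg2⟩ := hf2 j (pt k s) (hK0X hx0) (hK0K hx0)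
    obtain ⟨hτp, hτ0, hτ1⟩ := hτ2 k s hs
    have hpr : Prm (fun a c => f j (r a) (r c)) (Y ∩ Metric.ball (pt k s) ε1) (fun y => g (r y)) := by
      have : ∀ a ∈ Y ∩ Metric.ball (pt k s) ε1, r a ∈ X ∧ dist (r a) (pt k s) < δ := fun a ha => by
        have ha2 := Metric.mem_ball.1 ha.2
        obtain ⟨h1, h2, h3⟩ := hr2 a ha.1 (by linarith [hball _ hx0 a ha2])
        exact ⟨h1, by linarith [dist_triangle_left (r a) (pt k s) a]⟩
      intro x _
      refine ⟨univ, univ_mem, fun a ha c hc => ?_⟩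
      exact hg1 _ (this a ha.2).1 (this a ha.2).2 _ (this c hc.2).1 (this c hc.2).2
    rw [Intg_prm hpr hτp, hτ0, hτ1]
    have hu : ∀ t ∈ Icc (0:ℝ) 1, (1 - t) * ((s : ℝ) / ν) + t * (((s + 1 : ℕ) : ℝ) / ν) ∈ Icc (0:ℝ) 1 ∧
        dist ((1 - t) * ((s : ℝ) / ν) + t * (((s + 1 : ℕ) : ℝ) / ν)) ((s : ℝ) / ν) ≤ 1 / ν := by
      rintro t ⟨ht0, ht1⟩
      obtain ⟨a1, a2⟩ := hI s hs.le
      obtain ⟨b1, b2⟩ := hI (s + 1) hs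
      refine ⟨⟨by nlinarith, by nlinarith⟩, ?_⟩
      rw [Real.dist_eq, show (1 - t) * ((s : ℝ) / ν) + t * (((s + 1 : ℕ) : ℝ) / ν) - (s : ℝ) / ν = t * (1 / ν) by
        push_cast; ring, abs_of_nonneg (by positivity)]
      exact mul_le_of_le_one_left (by positivity) ht1
    have hpc : IsP (X ∩ Metric.ball (pt k s) δ)
        (fun t => γ k ((1 - t) * ((s : ℝ) / ν) + t * (((s + 1 : ℕ) : ℝ) / ν))) := by
      refine ⟨(hγ k).1.comp (by fun_prop) fun t ht => (hu t ht).1, fun t ht => ⟨(hγ k).2 (hu t ht).1, ?_⟩⟩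
      rw [Metric.mem_ball]
      linarith [huc k _ (hu t ht).1 _ (hI s hs.le) (hu t ht).2]
    rw [hg2 _ hpc]
    have hrl : ∀ x ∈ K0, r (l x) ∈ X ∧ dist (r (l x)) x < 2 * η := fun x hx => by
      obtain ⟨h1, h2⟩ := hl2 x hx
      obtain ⟨h3, h4, h5⟩ := hr2 (l x) h1 (by linarith [hball x hx (l x) (by linarith)])
      exact ⟨h3, by linarith [dist_triangle_left (r (l x)) x (l x)]⟩
    have v0 := hg1 _ (hK0X hx0) (by rw [dist_self]; linarith) _ (hrl _ hx0).1 (by linarith [(hrl _ hx0).2])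
    have v1 := hg1 _ (hK0X hx1) (by linarith [hstep k s hs]) _ (hrl _ hx1).1
      (by linarith [(hrl _ hx1).2, hstep k s hs, dist_triangle (r (l (pt k (s+1)))) (pt k (s+1)) (pt k s)])
    dsimp only
    rw [v0, v1]
    simp only [sub_self, zero_mul, one_mul, zero_add, sub_zero, add_zero]
    simp only [hpt]
    ring
  refine ifB Y hYf b (m * ν) (fun k => τ (finProdFinEquiv.symm k).1 (finProdFinEquiv.symm k).2)
    (fun i k => q i (finProdFinEquiv.symm k).1) ?_ ?_ ?_
  · intro k
    have := (hτ2 (finProdFinEquiv.symm k).1 (finProdFinEquiv.symm k).2 (finProdFinEquiv.symm k).2.2).1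
    exact ⟨this.1, fun s hs => (this.2 hs).1⟩
  · intro i u
    rw [hsum (fun k s => u (τ k s 1) - u (τ k s 0)), ← htel (fun x => u (l x)) i]
    refine Finset.sum_congr rfl fun k _ => ?_
    congr 1
    refine Finset.sum_congr rfl fun s hs => ?_
    rw [(hτ2 k s (Finset.mem_range.1 hs)).2.1, (hτ2 k s (Finset.mem_range.1 hs)).2.2]
  · intro K' hK' hKc
    obtain ⟨S1, hS1⟩ : ∃ S1, ∀ y ∈ K', Nsq y < S1 := by
      obtain ⟨C, hC⟩ := hKc.bddAbove_image (Nsq_cont (N := N)).continuousOn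
      exact ⟨C + 1, fun y hy => by linarith [hC (mem_image_of_mem _ hy)]⟩
    have hco : ∀ j, Coc (fun a c => f j (r a) (r c)) (Y ∩ {z | Nsq z < S0 + 1}) := by
      rintro j y ⟨hy, hy2⟩
      obtain ⟨h1, h2, h3⟩ := hr2 y hy hy2
      obtain ⟨g, hg1, -⟩ := hf2 j (r y) h1 h2
      have : ∀ a ∈ Metric.ball y η ∩ (Y ∩ {z | Nsq z < S0 + 1}), r a ∈ X ∧ dist (r a) (r y) < δ := by
        rintro a ⟨ha, ha1, ha2⟩
        obtain ⟨h4, h5, h6⟩ := hr2 a ha1 ha2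
        rw [Metric.mem_ball] at ha
        exact ⟨h4, by linarith [dist_triangle_left (r a) y a, dist_triangle (r a) y (r y)]⟩
      refine ⟨Metric.ball y η, Metric.ball_mem_nhds y hη, fun z => g (r z), fun a ha c hc => ?_⟩
      exact hg1 _ (this a ha).1 (this a ha).2 _ (this c hc).1 (this c hc).2
    have hext := fun j => ext_main hY hYc (show S0 < S0 + 1 by linarith) S1 (hco j)
    choose f' hf' G hG using hext
    refine ⟨fun j => Intg (f' j), fun j φ hφ hφ' => Intg_tri (hf' j) hφ
      fun w hw => ⟨hK' (hφ' hw), hS1 _ (hφ' hw)⟩, fun j _ _ h => Intg_congr h, fun i j => ?_⟩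
    rw [hsum (fun k s => Intg (f' j) (τ k s)), ← hd i j]
    have e1 := htel (fun x => f j x (r (l x))) i
    have e2 := htel (fun x => G j (l x)) i
    have e3 : ∑ k, q i k * ∑ s ∈ Finset.range ν, Intg (f' j) (τ k s) =
        ∑ k, q i k * L j (γ k) +
        ∑ k, q i k * ∑ s ∈ Finset.range ν, ((fun x => f j x (r (l x))) (pt k (s + 1)) - (fun x => f j x (r (l x))) (pt k s)) +
        ∑ k, q i k * ∑ s ∈ Finset.range ν, ((fun x => G j (l x)) (pt k (s + 1)) - (fun x => G j (l x)) (pt k s)) := by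
      rw [← Finset.sum_add_distrib, ← Finset.sum_add_distrib]
      refine Finset.sum_congr rfl fun k _ => ?_
      rw [← (hL j).sum (hγ k) hν, ← mul_add, ← mul_add, ← Finset.sum_add_distrib, ← Finset.sum_add_distrib]
      congr 1
      refine Finset.sum_congr rfl fun s hs => ?_
      rw [Finset.mem_range] at hs
      obtain ⟨hτp, hτ0, hτ1⟩ := hτ2 k s hs
      rw [← key j k s hs, Intg_sub ((hco j).mono (A := Y ∩ {z | Nsq z < S0})
        (fun z hz => ⟨hz.1, lt_trans hz.2 (show S0 < S0 + 1 by linarith)⟩)) (hG j)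
        ⟨hτp.1, fun w hw => ⟨(hτp.2 hw).1, hball _ (hpt0 k s hs.le) _ (Metric.mem_ball.1 (hτp.2 hw).2)⟩⟩, hτ0, hτ1]
    rw [e3, e1, e2, add_zero, add_zero]

end Fin10

section Fin11

variable {N n : ℕ} {M : Set (Fin N → ℂ)} {p : (Fin N → ℂ) → (Fin n → ℂ)}

theorem b1_ge (hM : IsClosed M) (hp : ContinuousOn p M) {D : Set (Fin n → ℂ)} {lam : Fin n → ℂ}
    (hD : D ∈ 𝓝 lam) (hch : ∀ x ∈ M, p x ∈ D → HasChart M p x)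
    (hfin : ∀ t ∈ D, FiniteBetti ↥(Fb M p t) 1) :
    ∃ δ > 0, ∀ t, dist t lam < δ →
      bettiNumber ↥(Fb M p lam) 1 ≤ bettiNumber ↥(Fb M p t) 1 := by
  have hlamD := mem_of_mem_nhds hD
  have hchF : ∀ t ∈ D, ∀ x ∈ Fb M p t, HasChart M p x := fun t ht x hx =>
    hch x hx.1 (by rw [show p x = t from hx.2]; exact ht)
  obtain ⟨m, γ, q, L, hγ, hq, hL1, hL2, hd⟩ := ifA _ (hfin lam hlamD)
  set K0 : Set (Fin N → ℂ) := ⋃ k, γ k '' Icc 0 1 with hK0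
  have hK0c : IsCompact K0 := isCompact_iUnion fun k => isCompact_Icc.image_of_continuousOn (hγ k).1
  have hK0X : K0 ⊆ Fb M p lam := by
    rw [hK0]
    exact iUnion_subset fun k => (hγ k).2.image_subset
  have hγ0 : ∀ k, MapsTo (γ k) (Icc 0 1) K0 := fun k u hu => mem_iUnion.2 ⟨k, mem_image_of_mem _ hu⟩
  obtain ⟨S0, hS0⟩ : ∃ S0, ∀ y ∈ K0, Nsq y < S0 := by
    obtain ⟨C, hC⟩ := hK0c.bddAbove_image (Nsq_cont (N := N)).continuousOn
    exact ⟨C + 1, fun y hy => by linarith [hC (mem_image_of_mem _ hy)]⟩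
  obtain ⟨ε0, hε0, hth⟩ := hK0c.exists_thickening_subset_open
    (isOpen_lt (Nsq_cont (N := N)) continuous_const) (t := {z | Nsq z < S0}) hS0
  set A : Set (Fin N → ℂ) := {z | Nsq z ≤ S0 + 1} with hA
  have hAc : IsCompact A := Nsq_bdd _
  obtain ⟨δ, hδ, hF⟩ := lemF hM hp (hchF lam hlamD) (hAc.cthickening (r := 1))
  set ε1 := min ε0 (δ / 2) with hε1
  have hε1p : 0 < ε1 := by positivity
  obtain ⟨δu, hδu, hu⟩ := ulpc_unif hp (hchF lam hlamD) hK0c hK0X hε1p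
  set η := min (min 1 (δ / 4)) (min (δu / 2) ε1) with hη
  have hηp : 0 < η := by positivity
  have hη1 : η ≤ 1 := (min_le_left _ _).trans (min_le_left _ _)
  have hη2 : η ≤ δ / 4 := (min_le_left _ _).trans (min_le_right _ _)
  have hη3 : η ≤ δu / 2 := (min_le_right _ _).trans (min_le_left _ _)
  have hη4 : η ≤ ε1 := (min_le_right _ _).trans (min_le_right _ _)
  obtain ⟨δl, hδl, hl⟩ := ulpc_unif hp (hchF lam hlamD) hK0c hK0X hηp
  obtain ⟨δr, hδr, hr⟩ := fb_near hM hp lam hAc hηp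
  obtain ⟨δD, hδD, hDb⟩ := Metric.mem_nhds_iff.1 hD
  have hun : ∀ k, ∃ ρ > 0, ∀ u ∈ Icc (0:ℝ) 1, ∀ u' ∈ Icc (0:ℝ) 1, dist u u' < ρ →
      dist (γ k u) (γ k u') < η := fun k =>
    Metric.uniformContinuousOn_iff.1 (isCompact_Icc.uniformContinuousOn_of_continuous (hγ k).1) η hηp
  choose ρ hρ hun using hun
  obtain ⟨ρ0, hρ0, hρ0'⟩ : ∃ ρ0 > 0, ∀ k, ρ0 < ρ k := by
    have : ∀ᶠ x : ℝ in 𝓝[>] 0, ∀ k, x < ρ k := by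
      rw [eventually_all]
      exact fun k => nhdsWithin_le_nhds (gt_mem_nhds (hρ k))
    obtain ⟨x, hx, hx0⟩ := (this.and self_mem_nhdsWithin).exists
    exact ⟨x, hx0, hx⟩
  obtain ⟨ν, hν⟩ := exists_nat_one_div_lt hρ0
  refine ⟨min δl (min δr δD), by positivity, fun t ht => ?_⟩
  rw [lt_min_iff, lt_min_iff] at ht
  obtain ⟨ht1, ht2, ht3⟩ := ht
  have htD : t ∈ D := hDb ht3
  refine b1_core (X := Fb M p lam) (K := Metric.cthickening 1 A) (K0 := K0) (S0 := S0) (δ := δ) (η := η)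
    (ε1 := ε1) (ν := ν + 1)
    (Fb_closed hM hp t) (fun x hx => ?_) (hfin t htD) γ q L hγ hq (fun j => ⟨hL1 j, hL2 j⟩) hd
    hηp (by linarith) hη4 (min_le_right _ _) hK0X (fun x hx => ?_) hγ0
    (fun j => hF (L j) ⟨hL1 j, hL2 j⟩) ?_ ?_ ?_ ?_ (Nat.succ_pos ν) ?_
  · have := chart_LC (hchF t htD x hx)
    rwa [show p x = t from hx.2] at this
  · exact Metric.self_subset_cthickening A (show Nsq x ≤ S0 + 1 by linarith [hS0 x hx])
  · intro y hy hy1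
    obtain ⟨x, hx, hxd⟩ := hr t ht2 y hy hy1.le
    refine ⟨x, hx, Metric.mem_cthickening_of_dist_le x y 1 A hy1.le ?_, hxd⟩
    rw [dist_comm]; linarith
  · exact fun x hx => (hl x hx).1 t ht1
  · intro x hx y hy
    exact hth (Metric.mem_thickening_iff.2 ⟨x, hx, hy.trans_le (min_le_left _ _)⟩)
  · exact fun x hx a ha had b hb hbd => (hu x hx).2 t a ha (by linarith) b hb (by linarith)
  · intro k u hu u' hu' hd
    refine hun k u hu u' hu' ?_
    push_cast at hd
    linarith [hρ0' k]

end Fin11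

/-- Under the hypotheses of Statement 1 (holomorphic `p : M → B` from a
connected Stein manifold of dimension `n+1`, finite Betti numbers of fibres, `λ` interior
to `Im p \ closure (p (Sing p))`, constant Euler characteristic near `λ`, no vanishing of
components at infinity at `λ`), both Betti numbers `b₀(t)` and `b₁(t)` are constant for
`t` in some neighborhood of `λ`. -/
theorem statement6 (N n : ℕ) (hn : 1 ≤ n) (hNn : n + 1 ≤ N)
    (M : Set (Fin N → ℂ)) (hMstein : IsSteinSubmanifold N (n + 1) M)
    (hMconn : IsConnected M)
    (B : Set (Fin n → ℂ)) (hBopen : IsOpen B) (hBconn : IsConnected B)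
    (p : (Fin N → ℂ) → (Fin n → ℂ))
    (hphol : ∃ U, IsOpen U ∧ M ⊆ U ∧ DifferentiableOn ℂ p U)
    (hpmaps : Set.MapsTo p M B)
    (hbetti : ∀ t ∈ B, FiniteBetti ↥(M ∩ p ⁻¹' {t}) 0 ∧ FiniteBetti ↥(M ∩ p ⁻¹' {t}) 1)
    (lam : Fin n → ℂ)
    (hlam : lam ∈ interior ((p '' M) \
      closure (p '' {x ∈ M | ¬ SubmersionAt (N - (n + 1)) M p x})))
    (hchi : ∃ U, IsOpen U ∧ lam ∈ U ∧ U ⊆ B ∧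
      ∀ t ∈ U, eulerCharOn p M t = eulerCharOn p M lam)
    (hnv : ¬ HasVanishingComponentAtInfinity M p B lam) :
    ∃ U, IsOpen U ∧ lam ∈ U ∧ U ⊆ B ∧
      ∀ t ∈ U, bettiNumber ↥(M ∩ p ⁻¹' {t}) 0 = bettiNumber ↥(M ∩ p ⁻¹' {lam}) 0 ∧
        bettiNumber ↥(M ∩ p ⁻¹' {t}) 1 = bettiNumber ↥(M ∩ p ⁻¹' {lam}) 1 := by
  obtain ⟨U0, hU0, hMU, hdiff⟩ := hphol
  obtain ⟨U, hU, hlU, hUB, hchi⟩ := hchi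
  have hM : IsClosed M := hMstein.1
  have hp : ContinuousOn p M := hdiff.continuousOn.mono hMU
  set I := interior ((p '' M) \ closure (p '' {x ∈ M | ¬ SubmersionAt (N - (n + 1)) M p x})) with hI
  have hD : U ∩ I ∈ 𝓝 lam := (hU.inter isOpen_interior).mem_nhds ⟨hlU, hlam⟩
  have hch : ∀ x ∈ M, p x ∈ U ∩ I → HasChart M p x := by
    intro x hx hpx
    refine chart_lemma hNn hU0 hMU hdiff hx ?_
    by_contra hs
    exact (interior_subset hpx.2).2 (subset_closure ⟨x, ⟨hx, hs⟩, rfl⟩)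
  obtain ⟨δ0, hδ0, h0⟩ := b0_le hM hp hD (inter_subset_left.trans hUB) hch (hbetti lam (hUB hlU)).1 hnv
  obtain ⟨δ1, hδ1, h1⟩ := b1_ge hM hp hD hch (fun t ht => (hbetti t (hUB ht.1)).2)
  refine ⟨U ∩ (Metric.ball lam δ0 ∩ Metric.ball lam δ1), hU.inter (Metric.isOpen_ball.inter Metric.isOpen_ball),
    ⟨hlU, Metric.mem_ball_self hδ0, Metric.mem_ball_self hδ1⟩, inter_subset_left.trans hUB, ?_⟩
  rintro t ⟨htU, ht0, ht1⟩
  have e0 := h0 t ht0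
  have e1 := h1 t ht1
  have e2 := hchi t htU
  unfold eulerCharOn at e2
  simp only [Fb] at e0 e1
  omega

end
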